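/- arXiv:1406.1323 — 6 statements merged into one kernel-verified Lean document; each statement's English description precedes it below -/
import Mathlib

section
/- Let R be a commutative Noetherian ring, M a finitely generated R-module, and a an ideal of R. Then the finiteness dimension satisfies f_a(M) = inf{f_{aR_p}(M_p) : p ∈ Spec(R)} (Faltings' local-global principle for finiteness dimensions). -/
open CategoryTheory

universe u

/-- Carrier of the `i`-th local cohomology module `H^i_a(M)` with support in `V(a)`. -/
noncomputable def locH (R : Type u) [CommRing R] (a : Ideal R) (i : ℕ)
    (M : Type u) [AddCommGroup M] [Module R M] : ModuleCat R :=
  (localCohomology a i).obj (ModuleCat.of R M)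

/-- Krull dimension of the support of a module. -/
noncomputable def dimSupp (R : Type u) [CommRing R]
    (M : Type u) [AddCommGroup M] [Module R M] : WithBot ℕ∞ :=
  Order.krullDim (Module.support R M)

/-- `f_a^b(M) = inf{i : b^n H^i_a(M) ≠ 0 for all n}`, the `b`-finiteness dimension
of `M` relative to `a` (`inf ∅ = ⊤`). -/
noncomputable def fab (R : Type u) [CommRing R] (a b : Ideal R)
    (M : Type u) [AddCommGroup M] [Module R M] : ℕ∞ :=
  sInf ((↑) '' {i : ℕ |
    ∀ n : ℕ, b ^ n • (⊤ : Submodule R (locH R a i M)) ≠ ⊥})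

/-- `f_a^b(M)_n = inf{i : dim Supp (b^t H^i_a(M)) ≥ n for all t}`. -/
noncomputable def fabn (R : Type u) [CommRing R] (a b : Ideal R)
    (M : Type u) [AddCommGroup M] [Module R M] (n : ℕ) : ℕ∞ :=
  sInf ((↑) '' {i : ℕ |
    ∀ t : ℕ, (n : WithBot ℕ∞) ≤ dimSupp R ↥(b ^ t • (⊤ : Submodule R (locH R a i M)))})

/-- `f_a^b(M)^n = inf{f_{aR_p}^{bR_p}(M_p) : p ∈ Spec R, dim R/p ≥ n}`. -/
noncomputable def fabUpper (R : Type u) [CommRing R] (a b : Ideal R)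
    (M : Type u) [AddCommGroup M] [Module R M] (n : ℕ) : ℕ∞ :=
  sInf {d : ℕ∞ | ∃ p : PrimeSpectrum R, (n : WithBot ℕ∞) ≤ ringKrullDim (R ⧸ p.asIdeal) ∧
    d = fab (Localization.AtPrime p.asIdeal)
      (a.map (algebraMap R (Localization.AtPrime p.asIdeal)))
      (b.map (algebraMap R (Localization.AtPrime p.asIdeal)))
      (LocalizedModule p.asIdeal.primeCompl M)}

/-- `f_a(M) = inf{i : H^i_a(M) is not finitely generated}`, the finiteness dimension. -/
noncomputable def finDim (R : Type u) [CommRing R] (a : Ideal R)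
    (M : Type u) [AddCommGroup M] [Module R M] : ℕ∞ :=
  sInf ((↑) '' {i : ℕ | ¬ Module.Finite R (locH R a i M)})

/-- The `i`-th Ext module `Ext^i_R(N, N')`. -/
noncomputable def extMod (R : Type u) [CommRing R] (i : ℕ)
    (N : Type u) [AddCommGroup N] [Module R N]
    (N' : Type u) [AddCommGroup N'] [Module R N'] : ModuleCat R :=
  ((Ext R (ModuleCat.{u} R) i).obj (Opposite.op (ModuleCat.of R N))).obj (ModuleCat.of R N')

/-- `N` is `b`-cofinite: `Supp N ⊆ V(b)` and `Ext^i_R(R/b, N)` is finitely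
generated for all `i ≥ 0`. -/
def IsCofinite (R : Type u) [CommRing R] (b : Ideal R)
    (N : Type u) [AddCommGroup N] [Module R N] : Prop :=
  Module.support R N ⊆ PrimeSpectrum.zeroLocus (b : Set R) ∧
    ∀ i : ℕ, Module.Finite R (extMod R i (R ⧸ b) N)

/-- `c_a^b(M) = inf{i : H^i_a(M) is not b-cofinite}`, the `b`-cofiniteness dimension. -/
noncomputable def cofDim (R : Type u) [CommRing R] (a b : Ideal R)
    (M : Type u) [AddCommGroup M] [Module R M] : ℕ∞ :=
  sInf ((↑) '' {i : ℕ | ¬ IsCofinite R b (locH R a i M)})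

/-- `depth(b, M)`: the supremum of lengths of `M`-regular sequences contained in `b`
(the common length of maximal `M`-regular sequences in `b`). -/
noncomputable def mdepth (R : Type u) [CommRing R] (b : Ideal R)
    (M : Type u) [AddCommGroup M] [Module R M] : ℕ∞ :=
  sSup {d : ℕ∞ | ∃ rs : List R, d = rs.length ∧ (∀ r ∈ rs, r ∈ b) ∧
    RingTheory.Sequence.IsRegular M rs}

/-- `f_a^n(M) = inf{f_{aR_p}(M_p) : p ∈ Supp(M/aM), dim R/p ≥ n}`. -/
noncomputable def fan (R : Type u) [CommRing R] (a : Ideal R)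
    (M : Type u) [AddCommGroup M] [Module R M] (n : ℕ) : ℕ∞ :=
  sInf {d : ℕ∞ | ∃ p : PrimeSpectrum R,
    p ∈ Module.support R (M ⧸ (a • ⊤ : Submodule R M)) ∧
    (n : WithBot ℕ∞) ≤ ringKrullDim (R ⧸ p.asIdeal) ∧
    d = finDim (Localization.AtPrime p.asIdeal)
      (a.map (algebraMap R (Localization.AtPrime p.asIdeal)))
      (LocalizedModule p.asIdeal.primeCompl M)}

/-- `M` is in dimension `< n`: there is a finitely generated submodule `N ⊆ M`
with `dim Supp (M/N) < n`. -/
def InDimLT (R : Type u) [CommRing R] (n : ℕ)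
    (M : Type u) [AddCommGroup M] [Module R M] : Prop :=
  ∃ N : Submodule R M, N.FG ∧ dimSupp R (M ⧸ N) < (n : WithBot ℕ∞)


namespace FLT

variable (R : Type u) [CommRing R] (a : Ideal R)

/-- The quotient map `R/a^n → R/a^m` for `m ≤ n`. -/
def trM (m n : ℕ) (h : m ≤ n) :
    ModuleCat.of R (R ⧸ a ^ n) ⟶ ModuleCat.of R (R ⧸ a ^ m) :=
  ModuleCat.ofHom (Submodule.mapQ _ _ LinearMap.id (Ideal.pow_le_pow_right h))

lemma trM_comp (l m n : ℕ) (h : l ≤ m) (h' : m ≤ n) :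
    trM R a m n h' ≫ trM R a l m h = trM R a l n (h.trans h') := by
  refine ModuleCat.hom_ext (LinearMap.ext fun x => ?_)
  obtain ⟨x, rfl⟩ := Submodule.Quotient.mk_surjective _ x
  rfl

/-- The Ext modules of the system. -/
abbrev EX (i : ℕ) (M : Type u) [AddCommGroup M] [Module R M] (n : ℕ) : Type u :=
  Abelian.Ext.{u} (ModuleCat.of R (R ⧸ a ^ n)) (ModuleCat.of R M) i

/-- Transition maps. -/
noncomputable def trE (i : ℕ) (M : Type u) [AddCommGroup M] [Module R M] (m n : ℕ) (h : m ≤ n) :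
    EX R a i M m →ₗ[R] EX R a i M n where
  toFun x := (Abelian.Ext.mk₀ (trM R a m n h)).comp x (zero_add _)
  map_add' := by simp
  map_smul' := by simp

instance (i : ℕ) (M : Type u) [AddCommGroup M] [Module R M] :
    DirectedSystem (EX R a i M) (fun m n h => trE R a i M m n h) where
  map_self n x := by
    have : trM R a n n le_rfl = 𝟙 _ := by
      refine ModuleCat.hom_ext (LinearMap.ext fun x => ?_)
      obtain ⟨x, rfl⟩ := Submodule.Quotient.mk_surjective _ x
      rfl
    simp [trE, this]
  map_map k j i hij hjk x := by
    simp [trE, Abelian.Ext.mk₀_comp_mk₀_assoc, trM_comp]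

/-- Local cohomology as a direct limit of (derived category) Ext modules. -/
abbrev HH (i : ℕ) (M : Type u) [AddCommGroup M] [Module R M] : Type u :=
  Module.DirectLimit (EX R a i M) (trE R a i M)

noncomputable abbrev hof (i : ℕ) (M : Type u) [AddCommGroup M] [Module R M] (n : ℕ) :
    EX R a i M n →ₗ[R] HH R a i M :=
  Module.DirectLimit.of R ℕ (EX R a i M) (trE R a i M) n

section
variable {R a}
variable {M N L : Type u} [AddCommGroup M] [Module R M] [AddCommGroup N] [Module R N]
  [AddCommGroup L] [Module R L]

lemma hof_surj {i : ℕ} (z : HH R a i M) : ∃ n x, hof R a i M n x = z :=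
  Module.DirectLimit.exists_of z

lemma hof_eq_zero {i n : ℕ} {x : EX R a i M n} (h : hof R a i M n x = 0) :
    ∃ m, ∃ h : n ≤ m, trE R a i M n m h x = 0 :=
  Module.DirectLimit.of.zero_exact h

lemma hof_tr {i n m : ℕ} (x : EX R a i M n) (h : n ≤ m) :
    hof R a i M m (trE R a i M n m h x) = hof R a i M n x :=
  Module.DirectLimit.of_f

/-- composition with an Ext class -/
noncomputable def Ecomp {i j k : ℕ} (α : Abelian.Ext.{u} (ModuleCat.of R M) (ModuleCat.of R N) j) (h : i + j = k)
    (n : ℕ) : EX R a i M n →ₗ[R] EX R a k N n where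
  toFun x := x.comp α h
  map_add' := by simp
  map_smul' := by simp

variable (a) in
noncomputable def Hcomp {i j k : ℕ} (α : Abelian.Ext.{u} (ModuleCat.of R M) (ModuleCat.of R N) j) (h : i + j = k) :
    HH R a i M →ₗ[R] HH R a k N :=
  Module.DirectLimit.map (Ecomp α h) (by
    intro m n hmn
    ext x
    simp [Ecomp, trE, Abelian.Ext.comp_assoc_of_second_deg_zero]
    rw [Abelian.Ext.comp_assoc]; all_goals lia)

lemma Hcomp_hof {i j k : ℕ} (α : Abelian.Ext.{u} (ModuleCat.of R M) (ModuleCat.of R N) j) (h : i + j = k)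
    (n : ℕ) (x : EX R a i M n) : Hcomp a α h (hof R a i M n x) = hof R a k N n (x.comp α h) :=
  Module.DirectLimit.map_apply_of _ _ _

variable (a) in
/-- functoriality -/
noncomputable def Hmap (i : ℕ) (f : M →ₗ[R] N) : HH R a i M →ₗ[R] HH R a i N :=
  Hcomp a (Abelian.Ext.mk₀ (ModuleCat.ofHom f)) (add_zero i)

lemma Hmap_hof (i : ℕ) (f : M →ₗ[R] N) (n : ℕ) (x : EX R a i M n) :
    Hmap a i f (hof R a i M n x) =
      hof R a i N n (x.comp (Abelian.Ext.mk₀ (ModuleCat.ofHom f)) (add_zero i)) :=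
  Hcomp_hof _ _ _ _

lemma Hmap_smul (i : ℕ) (r : R) (z : HH R a i M) :
    Hmap a i (r • (LinearMap.id : M →ₗ[R] M)) z = r • z := by
  obtain ⟨n, x, rfl⟩ := hof_surj z
  rw [Hmap_hof, ← map_smul, Abelian.Ext.smul_eq_comp_mk₀]
  rfl

/-- the short complex -/
noncomputable def sc (f : M →ₗ[R] N) (g : N →ₗ[R] L) (h : Function.Exact f g) :
    ShortComplex (ModuleCat.{u} R) :=
  ShortComplex.mk (ModuleCat.ofHom f) (ModuleCat.ofHom g) (by
    ext x; exact h.apply_apply_eq_zero x)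

lemma sc_exact {f : M →ₗ[R] N} {g : N →ₗ[R] L} (hf : Function.Injective f) (h : Function.Exact f g)
    (hg : Function.Surjective g) : (sc f g h).ShortExact where
  exact := (ShortComplex.ShortExact.moduleCat_exact_iff_function_exact _).mpr h
  mono_f := (ModuleCat.mono_iff_injective _).mpr hf
  epi_g := (ModuleCat.epi_iff_surjective _).mpr hg

section LES
variable {f : M →ₗ[R] N} {g : N →ₗ[R] L} (hf : Function.Injective f) (h : Function.Exact f g)
    (hg : Function.Surjective g)

noncomputable def dcl : Abelian.Ext.{u} (ModuleCat.of R L) (ModuleCat.of R M) 1 :=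
  (sc_exact hf h hg).extClass

lemma ex1 (X : ModuleCat.{u} R) (i : ℕ) (x : Abelian.Ext.{u} X (ModuleCat.of R M) (i+1))
    (hx : x.comp (Abelian.Ext.mk₀ (ModuleCat.ofHom f)) (add_zero _) = 0) :
    ∃ y : Abelian.Ext.{u} X (ModuleCat.of R L) i, y.comp (dcl hf h hg) rfl = x :=
  Abelian.Ext.covariant_sequence_exact₁ _ (sc_exact hf h hg) x hx rfl

lemma ex2 {f : M →ₗ[R] N} {g : N →ₗ[R] L} (hf : Function.Injective f) (h : Function.Exact f g)
    (hg : Function.Surjective g) (X : ModuleCat.{u} R) (i : ℕ) (x : Abelian.Ext.{u} X (ModuleCat.of R N) i)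
    (hx : x.comp (Abelian.Ext.mk₀ (ModuleCat.ofHom g)) (add_zero _) = 0) :
    ∃ y : Abelian.Ext.{u} X (ModuleCat.of R M) i,
      y.comp (Abelian.Ext.mk₀ (ModuleCat.ofHom f)) (add_zero _) = x :=
  Abelian.Ext.covariant_sequence_exact₂ _ (sc_exact hf h hg) x hx

lemma ex3 (X : ModuleCat.{u} R) (i : ℕ) (x : Abelian.Ext.{u} X (ModuleCat.of R L) i)
    (hx : x.comp (dcl hf h hg) rfl = 0) :
    ∃ y : Abelian.Ext.{u} X (ModuleCat.of R N) i,
      y.comp (Abelian.Ext.mk₀ (ModuleCat.ofHom g)) (add_zero _) = x :=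
  Abelian.Ext.covariant_sequence_exact₃ _ (sc_exact hf h hg) x rfl hx

lemma comp_dcl : (Abelian.Ext.mk₀ (ModuleCat.ofHom g)).comp (dcl hf h hg) (zero_add 1) = 0 :=
      (sc_exact hf h hg).comp_extClass
lemma dcl_comp : (dcl hf h hg).comp (Abelian.Ext.mk₀ (ModuleCat.ofHom f)) (add_zero 1) = 0 :=
      (sc_exact hf h hg).extClass_comp

variable (a) in
/-- connecting map -/
noncomputable def Hδ (i : ℕ) : HH R a i L →ₗ[R] HH R a (i+1) M :=
  Hcomp a (dcl hf h hg) rfl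

lemma Hδ_hof (i n : ℕ) (x : EX R a i L n) :
    Hδ a hf h hg i (hof R a i L n x) = hof R a (i+1) M n (x.comp (dcl hf h hg) rfl) :=
  Hcomp_hof _ _ _ _

lemma les2 {f : M →ₗ[R] N} {g : N →ₗ[R] L} (hf : Function.Injective f) (h : Function.Exact f g)
    (hg : Function.Surjective g) (i : ℕ) : Function.Exact (Hmap a i f) (Hmap a i g) := by
  intro z
  constructor
  · intro hz
    obtain ⟨n, x, rfl⟩ := hof_surj z
    rw [Hmap_hof] at hz
    obtain ⟨m, hm, hx⟩ := hof_eq_zero hz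
    obtain ⟨y, hy⟩ := ex2 hf h hg _ _ (trE R a i N n m hm x) (by
        rw [← hx]
        simp [trE])
    refine ⟨hof R a i M m y, ?_⟩
    rw [Hmap_hof, ← hof_tr x hm, ← hy]
  · rintro ⟨w, rfl⟩
    obtain ⟨n, x, rfl⟩ := hof_surj w
    have : ModuleCat.ofHom f ≫ ModuleCat.ofHom g = 0 := (sc f g h).zero
    simp only [Hmap_hof]
    rw [Abelian.Ext.comp_assoc_of_third_deg_zero, Abelian.Ext.mk₀_comp_mk₀, this]
    simp

lemma les3 (i : ℕ) : Function.Exact (Hmap a i g) (Hδ a hf h hg i) := by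
  intro z
  constructor
  · intro hz
    obtain ⟨n, x, rfl⟩ := hof_surj z
    rw [Hδ_hof] at hz
    obtain ⟨m, hm, hx⟩ := hof_eq_zero hz
    obtain ⟨y, hy⟩ := ex3 hf h hg _ _ (trE R a i L n m hm x) (by
        rw [← hx]
        simp only [trE, LinearMap.coe_mk, AddHom.coe_mk]
        rw [Abelian.Ext.comp_assoc]; all_goals lia)
    refine ⟨hof R a i N m y, ?_⟩
    rw [Hmap_hof, ← hof_tr x hm, ← hy]
  · rintro ⟨w, rfl⟩
    obtain ⟨n, x, rfl⟩ := hof_surj w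
    simp only [Hmap_hof, Hδ_hof]
    rw [Abelian.Ext.comp_assoc_of_second_deg_zero, comp_dcl]
    simp

lemma les1 (i : ℕ) : Function.Exact (Hδ a hf h hg i) (Hmap a (i+1) f) := by
  intro z
  constructor
  · intro hz
    obtain ⟨n, x, rfl⟩ := hof_surj z
    rw [Hmap_hof] at hz
    obtain ⟨m, hm, hx⟩ := hof_eq_zero hz
    obtain ⟨y, hy⟩ := ex1 hf h hg _ _ (trE R a (i+1) M n m hm x) (by
        rw [← hx]
        simp [trE])
    refine ⟨hof R a i L m y, ?_⟩
    rw [Hδ_hof, ← hof_tr x hm, ← hy]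
  · rintro ⟨w, rfl⟩
    obtain ⟨n, x, rfl⟩ := hof_surj w
    simp only [Hmap_hof, Hδ_hof]
    rw [Abelian.Ext.comp_assoc_of_third_deg_zero, dcl_comp]
    simp

end LES

lemma HH_inj [Module.Injective R M] (i : ℕ) (z : HH R a (i+1) M) : z = 0 := by
  obtain ⟨n, x, rfl⟩ := hof_surj z
  have : Injective (ModuleCat.of R M) := Module.injective_object_of_injective_module R M
  rw [Abelian.Ext.eq_zero_of_injective x, map_zero]

lemma HH_tors (i : ℕ) (z : HH R a i M) : ∃ n, ∀ r ∈ a ^ n, r • z = 0 := by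
  obtain ⟨n, x, rfl⟩ := hof_surj z
  refine ⟨n, fun r hr => ?_⟩
  have : r • 𝟙 (ModuleCat.of R (R ⧸ a ^ n)) = 0 := by
    refine ModuleCat.hom_ext (LinearMap.ext fun x => ?_)
    obtain ⟨x, rfl⟩ := Submodule.Quotient.mk_surjective _ x
    change Submodule.Quotient.mk (r • x) = 0
    rw [Submodule.Quotient.mk_eq_zero]
    exact Ideal.mul_mem_right _ _ hr
  rw [← map_smul, ← Abelian.Ext.mk₀_id_comp x, ← Abelian.Ext.smul_comp, ← Abelian.Ext.mk₀_smul, this]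
  simp

variable (R a M) in
/-- The comparison `H^0 → M`. -/
noncomputable def H0 : HH R a 0 M →ₗ[R] M :=
  Module.DirectLimit.lift R ℕ _ _ (fun n =>
    { toFun x := (Abelian.Ext.linearEquiv₀ (R := R) x).hom (Submodule.Quotient.mk 1)
      map_add' := by simp
      map_smul' := by simp } ) (by
    intro m n h x
    obtain ⟨x, rfl⟩ := (Abelian.Ext.linearEquiv₀ (R := R)).symm.surjective x
    have : trE R a 0 M m n h (Abelian.Ext.linearEquiv₀ (R := R).symm x) = 
      Abelian.Ext.linearEquiv₀ (R := R).symm (trM R a m n h ≫ x) := by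
      simp [trE]
    simp only [LinearMap.coe_mk, AddHom.coe_mk, this, LinearEquiv.apply_symm_apply]
    rfl)

lemma H0_hof (n : ℕ) (x : ModuleCat.of R (R ⧸ a ^ n) ⟶ ModuleCat.of R M) :
    H0 R a M (hof R a 0 M n (Abelian.Ext.mk₀ x)) = x.hom (Submodule.Quotient.mk 1) := by
  have : Abelian.Ext.mk₀ x = Abelian.Ext.linearEquiv₀ (R := R).symm x := rfl
  rw [this, H0, Module.DirectLimit.lift_of]
  simp only [LinearMap.coe_mk, AddHom.coe_mk, LinearEquiv.apply_symm_apply]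

lemma hof0_surj (z : HH R a 0 M) : ∃ (n : ℕ) (x : ModuleCat.of R (R ⧸ a ^ n) ⟶ ModuleCat.of R M),
    hof R a 0 M n (Abelian.Ext.mk₀ x) = z := by
  obtain ⟨n, x, rfl⟩ := hof_surj z
  obtain ⟨x, rfl⟩ := (Abelian.Ext.linearEquiv₀ (R := R)).symm.surjective x
  exact ⟨n, x, rfl⟩

lemma H0_inj : Function.Injective (H0 R a M) := by
  rw [← LinearMap.ker_eq_bot, LinearMap.ker_eq_bot']
  intro z hz
  obtain ⟨n, x, rfl⟩ := hof0_surj z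
  rw [H0_hof] at hz
  have : x = 0 := by
    refine ModuleCat.hom_ext (LinearMap.ext fun y => ?_)
    obtain ⟨y, rfl⟩ := Submodule.Quotient.mk_surjective _ y
    have : (Submodule.Quotient.mk y : R ⧸ a ^ n) = y • Submodule.Quotient.mk 1 := by
      rw [← Submodule.Quotient.mk_smul]; simp
    rw [this, map_smul, hz]
    simp
  simp [this]

lemma H0_range (m : M) : m ∈ LinearMap.range (H0 R a M) ↔ ∃ n, ∀ r ∈ a ^ n, r • m = 0 := by
  constructor
  · rintro ⟨z, rfl⟩
    obtain ⟨n, hn⟩ := HH_tors 0 z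
    exact ⟨n, fun r hr => by rw [← map_smul, hn r hr, map_zero]⟩
  · rintro ⟨n, hn⟩
    let φ : (R ⧸ a ^ n) →ₗ[R] M := Submodule.liftQ _ (LinearMap.toSpanSingleton R M m) (by
      intro r hr; simpa using hn r hr)
    refine ⟨hof R a 0 M n (Abelian.Ext.mk₀ (ModuleCat.ofHom φ)), ?_⟩
    rw [H0_hof]
    change (1 : R) • m = m
    simp

lemma H0_nat (f : M →ₗ[R] N) (z : HH R a 0 M) : H0 R a N (Hmap a 0 f z) = f (H0 R a M z) := by
  obtain ⟨n, x, rfl⟩ := hof0_surj z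
  rw [Hmap_hof, H0_hof, Abelian.Ext.mk₀_comp_mk₀, H0_hof]
  rfl

end

end FLT

namespace FLT
section Part2
open Opposite Limits
variable {R : Type u} [CommRing R]

abbrev YF (Y : ModuleCat.{u} R) : ModuleCat.{u} R ⥤ (ModuleCat.{u} R)ᵒᵖ :=
  ((linearYoneda R (ModuleCat.{u} R)).obj Y).rightOp

noncomputable abbrev KK {X : ModuleCat.{u} R} (P : ProjectiveResolution X) (Y : ModuleCat.{u} R) :
    HomologicalComplex (ModuleCat.{u} R)ᵒᵖ (ComplexShape.down ℕ) :=
  ((YF Y).mapHomologicalComplex _).obj P.complex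

noncomputable abbrev oldE (X Y : ModuleCat.{u} R) (n : ℕ) : ModuleCat.{u} R :=
  ((Ext R (ModuleCat.{u} R) n).obj (op X)).obj Y

noncomputable abbrev AA {X : ModuleCat.{u} R} (P : ProjectiveResolution X) (Y : ModuleCat.{u} R) (n : ℕ) :
    ModuleCat.{u} R := ((KK P Y).opcycles n).unop

noncomputable def pj {X : ModuleCat.{u} R} (P : ProjectiveResolution X) (Y : ModuleCat.{u} R) (n : ℕ) :
    ((YF Y).leftDerived n).obj X ≅ (KK P Y).homology n :=
  P.isoLeftDerivedObj (YF Y) n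

noncomputable def opi {X : ModuleCat.{u} R} (P : ProjectiveResolution X) (Y : ModuleCat.{u} R) (n : ℕ) :
    AA P Y n ⟶ oldE X Y n :=
  ((pj P Y n).hom ≫ (KK P Y).homologyι n).unop

noncomputable def oiota {X : ModuleCat.{u} R} (P : ProjectiveResolution X) (Y : ModuleCat.{u} R) (n : ℕ) :
    AA P Y n ⟶ ModuleCat.of R (P.complex.X n ⟶ Y) :=
  ((KK P Y).pOpcycles n).unop

variable {X : ModuleCat.{u} R} (P : ProjectiveResolution X) (Y : ModuleCat.{u} R) (n : ℕ)

lemma opi_surj : Function.Surjective (opi P Y n) := by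
  rw [← ModuleCat.epi_iff_surjective]
  exact @unop_epi_of_mono _ _ _ _ _ (mono_comp _ _)

lemma oiota_inj : Function.Injective (oiota P Y n) := by
  rw [← ModuleCat.mono_iff_injective]
  exact @unop_mono_of_epi _ _ _ _ _ inferInstance

lemma opi_zero_iff (x : AA P Y n) : opi P Y n x = 0 ↔
    ∃ g : P.complex.X ((ComplexShape.down ℕ).next n) ⟶ Y,
      P.complex.d n ((ComplexShape.down ℕ).next n) ≫ g = oiota P Y n x := by
  set p := (ComplexShape.down ℕ).next n
  have h1 : (ShortComplex.mk ((KK P Y).homologyι n) ((KK P Y).fromOpcycles n p)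
    ((KK P Y).homologyι_comp_fromOpcycles n p)).Exact :=
    ShortComplex.exact_of_f_is_kernel _ ((KK P Y).homologyIsKernel n p rfl)
  have h2 := h1.unop
  rw [ShortComplex.ShortExact.moduleCat_exact_iff_function_exact] at h2
  have h3 := h2 x
  have h4 : opi P Y n x = ((pj P Y n).hom).unop
    (((KK P Y).homologyι n).unop x) := by
    unfold opi
    rfl
  have hinj : Function.Injective ((pj P Y n).hom).unop := by
    rw [← ModuleCat.mono_iff_injective]; infer_instance
  have h5 : opi P Y n x = 0 ↔ ((KK P Y).homologyι n).unop x = 0 := by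
    rw [h4]
    constructor
    · intro h; apply hinj; rw [h]; exact (map_zero _).symm
    · intro h; rw [h]; exact map_zero _
  rw [h5]
  refine h3.trans ?_
  have h6 : ∀ g : P.complex.X p ⟶ Y, oiota P Y n (((KK P Y).fromOpcycles n p).unop g) =
      P.complex.d n p ≫ g := by
    intro g
    have := (KK P Y).p_fromOpcycles n p
    have h7 := congrArg (fun f => f.unop.hom g) this
    exact h7
  constructor
  · rintro ⟨g, rfl⟩
    exact ⟨g, (h6 g).symm⟩
  · rintro ⟨g, hg⟩
    refine ⟨g, ?_⟩
    apply oiota_inj P Y n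
    rw [← hg]
    exact h6 g

lemma oiota_range (f : P.complex.X n ⟶ Y) : (∃ x, oiota P Y n x = f) ↔
    P.complex.d (n+1) n ≫ f = 0 := by
  have h1 : (ShortComplex.mk ((KK P Y).d (n+1) n) ((KK P Y).pOpcycles n)
    ((KK P Y).d_pOpcycles (n+1) n)).Exact :=
    ShortComplex.exact_of_g_is_cokernel _ ((KK P Y).opcyclesIsCokernel (n+1) n (by simp))
  have h2 := h1.unop
  rw [ShortComplex.ShortExact.moduleCat_exact_iff_function_exact] at h2
  exact (h2 f).symm

lemma oiota_d (x : AA P Y n) : P.complex.d (n+1) n ≫ oiota P Y n x = 0 :=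
  (oiota_range P Y n _).1 ⟨x, rfl⟩

lemma extMk_zero_iff (f : P.complex.X n ⟶ Y) (hf : P.complex.d (n+1) n ≫ f = 0) :
    P.extMk f (n+1) rfl hf = (0 : Abelian.Ext.{u} X Y n) ↔
    ∃ g : P.complex.X ((ComplexShape.down ℕ).next n) ⟶ Y,
      P.complex.d n ((ComplexShape.down ℕ).next n) ≫ g = f := by
  cases n with
  | zero =>
    have h0 : P.complex.d 0 ((ComplexShape.down ℕ).next 0) = 0 := by
      apply P.complex.shape
      simp
    rw [h0]
    simp only [Limits.zero_comp]
    constructor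
    · intro h
      refine ⟨0, ?_⟩
      simp only [← P.extEquivCohomologyClass.apply_eq_iff_eq,
        ProjectiveResolution.extEquivCohomologyClass_extMk, ProjectiveResolution.extEquivCohomologyClass_zero,
        CochainComplex.HomComplex.CohomologyClass.mk_eq_zero_iff] at h
      rw [CochainComplex.HomComplex.Cocycle.toSingleMk_mem_coboundaries_iff _ _ _ _ _ 1 (by simp)] at h
      obtain ⟨g, hg⟩ := h
      have hz : IsZero (P.cochainComplex.X 1) := by
        exact CochainComplex.isZero_of_isStrictlyLE _ 0 1 (by simp)
      rw [hz.eq_of_src g 0, comp_zero] at hg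
      rw [← cancel_epi (P.cochainComplexXIso (-(0:ℕ)) 0 rfl).hom, comp_zero]
      exact hg
    · rintro ⟨-, rfl⟩
      exact P.extMk_zero _ _
  | succ p =>
    rw [P.extMk_eq_zero_iff f _ rfl hf p rfl]
    have : (ComplexShape.down ℕ).next (p+1) = p := by simp
    rw [this]

noncomputable def theta : AA P Y n →ₗ[R] Abelian.Ext.{u} X Y n where
  toFun x := P.extMk (oiota P Y n x) (n+1) rfl (oiota_d P Y n x)
  map_add' x y := by
    rw [P.add_extMk]
    congr 1
    exact map_add _ _ _
  map_smul' r x := by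
    simp only [RingHom.id_apply]
    rw [Abelian.Ext.smul_eq_comp_mk₀, P.extMk_comp_mk₀]
    congr 1
    rw [show oiota P Y n (r • x) = r • oiota P Y n x from map_smul _ _ _]
    simp

lemma theta_surj : Function.Surjective (theta P Y n) := by
  intro α
  obtain ⟨f, hf, rfl⟩ := P.extMk_surjective α (n+1) rfl
  obtain ⟨x, rfl⟩ := (oiota_range P Y n f).2 hf
  exact ⟨x, rfl⟩

lemma theta_ker (x : AA P Y n) : theta P Y n x = 0 ↔ opi P Y n x = 0 := by
  rw [opi_zero_iff, ← extMk_zero_iff P Y n _ (oiota_d P Y n x)]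
  rfl

noncomputable def eON : oldE X Y n ≃ₗ[R] Abelian.Ext.{u} X Y n :=
  ((opi P Y n).hom.quotKerEquivOfSurjective (opi_surj P Y n)).symm.trans
    ((Submodule.quotEquivOfEq _ _ (by ext x; exact (theta_ker P Y n x).symm)).trans
     ((theta P Y n).quotKerEquivOfSurjective (theta_surj P Y n)))

lemma eON_opi (x : AA P Y n) : eON P Y n (opi P Y n x) = theta P Y n x := by
  have : ((opi P Y n).hom.quotKerEquivOfSurjective (opi_surj P Y n)).symm (opi P Y n x) = 
    Submodule.Quotient.mk x := by
    rw [LinearEquiv.symm_apply_eq]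
    rfl
  unfold eON
  rw [LinearEquiv.trans_apply, this]
  rfl

lemma eON_nat {X' : ModuleCat.{u} R} (P' : ProjectiveResolution X') (g : X' ⟶ X) (z : oldE X Y n) :
    eON P' Y n ((((Ext R (ModuleCat.{u} R) n).map g.op).app Y) z) =
      (Abelian.Ext.mk₀ g).comp (eON P Y n z) (zero_add n) := by
  obtain ⟨x, rfl⟩ := opi_surj P Y n z
  let φ := ProjectiveResolution.lift g P' P
  have comm : φ.f 0 ≫ P.π.f 0 = P'.π.f 0 ≫ g := ProjectiveResolution.lift_commutes_zero g P' P
  let ψ : KK P' Y ⟶ KK P Y := ((YF Y).mapHomologicalComplex _).map φ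
  let y : AA P' Y n := (HomologicalComplex.opcyclesMap ψ n).unop x
  have h1 : (((Ext R (ModuleCat.{u} R) n).map g.op).app Y) (opi P Y n x) = opi P' Y n y := by
    have a1 : ((YF Y).leftDerived n).map g ≫ (pj P Y n).hom =
        (pj P' Y n).hom ≫ HomologicalComplex.homologyMap ψ n :=
      ProjectiveResolution.isoLeftDerivedObj_hom_naturality g P' P φ comm (YF Y) n
    have a2 := HomologicalComplex.homologyι_naturality ψ n
    have a3 : ((YF Y).leftDerived n).map g ≫ ((pj P Y n).hom ≫ (KK P Y).homologyι n)
      = ((pj P' Y n).hom ≫ (KK P' Y).homologyι n) ≫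
        HomologicalComplex.opcyclesMap ψ n := by
      rw [← Category.assoc, a1, Category.assoc, Category.assoc, a2]
    exact congrArg (fun f => f.unop.hom x) a3
  have h2 : oiota P' Y n y = φ.f n ≫ oiota P Y n x := by
    have a1 := HomologicalComplex.p_opcyclesMap ψ n
    exact congrArg (fun f => f.unop.hom x) a1
  rw [h1, eON_opi, eON_opi]
  let Φ : ProjectiveResolution.Hom P' P g := ⟨φ, comm⟩
  have h3 := ProjectiveResolution.mk₀_comp_extMk (oiota P Y n x) (n+1) rfl (oiota_d P Y n x) Φ
  refine Eq.trans ?_ h3.symm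
  change P'.extMk (oiota P' Y n y) (n+1) rfl (oiota_d P' Y n y) = _
  congr 1

variable (R) (a : Ideal R) (i : ℕ) (M : Type u) [AddCommGroup M] [Module R M]

noncomputable abbrev eN (n : ℕ) : oldE (ModuleCat.of R (R ⧸ a ^ n)) (ModuleCat.of R M) i ≃ₗ[R] EX R a i M n :=
  eON (projectiveResolution (ModuleCat.of R (R ⧸ a ^ n))) (ModuleCat.of R M) i

noncomputable abbrev DD : (ℕᵒᵖ)ᵒᵖ ⥤ ModuleCat.{u} R ⥤ ModuleCat.{u} R :=
  localCohomology.diagram (localCohomology.idealPowersDiagram a) i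

noncomputable abbrev DM : (ℕᵒᵖ)ᵒᵖ ⥤ ModuleCat.{u} R :=
  DD R a i ⋙ (evaluation _ _).obj (ModuleCat.of R M)

noncomputable def LHc : Cocone (DM R a i M) :=
  ((evaluation _ _).obj (ModuleCat.of R M)).mapCocone (colimit.cocone (DD R a i))

noncomputable def LHcol : IsColimit (LHc R a i M) :=
  isColimitOfPreserves ((evaluation _ _).obj (ModuleCat.of R M)) (colimit.isColimit (DD R a i))

lemma eN_tr (m n : ℕ) (h : m ≤ n) (z : oldE (ModuleCat.of R (R ⧸ a ^ m)) (ModuleCat.of R M) i)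
    (w : op (op m) ⟶ op (op n)) :
    eN R a i M n ((DM R a i M).map w z) = trE R a i M m n h (eN R a i M m z) := by
  have := eON_nat (projectiveResolution (ModuleCat.of R (R ⧸ a ^ m))) (ModuleCat.of R M) i
    (projectiveResolution (ModuleCat.of R (R ⧸ a ^ n)))
    ((localCohomology.ringModIdeals (localCohomology.idealPowersDiagram a)).map w.unop) z
  exact this

noncomputable def HHc : Cocone (DM R a i M) where
  pt := ModuleCat.of R (HH R a i M)
  ι :=
    { app := fun j => ModuleCat.ofHom (hof R a i M j.unop.unop ∘ₗ (eN R a i M j.unop.unop).toLinearMap)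
      naturality := by
        intro j k w
        ext z
        have h : j.unop.unop ≤ k.unop.unop := w.unop.unop.down.down
        have := eN_tr R a i M j.unop.unop k.unop.unop h z w
        have h2 := hof_tr (eN R a i M j.unop.unop z) h
        rw [← this] at h2
        exact h2 }

noncomputable def toHH : (LHc R a i M).pt ⟶ ModuleCat.of R (HH R a i M) :=
  (LHcol R a i M).desc (HHc R a i M)

lemma lcomp_symm (n : ℕ) (z : oldE (ModuleCat.of R (R ⧸ a ^ n)) (ModuleCat.of R M) i) :
    (((LHc R a i M).ι.app (op (op n))).hom ∘ₗ (eN R a i M n).symm.toLinearMap) (eN R a i M n z)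
      = ((LHc R a i M).ι.app (op (op n))).hom z :=
  congrArg ((LHc R a i M).ι.app (op (op n))).hom ((eN R a i M n).symm_apply_apply z)

noncomputable def ofHH : HH R a i M →ₗ[R] (LHc R a i M).pt :=
  Module.DirectLimit.lift R ℕ (EX R a i M) (trE R a i M)
    (fun n => ((LHc R a i M).ι.app (op (op n))).hom ∘ₗ (eN R a i M n).symm.toLinearMap)
    (by
      intro m n h x
      obtain ⟨z, rfl⟩ := (eN R a i M m).surjective x
      let w : op (op m) ⟶ op (op n) := (homOfLE h).op.op
      rw [← eN_tr R a i M m n h z w]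
      have := congrArg (fun f => f.hom z) ((LHc R a i M).w w)
      exact (lcomp_symm R a i M n _).trans (this.trans (lcomp_symm R a i M m z).symm))

lemma ofHH_hof (n : ℕ) (z) : ofHH R a i M (hof R a i M n (eN R a i M n z)) = (LHc R a i M).ι.app (op (op n)) z := by
  unfold ofHH
  rw [Module.DirectLimit.lift_of]
  exact lcomp_symm R a i M n z

lemma toHH_ι (n : ℕ) (z) : toHH R a i M ((LHc R a i M).ι.app (op (op n)) z) = hof R a i M n (eN R a i M n z) := by
  have := (LHcol R a i M).fac (HHc R a i M) (op (op n))
  exact congrArg (fun f => f.hom z) this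

theorem locH_equiv : Nonempty (((localCohomology a i).obj (ModuleCat.of R M) : ModuleCat.{u} R) ≃ₗ[R] HH R a i M) := by
  refine ⟨LinearEquiv.ofLinearMap (toHH R a i M).hom (ofHH R a i M) ?_ ?_⟩
  · refine LinearMap.ext fun z => ?_
    obtain ⟨n, x, rfl⟩ := hof_surj z
    obtain ⟨x, rfl⟩ := (eN R a i M n).surjective x
    exact (congrArg (toHH R a i M) (ofHH_hof R a i M n x)).trans (toHH_ι R a i M n x)
  · have : toHH R a i M ≫ ModuleCat.ofHom (ofHH R a i M) = 𝟙 _ := by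
      apply (LHcol R a i M).hom_ext
      intro j
      ext z
      have h1 := toHH_ι R a i M j.unop.unop z
      have h2 := ofHH_hof R a i M j.unop.unop z
      rw [← h1] at h2
      exact h2
    exact congrArg (fun f => f.hom) this

end Part2
end FLT

namespace FLT
section Part3
open Limits
variable {R : Type u} [CommRing R]

/-- The `a`-power torsion submodule. -/
def tor (a : Ideal R) (M : Type u) [AddCommGroup M] [Module R M] : Submodule R M where
  carrier := {m | ∃ n, ∀ r ∈ a ^ n, r • m = 0}
  add_mem' := by
    rintro x y ⟨n, hn⟩ ⟨k, hk⟩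
    refine ⟨n + k, fun r hr => ?_⟩
    rw [smul_add, hn r (Ideal.pow_le_pow_right (by omega) hr),
      hk r (Ideal.pow_le_pow_right (by omega) hr), add_zero]
  zero_mem' := ⟨0, fun r _ => smul_zero r⟩
  smul_mem' := by
    rintro c x ⟨n, hn⟩
    exact ⟨n, fun r hr => by rw [smul_comm, hn r hr, smul_zero]⟩

lemma mem_tor {a : Ideal R} {M : Type u} [AddCommGroup M] [Module R M] {m : M} :
    m ∈ tor a M ↔ ∃ n, ∀ r ∈ a ^ n, r • m = 0 := Iff.rfl

lemma exists_inj (M : Type u) [AddCommGroup M] [Module R M] :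
    ∃ (E : Type u) (_ : AddCommGroup E) (_ : Module R E) (_ : Module.Injective R E)
      (f : M →ₗ[R] E), Function.Injective f := by
  let E := Injective.under (ModuleCat.of R M)
  have : Injective (ModuleCat.of R E) := inferInstanceAs (Injective E)
  refine ⟨E, inferInstance, inferInstance,
    Module.injective_module_of_injective_object R E, (Injective.ι (ModuleCat.of R M)).hom, ?_⟩
  exact (ModuleCat.mono_iff_injective _).1 inferInstance

/-- A finitely generated power torsion module is killed by one power. -/
lemma exists_pow_kill (a : Ideal R) {M : Type u} [AddCommGroup M] [Module R M] [Module.Finite R M]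
    (h : ∀ m : M, ∃ n, ∀ r ∈ a ^ n, r • m = 0) : ∃ n, ∀ r ∈ a ^ n, ∀ m : M, r • m = 0 := by
  obtain ⟨s, hs⟩ := (Module.finite_def (R := R) (M := M)).1 inferInstance
  choose f hf using h
  refine ⟨s.sup f, fun r hr m => ?_⟩
  have hm : m ∈ Submodule.span R (s : Set M) := by rw [hs]; trivial
  induction hm using Submodule.span_induction with
  | mem x hx => exact hf x r (Ideal.pow_le_pow_right (Finset.le_sup hx) hr)
  | zero => exact smul_zero r
  | add x y _ _ hx hy => rw [smul_add, hx, hy, add_zero]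
  | smul c x _ hx => rw [smul_comm, hx, smul_zero]

lemma tor_injective [IsNoetherianRing R] (a : Ideal R) (E : Type u) [AddCommGroup E] [Module R E]
    [Module.Injective R E] : Module.Injective R (tor a E) := by
  apply Module.Baer.injective
  intro I g
  have hfin : Module.Finite R (LinearMap.range g) := inferInstance
  obtain ⟨n, hn⟩ := exists_pow_kill a (M := LinearMap.range g) (by
    rintro ⟨⟨x, n, hn⟩, hx⟩
    exact ⟨n, fun r hr => Subtype.ext (Subtype.ext (hn r hr))⟩)
  obtain ⟨k, hk⟩ := Ideal.exists_pow_inf_eq_pow_smul a (I : Submodule R R)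
  have hk' := hk (n + k) (by omega)
  rw [Nat.add_sub_cancel] at hk'
  have hker : ∀ x (hx : x ∈ I), x ∈ a ^ (n + k) → g ⟨x, hx⟩ = 0 := by
    intro x hx hxa
    have hm : x ∈ (a ^ (n+k) • ⊤ ⊓ I : Submodule R R) := ⟨by simpa using hxa, hx⟩
    rw [hk'] at hm
    have hm2 : x ∈ (a ^ n • I : Submodule R R) := (Submodule.smul_mono le_rfl inf_le_right : _ ≤ _) hm
    have : ∀ y ∈ (a ^ n • I : Submodule R R), ∀ hy : y ∈ I, g ⟨y, hy⟩ = 0 := by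
      intro y hy
      induction hy using Submodule.smul_induction_on' with
      | smul r hr z hz =>
        intro hy
        have : (⟨r • z, hy⟩ : I) = r • (⟨z, hz⟩ : I) := rfl
        rw [this, map_smul]
        exact congrArg Subtype.val (hn r hr ⟨g ⟨z, hz⟩, LinearMap.mem_range_self _ _⟩)
      | add x hx y hy h1 h2 =>
        intro h3
        have hxI := Submodule.smul_le_right hx
        have hyI := Submodule.smul_le_right hy
        have : (⟨x + y, h3⟩ : I) = ⟨x, hxI⟩ + ⟨y, hyI⟩ := rfl
        rw [this, map_add, h1, h2, add_zero]
    exact this x hm2 hx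
  let K : Submodule R I := Submodule.comap (Submodule.subtype I) (a ^ (n + k) : Ideal R)
  let f : (I ⧸ K) →ₗ[R] (R ⧸ (a ^ (n + k) : Ideal R)) := Submodule.mapQ K (a ^ (n+k) : Ideal R) (Submodule.subtype I) le_rfl
  have hf : Function.Injective f := by
    rw [← LinearMap.ker_eq_bot, LinearMap.ker_eq_bot']
    intro m hm
    obtain ⟨m, rfl⟩ := Submodule.Quotient.mk_surjective _ m
    rw [Submodule.Quotient.mk_eq_zero]
    exact (Submodule.Quotient.mk_eq_zero (a ^ (n + k) : Ideal R)).1 hm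
  let g0 : (I ⧸ K) →ₗ[R] E := Submodule.liftQ K ((tor a E).subtype ∘ₗ g) (by
    rintro ⟨x, hx⟩ hxa
    rw [LinearMap.mem_ker, LinearMap.comp_apply, hker x hx hxa, map_zero])
  obtain ⟨h, hh⟩ := Module.Injective.out (Q := E) f hf g0
  let e : E := h (Ideal.Quotient.mk _ 1)
  have he : e ∈ tor a E := by
    refine ⟨n + k, fun r hr => ?_⟩
    change r • h _ = 0
    rw [← map_smul]
    have : r • (Ideal.Quotient.mk (a ^ (n+k)) 1) = 0 := by
      change Ideal.Quotient.mk (a ^ (n+k)) (r * 1) = 0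
      rw [mul_one]
      exact Ideal.Quotient.eq_zero_iff_mem.2 hr
    rw [this, map_zero]
  refine ⟨LinearMap.toSpanSingleton R _ ⟨e, he⟩, fun x hx => Subtype.ext ?_⟩
  have h1 := hh (Submodule.Quotient.mk ⟨x, hx⟩)
  refine Eq.trans ?_ h1
  change x • h _ = _
  rw [← map_smul]
  congr 1
  change Ideal.Quotient.mk _ (x * 1) = Ideal.Quotient.mk _ x
  rw [mul_one]

variable {a : Ideal R} {M N L : Type u} [AddCommGroup M] [Module R M] [AddCommGroup N] [Module R N]
  [AddCommGroup L] [Module R L]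

theorem HH_torsion_zero [IsNoetherianRing R] (i : ℕ) : ∀ (Γ : Type u) [AddCommGroup Γ] [Module R Γ]
    (_ : ∀ m : Γ, ∃ n, ∀ r ∈ a ^ n, r • m = 0) (z : HH R a (i+1) Γ), z = 0 := by
  induction i with
  | zero =>
    intro Γ _ _ hΓ z
    obtain ⟨E, _, _, _, f, hf⟩ := exists_inj (R := R) Γ
    have := tor_injective a E
    let f' : Γ →ₗ[R] tor a E := f.codRestrict _ (fun m => by
      obtain ⟨n, hn⟩ := hΓ m
      exact ⟨n, fun r hr => by rw [← map_smul, hn r hr, map_zero]⟩)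
    have hf' : Function.Injective f' := fun x y h => hf (congrArg Subtype.val h)
    let g := (LinearMap.range f').mkQ
    have hg : Function.Surjective g := Submodule.mkQ_surjective _
    have hex : Function.Exact f' g := LinearMap.exact_map_mkQ_range f'
    obtain ⟨y, rfl⟩ := (les1 (a := a) hf' hex hg 0 z).1 (HH_inj 0 _)
    obtain ⟨e, he⟩ := hg (H0 R a _ y)
    obtain ⟨w, hw⟩ := (H0_range (a := a) e).2 (by
      obtain ⟨n, hn⟩ := e.2
      exact ⟨n, fun r hr => Subtype.ext (hn r hr)⟩)
    have : Hmap a 0 g w = y := by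
      apply H0_inj
      rw [H0_nat, hw, he]
    exact (les3 hf' hex hg 0 y).2 ⟨w, this⟩
  | succ i ih =>
    intro Γ _ _ hΓ z
    obtain ⟨E, _, _, _, f, hf⟩ := exists_inj (R := R) Γ
    have := tor_injective a E
    let f' : Γ →ₗ[R] tor a E := f.codRestrict _ (fun m => by
      obtain ⟨n, hn⟩ := hΓ m
      exact ⟨n, fun r hr => by rw [← map_smul, hn r hr, map_zero]⟩)
    have hf' : Function.Injective f' := fun x y h => hf (congrArg Subtype.val h)
    let g := (LinearMap.range f').mkQ
    have hg : Function.Surjective g := Submodule.mkQ_surjective _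
    have hex : Function.Exact f' g := LinearMap.exact_map_mkQ_range f'
    obtain ⟨y, rfl⟩ := (les1 (a := a) hf' hex hg (i+1) z).1 (HH_inj (i+1) _)
    have : y = 0 := ih _ (by
      intro m
      obtain ⟨e, rfl⟩ := hg m
      obtain ⟨n, hn⟩ := e.2
      refine ⟨n, fun r hr => ?_⟩
      rw [← map_smul, show r • e = 0 from Subtype.ext (hn r hr), map_zero]) y
    rw [this, map_zero]

/-- Torsion quotient does not change higher local cohomology. -/
theorem HH_mod_tor [IsNoetherianRing R] (i : ℕ) :
    Nonempty (HH R a (i+1) M ≃ₗ[R] HH R a (i+1) (M ⧸ tor a M)) := by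
  have hf := Submodule.injective_subtype (tor a M)
  have hg := Submodule.mkQ_surjective (tor a M)
  have hex : Function.Exact (tor a M).subtype (tor a M).mkQ := LinearMap.exact_subtype_mkQ _
  have ht : ∀ m : tor a M, ∃ n, ∀ r ∈ a ^ n, r • m = 0 := by
    rintro ⟨m, n, hn⟩
    exact ⟨n, fun r hr => Subtype.ext (hn r hr)⟩
  refine ⟨LinearEquiv.ofBijective (Hmap a (i+1) (tor a M).mkQ) ⟨?_, ?_⟩⟩
  · rw [← LinearMap.ker_eq_bot, LinearMap.ker_eq_bot']
    intro z hz
    obtain ⟨y, rfl⟩ := (les2 (a := a) hf hex hg (i+1) z).1 hz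
    rw [HH_torsion_zero i _ ht y, map_zero]
  · intro y
    exact (les3 (a := a) hf hex hg (i+1) y).1 (HH_torsion_zero (i+1) _ ht _)

/-- Elements of `H` sent into `F` by the ideal `a`. -/
def col (a : Ideal R) (F : Submodule R M) : Submodule R M where
  carrier := {h | ∀ r ∈ a, r • h ∈ F}
  add_mem' hx hy r hr := by rw [smul_add]; exact add_mem (hx r hr) (hy r hr)
  zero_mem' r _ := by rw [smul_zero]; exact zero_mem _
  smul_mem' c x hx r hr := by rw [smul_comm]; exact F.smul_mem _ (hx r hr)

lemma col_fg [IsNoetherianRing R] (F : Submodule R M) (hF : F.FG) (h0 : (col a (⊥ : Submodule R M)).FG) :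
    (col a F).FG := by
  obtain ⟨s, hs⟩ := (isNoetherianRing_iff_ideal_fg R).1 inferInstance a
  have hsa : ∀ x : s, (x : R) ∈ a := fun x => by rw [← hs]; exact Ideal.subset_span x.2
  have : Module.Finite R F := Module.Finite.iff_fg.2 hF
  let φ : col a F →ₗ[R] (s → F) := LinearMap.pi fun x =>
    ((LinearMap.lsmul R M (x : R)) ∘ₗ (col a F).subtype).codRestrict F (fun h => h.2 _ (hsa x))
  have hker : (LinearMap.ker φ).map (col a F).subtype = col a ⊥ := by
    ext h
    constructor
    · rintro ⟨h, hh, rfl⟩ r hr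
      have hh' : ∀ x : s, (x : R) • (h : M) = 0 := fun x =>
        congrArg Subtype.val (congrFun hh x)
      rw [← hs] at hr
      change r • (h : M) ∈ (⊥ : Submodule R M)
      rw [Submodule.mem_bot]
      induction hr using Submodule.span_induction with
      | mem x hx => exact hh' ⟨x, hx⟩
      | zero => exact zero_smul _ _
      | add x y _ _ hx hy => rw [add_smul, hx, hy, add_zero]
      | smul c x _ hx => rw [smul_assoc, hx, smul_zero]
    · intro hh
      have hm : h ∈ col a F := fun r hr => by
        rw [(Submodule.mem_bot R).1 (hh r hr)]; exact zero_mem _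
      refine ⟨⟨h, hm⟩, ?_, rfl⟩
      ext x
      exact (Submodule.mem_bot R).1 (hh _ (hsa x))
  have hkfg : (LinearMap.ker φ).FG := by
    rw [← hker] at h0
    exact Submodule.fg_of_fg_map_injective _ (Submodule.injective_subtype _) h0
  have hr : (LinearMap.range φ).FG := IsNoetherian.noetherian _
  have : (⊤ : Submodule R (col a F)).FG := by
    apply Submodule.fg_of_fg_map_of_fg_inf_ker φ
    · rw [← LinearMap.range_eq_map]; exact hr
    · rw [top_inf_eq]; exact hkfg
  exact (Submodule.fg_top _).1 this

lemma col_pow_fg [IsNoetherianRing R] (h0 : (col a (⊥ : Submodule R M)).FG) (n : ℕ) :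
    (col (a ^ n) (⊥ : Submodule R M)).FG := by
  induction n with
  | zero =>
    have : col (a ^ 0) (⊥ : Submodule R M) = ⊥ := by
      rw [eq_bot_iff]
      intro x hx
      have := hx 1 (by simp)
      rwa [one_smul] at this
    rw [this]
    exact Submodule.fg_bot
  | succ n ih =>
    have : col (a ^ (n+1)) (⊥ : Submodule R M) = col a (col (a ^ n) ⊥) := by
      ext x
      constructor
      · intro hx r hr s hs
        rw [smul_smul]
        exact hx _ (by rw [pow_succ]; exact Ideal.mul_mem_mul hs hr)
      · intro hx r hr
        rw [pow_succ] at hr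
        induction hr using Submodule.mul_induction_on' with
        | mem_mul_mem s hs t ht => rw [mul_smul]; exact hx t ht s hs
        | add x _ y _ h1 h2 => rw [add_smul]; exact add_mem h1 h2
    rw [this]
    exact col_fg _ ih h0

lemma col_bot_fg_of_equiv (e : M ≃ₗ[R] N) (h : (col a (⊥ : Submodule R N)).FG) :
    (col a (⊥ : Submodule R M)).FG := by
  have : (col a (⊥ : Submodule R M)).map e.toLinearMap = col a ⊥ := by
    ext y
    constructor
    · rintro ⟨x, hx, rfl⟩ r hr
      change r • e x ∈ _
      rw [← map_smul, (Submodule.mem_bot R).1 (hx r hr), map_zero]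
      exact zero_mem _
    · intro hy
      refine ⟨e.symm y, fun r hr => ?_, e.apply_symm_apply y⟩
      rw [← map_smul, (Submodule.mem_bot R).1 (hy r hr), map_zero]
      exact zero_mem _
  rw [← this] at h
  exact Submodule.fg_of_fg_map_injective _ e.injective h

end Part3
end FLT

namespace FLT
section Part4
variable {R : Type u} [CommRing R] [IsNoetherianRing R]
variable {a : Ideal R} {M N L : Type u} [AddCommGroup M] [Module R M] [AddCommGroup N] [Module R N]
  [AddCommGroup L] [Module R L]

lemma HH0_finite [Module.Finite R M] : Module.Finite R (HH R a 0 M) :=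
  Module.Finite.of_injective (H0 R a M) H0_inj

lemma finite_of_exact {f : M →ₗ[R] N} {g : N →ₗ[R] L} (h : Function.Exact f g)
    [Module.Finite R M] [Module.Finite R L] : Module.Finite R N := by
  rw [Module.finite_def]
  apply Submodule.fg_of_fg_map_of_fg_inf_ker g
  · exact IsNoetherian.noetherian _
  · rw [top_inf_eq, LinearMap.exact_iff.1 h, LinearMap.range_eq_map]
    exact Submodule.FG.map _ (Module.finite_def.1 inferInstance)

lemma exists_reg [Module.Finite R N] (h : ∀ m : N, (∀ r ∈ a, r • m = 0) → m = 0) :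
    ∃ x ∈ a, IsSMulRegular N x := by
  have : Subsingleton ((R ⧸ a) →ₗ[R] N) := by
    refine subsingleton_of_forall_eq 0 fun φ => ?_
    ext
    apply h
    intro r hr
    change r • φ (Ideal.Quotient.mk a 1) = 0
    rw [← map_smul]
    change φ (Ideal.Quotient.mk a (r * 1)) = 0
    rw [mul_one, Ideal.Quotient.eq_zero_iff_mem.2 hr, map_zero]
  obtain ⟨x, hx, hx'⟩ := IsSMulRegular.subsingleton_linearMap_iff.1 this
  rw [Ideal.annihilator_quotient] at hx
  exact ⟨x, hx, hx'⟩

lemma col_step [Module.Finite R N] (i : ℕ)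
    (ih : ∀ (M : Type u) [AddCommGroup M] [Module R M] [Module.Finite R M]
      (_ : ∀ j < i, Module.Finite R (HH R a j M)), (col a (⊥ : Submodule R (HH R a i M))).FG)
    (htor : ∀ m : N, (∀ r ∈ a, r • m = 0) → m = 0)
    (hN : ∀ j < i + 1, Module.Finite R (HH R a j N)) :
    (col a (⊥ : Submodule R (HH R a (i+1) N))).FG := by
  obtain ⟨x, hx, hreg⟩ := exists_reg htor
  let f : N →ₗ[R] N := x • LinearMap.id
  let g := (LinearMap.range f).mkQ
  have hf : Function.Injective f := fun y z h => hreg h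
  have hg : Function.Surjective g := Submodule.mkQ_surjective _
  have hex : Function.Exact f g := LinearMap.exact_map_mkQ_range f
  have hQ : ∀ j < i, Module.Finite R (HH R a j (N ⧸ LinearMap.range f)) := by
    intro j hj
    have := hN j (by omega)
    have := hN (j+1) (by omega)
    exact finite_of_exact (les3 (a := a) hf hex hg j)
  have h0 := ih _ hQ
  have := hN i (by omega)
  have hF : (LinearMap.range (Hmap a i g)).FG := by
    exact Module.Finite.iff_fg.1 inferInstance
  have h1 := (col_fg _ hF h0).map (Hδ a hf hex hg i)
  suffices hh : col a (⊥ : Submodule R (HH R a (i+1) N)) =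
      Submodule.map (Hδ a hf hex hg i) (col a (LinearMap.range (Hmap a i g))) by
    rw [hh]
    exact h1
  refine Submodule.ext fun z => ?_
  constructor
  · intro hz
    have hxz : Hmap a (i+1) f z = 0 := by
      rw [Hmap_smul]
      exact (Submodule.mem_bot R).1 (hz x hx)
    obtain ⟨y, rfl⟩ := (les1 (a := a) hf hex hg i z).1 hxz
    refine ⟨y, fun r hr => ?_, rfl⟩
    refine (les3 (a := a) hf hex hg i _).1 ?_
    rw [map_smul]
    exact (Submodule.mem_bot R).1 (hz r hr)
  · rintro ⟨y, hy, rfl⟩ r hr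
    rw [Submodule.mem_bot, ← map_smul]
    exact (les3 (a := a) hf hex hg i _).2 (hy r hr)

theorem col_HH_fg (i : ℕ) : ∀ (M : Type u) [AddCommGroup M] [Module R M] [Module.Finite R M]
    (_ : ∀ j < i, Module.Finite R (HH R a j M)), (col a (⊥ : Submodule R (HH R a i M))).FG := by
  induction i with
  | zero =>
    intro M _ _ _ _
    have := HH0_finite (a := a) (M := M)
    exact IsNoetherian.noetherian _
  | succ i ih =>
    intro M _ _ _ hM
    obtain ⟨e⟩ := HH_mod_tor (a := a) (M := M) i
    apply col_bot_fg_of_equiv e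
    have hN : ∀ j < i + 1, Module.Finite R (HH R a j (M ⧸ tor a M)) := by
      intro j hj
      cases j with
      | zero => exact HH0_finite
      | succ j =>
        obtain ⟨e⟩ := HH_mod_tor (a := a) (M := M) j
        have := hM _ hj
        exact Module.Finite.equiv e
    have htor : ∀ m : M ⧸ tor a M, (∀ r ∈ a, r • m = 0) → m = 0 := by
      intro m hm
      obtain ⟨m, rfl⟩ := Submodule.Quotient.mk_surjective _ m
      have hm' : m ∈ col a (tor a M) := by
        intro r hr
        have := hm r hr
        rwa [← Submodule.Quotient.mk_smul, Submodule.Quotient.mk_eq_zero] at this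
      rw [Submodule.Quotient.mk_eq_zero]
      obtain ⟨n, hn⟩ := exists_pow_kill a (M := tor a M) (by
        rintro ⟨m, n, hn⟩
        exact ⟨n, fun r hr => Subtype.ext (hn r hr)⟩)
      refine ⟨n + 1, fun r hr => ?_⟩
      rw [pow_succ] at hr
      induction hr using Submodule.mul_induction_on' with
      | mem_mul_mem s hs t ht =>
        rw [mul_smul]
        exact congrArg Subtype.val (hn s hs ⟨t • m, hm' t ht⟩)
      | add x _ y _ h1 h2 => rw [add_smul, h1, h2, add_zero]
    exact col_step i (fun Q _ _ _ hQ => ih Q hQ) htor hN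
end Part4
end FLT

namespace FLT
section Part5
variable {R : Type u} [CommRing R] (S : Submonoid R)
variable {a : Ideal R} {M N L : Type u} [AddCommGroup M] [Module R M] [AddCommGroup N] [Module R N]
  [AddCommGroup L] [Module R L]

lemma lm_inj (f : M →ₗ[R] N) (hf : Function.Injective f) : Function.Injective (LocalizedModule.map S f) :=
  IsLocalizedModule.map_injective S (LocalizedModule.mkLinearMap S M) (LocalizedModule.mkLinearMap S N) f hf

lemma lm_surj (f : M →ₗ[R] N) (hf : Function.Surjective f) : Function.Surjective (LocalizedModule.map S f) :=
  IsLocalizedModule.map_surjective S (LocalizedModule.mkLinearMap S M) (LocalizedModule.mkLinearMap S N) f hf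

lemma lm_exact (f : M →ₗ[R] N) (g : N →ₗ[R] L) (h : Function.Exact f g) :
    Function.Exact (LocalizedModule.map S f) (LocalizedModule.map S g) :=
  LocalizedModule.map_exact S f g h

lemma lm_comp (f : M →ₗ[R] N) (g : N →ₗ[R] L) (z : LocalizedModule S M) :
    LocalizedModule.map S g (LocalizedModule.map S f z) = LocalizedModule.map S (g ∘ₗ f) z := by
  induction z using LocalizedModule.induction_on with
  | h m s => simp [LocalizedModule.map_mk]

lemma pow_map_mem (n : ℕ) {r : R} (hr : r ∈ a ^ n) :
    algebraMap R (Localization S) r ∈ (a.map (algebraMap R (Localization S))) ^ n := by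
  rw [← Ideal.map_pow]
  exact Ideal.mem_map_of_mem _ hr

variable [IsNoetherianRing R]

lemma H0_loc_range : LinearMap.range (LocalizedModule.map S (H0 R a M)) =
    LinearMap.range (H0 (Localization S) (a.map (algebraMap R (Localization S))) (LocalizedModule S M)) := by
  refine Submodule.ext fun y => ?_
  rw [H0_range]
  constructor
  · rintro ⟨z, rfl⟩
    induction z using LocalizedModule.induction_on with
    | h w s =>
      rw [LocalizedModule.map_mk]
      obtain ⟨n, hn⟩ := (H0_range (a := a) _).1 ⟨w, rfl⟩
      refine ⟨n, fun r hr => ?_⟩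
      rw [← Ideal.map_pow] at hr
      induction hr using Submodule.span_induction with
      | mem x hx =>
        obtain ⟨r, hr, rfl⟩ := hx
        rw [algebraMap_smul, LocalizedModule.smul'_mk, hn r hr, LocalizedModule.zero_mk]
      | zero => exact zero_smul _ _
      | add x y _ _ hx hy => rw [add_smul, hx, hy, add_zero]
      | smul c x _ hx => rw [smul_assoc, hx, smul_zero]
  · rintro ⟨n, hn⟩
    induction y using LocalizedModule.induction_on with
    | h m s =>
      have h1 : ∀ r ∈ a ^ n, ∃ t : S, t • r • m = 0 := by
        intro r hr
        have := hn _ (pow_map_mem S n hr)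
        rw [algebraMap_smul, LocalizedModule.smul'_mk, ← LocalizedModule.zero_mk 1, LocalizedModule.mk_eq] at this
        obtain ⟨u, hu⟩ := this
        exact ⟨u, by simpa using hu⟩
      obtain ⟨F, hF⟩ := (isNoetherianRing_iff_ideal_fg R).1 inferInstance (a ^ n)
      have h2 : ∃ t : S, ∀ r ∈ F, t • r • m = 0 := by
        have hF' : ∀ r ∈ F, r ∈ a ^ n := fun r hr => by rw [← hF]; exact Ideal.subset_span hr
        clear hF
        classical
        induction F using Finset.induction_on with
        | empty => exact ⟨1, by simp⟩
        | insert x F _ ih =>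
          obtain ⟨t, ht⟩ := ih (fun r hr => hF' r (Finset.mem_insert_of_mem hr))
          obtain ⟨t', ht'⟩ := h1 x (hF' x (Finset.mem_insert_self _ _))
          refine ⟨t * t', fun r hr => ?_⟩
          rcases Finset.mem_insert.1 hr with rfl | hr
          · rw [mul_smul, ht', smul_zero]
          · rw [mul_comm, mul_smul, ht r hr, smul_zero]
      obtain ⟨t, ht⟩ := h2
      have h3 : ∀ r ∈ a ^ n, r • t • m = 0 := by
        intro r hr
        rw [← hF] at hr
        induction hr using Submodule.span_induction with
        | mem x hx => rw [smul_comm]; exact ht x hx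
        | zero => exact zero_smul _ _
        | add x y _ _ hx hy => rw [add_smul, hx, hy, add_zero]
        | smul c x _ hx => rw [smul_assoc, hx, smul_zero]
      obtain ⟨w, hw⟩ := (H0_range (a := a) (t • m)).2 ⟨n, h3⟩
      refine ⟨LocalizedModule.mk w (t * s), ?_⟩
      rw [LocalizedModule.map_mk, hw, LocalizedModule.mk_cancel_common_left]

abbrev aS (a : Ideal R) : Ideal (Localization S) := a.map (algebraMap R (Localization S))

lemma H0_loc (a : Ideal R) (M : Type u) [AddCommGroup M] [Module R M] :
    ∃ e : LocalizedModule S (HH R a 0 M) ≃ₗ[Localization S] HH (Localization S) (aS S a) 0 (LocalizedModule S M),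
      ∀ z, H0 _ _ _ (e z) = LocalizedModule.map S (H0 R a M) z := by
  let e1 := LinearEquiv.ofInjective (LocalizedModule.map S (H0 R a M)) (lm_inj S _ H0_inj)
  let e2 := LinearEquiv.ofInjective (H0 (Localization S) (aS S a) (LocalizedModule S M)) H0_inj
  let e3 := LinearEquiv.ofEq _ _ (H0_loc_range S (a := a) (M := M))
  refine ⟨e1.trans (e3.trans e2.symm), fun z => ?_⟩
  have h : e2 ((e1.trans (e3.trans e2.symm)) z) = e3 (e1 z) := e2.apply_symm_apply _
  exact congrArg Subtype.val h

lemma equiv_of_surj {A : Type u} [CommRing A] {B C B' C' : Type u} [AddCommGroup B] [AddCommGroup C]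
    [AddCommGroup B'] [AddCommGroup C'] [Module A B] [Module A C] [Module A B'] [Module A C']
    (p : B →ₗ[A] C) (p' : B' →ₗ[A] C') (hp : Function.Surjective p) (hp' : Function.Surjective p')
    (e : B ≃ₗ[A] B') (h : ∀ b, p b = 0 ↔ p' (e b) = 0) : Nonempty (C ≃ₗ[A] C') := by
  have hk : LinearMap.ker p = LinearMap.ker (p' ∘ₗ e.toLinearMap) := by
    ext b
    exact h b
  refine ⟨(p.quotKerEquivOfSurjective hp).symm.trans ((Submodule.quotEquivOfEq _ _ hk).trans
    ((p' ∘ₗ e.toLinearMap).quotKerEquivOfSurjective ?_))⟩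
  exact hp'.comp e.surjective

lemma Hδ_inj {A : Type u} [CommRing A] (a : Ideal A) {M E L : Type u} [AddCommGroup M] [Module A M]
    [AddCommGroup E] [Module A E] [AddCommGroup L] [Module A L] [Module.Injective A E]
    {f : M →ₗ[A] E} {g : E →ₗ[A] L} (hf : Function.Injective f) (hex : Function.Exact f g)
    (hg : Function.Surjective g) (i : ℕ) : Function.Injective (Hδ a hf hex hg (i + 1)) := by
  refine (injective_iff_map_eq_zero _).2 fun b hb => ?_
  obtain ⟨z, rfl⟩ := (les3 (a := a) hf hex hg (i + 1) b).1 hb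
  rw [HH_inj i z]
  exact map_zero _

set_option maxHeartbeats 1000000 in
theorem HH_loc (a : Ideal R) (i : ℕ) : ∀ (M : Type u) [AddCommGroup M] [Module R M],
    Nonempty (LocalizedModule S (HH R a i M) ≃ₗ[Localization S]
      HH (Localization S) (aS S a) i (LocalizedModule S M)) := by
  induction i with
  | zero =>
    intro M _ _
    exact ⟨(H0_loc S a M).choose⟩
  | succ i ih =>
    intro M _ _
    obtain ⟨E, _, _, _, f, hf⟩ := exists_inj (R := R) M
    have hES : Module.Injective (Localization S) (LocalizedModule S E) :=
      Module.injective_of_isLocalizedModule S (LocalizedModule.mkLinearMap S E)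
    let g := (LinearMap.range f).mkQ
    have hg : Function.Surjective g := Submodule.mkQ_surjective _
    have hex : Function.Exact f g := LinearMap.exact_map_mkQ_range f
    have hfS := lm_inj S f hf
    have hgS := lm_surj S g hg
    have hexS := lm_exact S f g hex
    have hp : Function.Surjective (Hδ a hf hex hg i) := fun z =>
      (les1 (a := a) hf hex hg i z).1 (HH_inj i _)
    have hp' : Function.Surjective (Hδ (aS S a) hfS hexS hgS i) := fun z =>
      (les1 (a := aS S a) hfS hexS hgS i z).1 (HH_inj i _)
    have hx1 := lm_exact S _ _ (les3 (a := a) hf hex hg i)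
    have hx2 := les3 (a := aS S a) hfS hexS hgS i
    suffices hsuff : ∃ eL : LocalizedModule S (HH R a i (E ⧸ LinearMap.range f)) ≃ₗ[Localization S]
        HH (Localization S) (aS S a) i (LocalizedModule S (E ⧸ LinearMap.range f)),
        ∀ b, LocalizedModule.map S (Hδ a hf hex hg i) b = 0 ↔
          Hδ (aS S a) hfS hexS hgS i (eL b) = 0 by
      obtain ⟨eL, heL⟩ := hsuff
      exact equiv_of_surj (LocalizedModule.map S (Hδ a hf hex hg i)) (Hδ (aS S a) hfS hexS hgS i)
        (lm_surj S _ hp) hp' eL heL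
    cases i with
    | zero =>
      obtain ⟨eE, heE⟩ := H0_loc S a E
      obtain ⟨eL, heL⟩ := H0_loc S a (E ⧸ LinearMap.range f)
      have hnat : ∀ z, eL (LocalizedModule.map S (Hmap a 0 g) z) =
          Hmap (aS S a) 0 (LocalizedModule.map S g) (eE z) := by
        intro z
        apply H0_inj
        rw [heL, H0_nat, heE, lm_comp, lm_comp]
        congr 2
        exact LinearMap.ext fun w => H0_nat g w
      refine ⟨eL, fun b => ?_⟩
      rw [hx1 b, hx2 (eL b)]
      constructor
      · rintro ⟨z, rfl⟩
        exact ⟨eE z, (hnat z).symm⟩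
      · rintro ⟨z, hz⟩
        refine ⟨eE.symm z, ?_⟩
        apply eL.injective
        rw [hnat, eE.apply_symm_apply, hz]
    | succ i =>
      obtain ⟨eL⟩ := ih (E ⧸ LinearMap.range f)
      have hi := Hδ_inj a hf hex hg i
      have hi' := Hδ_inj (aS S a) hfS hexS hgS i
      have hi2 := lm_inj S _ hi
      refine ⟨eL, fun b => ?_⟩
      exact (map_eq_zero_iff _ hi2).trans (eL.map_eq_zero_iff.symm.trans (map_eq_zero_iff _ hi').symm)
end Part5
end FLT

namespace FLT
section Part6
variable {R : Type u} [CommRing R] {a : Ideal R} {H : Type u} [AddCommGroup H] [Module R H]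

lemma loc_kill (S : Submonoid R) (ht : ∀ m : H, ∃ n, ∀ r ∈ a ^ n, r • m = 0)
    [Module.Finite (Localization S) (LocalizedModule S H)] :
    ∃ n, ∀ r ∈ a ^ n, ∀ m : H, ∃ s ∈ S, s • (r • m) = 0 := by
  obtain ⟨n, hn⟩ := exists_pow_kill (a.map (algebraMap R (Localization S)))
    (M := LocalizedModule S H) (by
      intro z
      induction z using LocalizedModule.induction_on with
      | h m s =>
        obtain ⟨n, hn⟩ := ht m
        refine ⟨n, ?_⟩
        have : (a.map (algebraMap R (Localization S))) ^ n ≤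
            LinearMap.ker (LinearMap.toSpanSingleton (Localization S) _ (LocalizedModule.mk m s)) := by
          rw [← Ideal.map_pow, Ideal.map_le_iff_le_comap]
          intro r hr
          change algebraMap R (Localization S) r • LocalizedModule.mk m s = 0
          rw [algebraMap_smul, LocalizedModule.smul'_mk, hn r hr, LocalizedModule.zero_mk]
        exact fun r hr => this hr)
  refine ⟨n, fun r hr m => ?_⟩
  have h := hn _ (pow_map_mem S n hr) (LocalizedModule.mk m 1)
  rw [algebraMap_smul, LocalizedModule.smul'_mk, ← LocalizedModule.zero_mk 1, LocalizedModule.mk_eq] at h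
  obtain ⟨u, hu⟩ := h
  refine ⟨u, u.2, ?_⟩
  simpa [Submonoid.smul_def] using hu

theorem finite_of_local [IsNoetherianRing R] (ht : ∀ m : H, ∃ n, ∀ r ∈ a ^ n, r • m = 0)
    (hcol : (col a (⊥ : Submodule R H)).FG)
    (hloc : ∀ p : PrimeSpectrum R,
      Module.Finite (Localization p.asIdeal.primeCompl) (LocalizedModule p.asIdeal.primeCompl H)) :
    Module.Finite R H := by
  have hT : Module.Finite R (col a (⊥ : Submodule R H)) := Module.Finite.iff_fg.2 hcol
  have hfin := associatedPrimes.finite R (col a (⊥ : Submodule R H))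
  have hk : ∀ p : PrimeSpectrum R,
      ∃ n, ∀ r ∈ a ^ n, ∀ m : H, ∃ s ∈ p.asIdeal.primeCompl, s • (r • m) = 0 := fun p => by
    have := hloc p
    exact loc_kill p.asIdeal.primeCompl ht
  choose k hk using hk
  have hfin2 : {p : PrimeSpectrum R | p.asIdeal ∈ associatedPrimes R (col a (⊥ : Submodule R H))}.Finite :=
    hfin.preimage (fun p _ q _ h => PrimeSpectrum.ext h)
  let n := hfin2.toFinset.sup k
  have hz : (a ^ n • (⊤ : Submodule R H)) = ⊥ := by
    by_contra hne
    obtain ⟨x, hx, hx0⟩ := Submodule.exists_mem_ne_zero_of_ne_bot hne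
    obtain ⟨P, hP, -⟩ := exists_le_isAssociatedPrime_of_isNoetherianRing R
      (⟨x, hx⟩ : (a ^ n • (⊤ : Submodule R H) : Submodule R H)) (fun h => hx0 (congrArg Subtype.val h))
    obtain ⟨hPp, ⟨h, hh⟩, hPe⟩ := isAssociatedPrime_iff.1 hP
    have hPm : ∀ r, r ∈ P ↔ r • h = 0 := by
      intro r
      rw [hPe, Submodule.mem_colon_singleton, Submodule.mem_bot, Subtype.ext_iff]
      rfl
    have haP : a ≤ P := by
      obtain ⟨m, hm⟩ := ht h
      exact Ideal.IsPrime.le_of_pow_le (n := m) fun r hr => (hPm r).2 (hm r hr)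
    have hcolm : h ∈ col a (⊥ : Submodule R H) := fun r hr => (hPm r).1 (haP hr)
    have hPa : P ∈ associatedPrimes R (col a (⊥ : Submodule R H)) := by
      refine isAssociatedPrime_iff.2 ⟨hPp, ⟨h, hcolm⟩, ?_⟩
      ext r
      rw [hPm, Submodule.mem_colon_singleton, Submodule.mem_bot, Subtype.ext_iff]
      rfl
    let p : PrimeSpectrum R := ⟨P, hPp⟩
    have hkn : k p ≤ n := Finset.le_sup (f := k) (hfin2.mem_toFinset.2 hPa)
    have hs : ∃ s ∈ P.primeCompl, s • h = 0 := by
      refine Submodule.smul_induction_on (p := fun y => ∃ s ∈ P.primeCompl, s • y = 0) hh ?_ ?_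
      · intro r hr m _
        exact hk p r (Ideal.pow_le_pow_right hkn hr) m
      · rintro y z ⟨s, hs, hsy⟩ ⟨t, ht', htz⟩
        refine ⟨s * t, mul_mem hs ht', ?_⟩
        rw [smul_add, mul_comm s t, mul_smul, hsy, mul_comm t s, mul_smul, htz, smul_zero, smul_zero,
          add_zero]
    obtain ⟨s, hs, hsh⟩ := hs
    exact hs ((hPm s).2 hsh)
  have htop : col (a ^ n) (⊥ : Submodule R H) = ⊤ := by
    refine eq_top_iff.2 fun m _ r hr => ?_
    rw [← hz]
    exact Submodule.smul_mem_smul hr trivial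
  exact ⟨htop ▸ col_pow_fg hcol n⟩

section final
variable [IsNoetherianRing R] (M : Type u) [AddCommGroup M] [Module R M]

lemma fin_iff (a : Ideal R) (i : ℕ) :
    Module.Finite R (locH R a i M) ↔ Module.Finite R (HH R a i M) := by
  obtain ⟨e⟩ := locH_equiv R a i M
  exact ⟨fun h => @Module.Finite.equiv R _ _ _ _ _ _ _ h e,
    fun h => @Module.Finite.equiv R _ _ _ _ _ _ _ h e.symm⟩

lemma fin_loc_iff (a : Ideal R) (i : ℕ) (p : PrimeSpectrum R) :
    Module.Finite (Localization.AtPrime p.asIdeal) (locH (Localization.AtPrime p.asIdeal)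
      (a.map (algebraMap R (Localization.AtPrime p.asIdeal))) i (LocalizedModule p.asIdeal.primeCompl M))
    ↔ Module.Finite (Localization p.asIdeal.primeCompl)
      (LocalizedModule p.asIdeal.primeCompl (HH R a i M)) := by
  have : IsNoetherianRing (Localization.AtPrime p.asIdeal) :=
    IsLocalization.isNoetherianRing p.asIdeal.primeCompl _ inferInstance
  refine (fin_iff (R := Localization.AtPrime p.asIdeal) _ _ i).trans ?_
  obtain ⟨e⟩ := HH_loc p.asIdeal.primeCompl a i M
  exact ⟨fun h => @Module.Finite.equiv _ _ _ _ _ _ _ _ h e.symm,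
    fun h => @Module.Finite.equiv _ _ _ _ _ _ _ _ h e⟩
end final
end Part6
end FLT

/-- Faltings' local-global principle for finiteness dimensions:
`f_a(M) = inf{f_{aR_p}(M_p) : p ∈ Spec R}`. -/
theorem finDim_eq_inf_localizations (R : Type u) [CommRing R] [IsNoetherianRing R]
    (a : Ideal R)
    (M : Type u) [AddCommGroup M] [Module R M] [Module.Finite R M] :
    finDim R a M = sInf {d : ℕ∞ | ∃ p : PrimeSpectrum R,
      d = finDim (Localization.AtPrime p.asIdeal)
        (a.map (algebraMap R (Localization.AtPrime p.asIdeal)))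
        (LocalizedModule p.asIdeal.primeCompl M)} := by
  apply le_antisymm
  · refine le_sInf ?_
    rintro d ⟨p, rfl⟩
    refine le_sInf ?_
    rintro _ ⟨i, hi, rfl⟩
    refine sInf_le ⟨i, fun h => hi ?_, rfl⟩
    have := (FLT.fin_iff M a i).1 h
    refine (FLT.fin_loc_iff M a i p).2 ?_
    exact Module.Finite.of_isLocalizedModule p.asIdeal.primeCompl
      (LocalizedModule.mkLinearMap p.asIdeal.primeCompl (FLT.HH R a i M))
  · refine le_sInf ?_
    rintro _ ⟨i, hi, rfl⟩
    by_contra hlt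
    rw [not_le] at hlt
    have key : ∀ j ≤ i, Module.Finite R (FLT.HH R a j M) := by
      intro j
      induction j using Nat.strong_induction_on with
      | _ j ih =>
        intro hj
        have hcol := FLT.col_HH_fg (a := a) j M (fun l hl => ih l hl (hl.le.trans hj))
        refine FLT.finite_of_local (fun z => FLT.HH_tors j z) hcol fun p => ?_
        by_contra hn
        have h1 := (FLT.fin_loc_iff M a j p).not.2 hn
        have h2 : finDim (Localization.AtPrime p.asIdeal)
            (a.map (algebraMap R (Localization.AtPrime p.asIdeal)))
            (LocalizedModule p.asIdeal.primeCompl M) ≤ (j : ℕ∞) := sInf_le ⟨j, h1, rfl⟩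
        have h3 := (sInf_le ⟨p, rfl⟩ : sInf {d : ℕ∞ | ∃ p : PrimeSpectrum R,
          d = finDim (Localization.AtPrime p.asIdeal)
            (a.map (algebraMap R (Localization.AtPrime p.asIdeal)))
            (LocalizedModule p.asIdeal.primeCompl M)} ≤ _)
        have h4 := hlt.trans_le (h3.trans h2)
        exact absurd hj (not_le.2 (by exact_mod_cast h4))
    exact hi ((FLT.fin_iff M a i).2 (key i le_rfl))
end

section
/- Let R be a commutative Noetherian ring, a and b ideals with b ⊆ a, and M a finitely generated R-module. Then f_a(M) = min{f_a^b(M), c_a^b(M)}, where f_a(M) is the finiteness dimension of M relative to a, f_a^b(M) is the b-finiteness dimension of M relative to a, and c_a^b(M) is the b-cofiniteness dimension of M relative to a. -/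
open CategoryTheory

universe u

section Helpers

open CategoryTheory Limits

variable {R : Type u} [CommRing R]

/-- The submodule of elements killed by an ideal of bounded power is f.g. -/
theorem aux_finite_of_pow [IsNoetherianRing R] (b : Ideal R) (H : Type u) [AddCommGroup H]
    [Module R H] (h1 : (Submodule.torsionBySet R H (b : Set R)).FG) (n : ℕ)
    (hn : b ^ n • (⊤ : Submodule R H) = ⊥) : Module.Finite R H := by
  have key : ∀ k : ℕ, (Submodule.torsionBySet R H ((b ^ k : Ideal R) : Set R)).FG := by
    intro k
    induction k with
    | zero =>
      have : Submodule.torsionBySet R H ((b ^ 0 : Ideal R) : Set R) = ⊥ := by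
        rw [eq_bot_iff]
        intro x hx
        rw [Submodule.mem_torsionBySet_iff] at hx
        have := hx ⟨1, by simp⟩
        simpa using this
      rw [this]
      exact Submodule.fg_bot
    | succ k ih =>
      obtain ⟨s, hs⟩ := (IsNoetherian.noetherian b : b.FG)
      -- multiplication by the generators
      let φ : H →ₗ[R] (s → H) := LinearMap.pi fun r => LinearMap.lsmul R H (r : R)
      let T := Submodule.torsionBySet R H ((b ^ (k + 1) : Ideal R) : Set R)
      let S := Submodule.torsionBySet R H ((b ^ k : Ideal R) : Set R)
      have hTS : ∀ x ∈ T, ∀ r ∈ b, r • x ∈ S := by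
        intro x hx r hr
        rw [Submodule.mem_torsionBySet_iff] at hx ⊢
        rintro ⟨c, hc⟩
        have := hx ⟨c * r, by rw [pow_succ]; exact Ideal.mul_mem_mul hc hr⟩
        simpa [mul_smul] using this
      have hker : LinearMap.ker φ = Submodule.torsionBySet R H (b : Set R) := by
        ext x
        rw [LinearMap.mem_ker, Submodule.mem_torsionBySet_iff]
        constructor
        · intro h
          have hb : b ≤ LinearMap.ker (LinearMap.toSpanSingleton R H x) := by
            rw [← hs, Submodule.span_le]
            intro r hr
            simpa [φ] using congrFun h ⟨r, hr⟩
          rintro ⟨r, hr⟩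
          simpa using hb hr
        · intro h
          funext r
          have := h ⟨(r : R), by rw [← hs]; exact Ideal.subset_span r.2⟩
          simpa [φ] using this
      have : Module.Finite R S := Module.Finite.iff_fg.mpr ih
      have hpi : (Submodule.pi Set.univ (fun _ : s => S)).FG := by
        exact Submodule.fg_pi (fun _ => ih)
      have : IsNoetherian R (Submodule.pi Set.univ (fun _ : s => S)) :=
        isNoetherian_of_fg_of_noetherian _ hpi
      refine Submodule.fg_of_fg_map_of_fg_inf_ker φ ?_ ?_
      · refine Submodule.FG.of_le hpi ?_
        rintro _ ⟨x, hx, rfl⟩ r -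
        exact hTS x hx r (by rw [← hs]; exact Ideal.subset_span r.2)
      · rw [hker]
        exact Submodule.FG.of_le h1 inf_le_right
  refine ⟨?_⟩
  convert key n
  rw [eq_comm, eq_top_iff]
  intro x _
  rw [Submodule.mem_torsionBySet_iff]
  rintro ⟨c, hc⟩
  have : c • x ∈ b ^ n • (⊤ : Submodule R H) := Submodule.smul_mem_smul hc trivial
  rw [hn] at this
  simpa using this

instance aux_enough [IsNoetherianRing R] : EnoughProjectives (FGModuleCat.{u} R) where
  presentation X := by
    obtain ⟨n, f, hf⟩ := Module.Finite.exists_fin' R X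
    refine ⟨{ p := FGModuleCat.of R (Fin n → R), projective := ⟨?_⟩,
              f := FGModuleCat.ofHom f, epi := ?_ }⟩
    · intro E X g e he
      have he' : Epi ((forget₂ (FGModuleCat.{u} R) (ModuleCat.{u} R)).map e) := inferInstance
      obtain ⟨k, hk⟩ := Module.projective_lifting_property e.hom.hom g.hom.hom
        ((ModuleCat.epi_iff_surjective _).mp he')
      exact ⟨FGModuleCat.ofHom k, FGModuleCat.hom_ext hk⟩
    · apply (forget₂ (FGModuleCat.{u} R) (ModuleCat.{u} R)).epi_of_epi_map
      exact (ModuleCat.epi_iff_surjective _).mpr hf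

instance aux_presProj [IsNoetherianRing R] :
    (forget₂ (FGModuleCat.{u} R) (ModuleCat.{u} R)).PreservesProjectiveObjects where
  projective_obj {X} hX := by
    obtain ⟨n, f, hf⟩ := Module.Finite.exists_fin' R X
    let f' : FGModuleCat.of R (Fin n → R) ⟶ X := FGModuleCat.ofHom f
    have : Epi f' := by
      apply (forget₂ (FGModuleCat.{u} R) (ModuleCat.{u} R)).epi_of_epi_map
      exact (ModuleCat.epi_iff_surjective _).mpr hf
    let s : X ⟶ FGModuleCat.of R (Fin n → R) := Projective.factorThru (𝟙 X) f'
    have hs : s ≫ f' = 𝟙 X := Projective.factorThru_comp _ _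
    have : Module.Projective R X := by
      refine Module.Projective.of_split s.hom.hom f'.hom.hom ?_
      rw [← FGModuleCat.hom_hom_comp, hs]
      rfl
    exact @ModuleCat.projective_of_categoryTheory_projective R _
      ((forget₂ (FGModuleCat.{u} R) (ModuleCat.{u} R)).obj X) this

theorem aux_ext_finite [IsNoetherianRing R] (N H : Type u) [AddCommGroup N] [Module R N]
    [AddCommGroup H] [Module R H] [Module.Finite R N] [Module.Finite R H] (i : ℕ) :
    Module.Finite R (extMod R i N H) := by
  let P := ProjectiveResolution.of (FGModuleCat.of R N)
  have : (forget₂ (FGModuleCat.{u} R) (ModuleCat.{u} R)).PreservesHomology := inferInstance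
  let Q : ProjectiveResolution (ModuleCat.of R N) :=
    (forget₂ (FGModuleCat.{u} R) (ModuleCat.{u} R)).mapProjectiveResolution P
  let e := (Q.isoExt (R := R) i (ModuleCat.of R H)).toLinearEquiv
  let K := Q.complex.linearYonedaObj R (ModuleCat.of R H)
  have hfin : Module.Finite R (K.X i) := by
    have : Module.Finite R (Q.complex.X i) := (P.complex.X i).property
    exact Module.Finite.equiv
      (ModuleCat.homLinearEquiv (S := R) (M := Q.complex.X i) (N := ModuleCat.of R H)).symm
  have hc : Module.Finite R (K.cycles i) :=
    Module.Finite.of_injective (K.iCycles i).hom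
      ((ModuleCat.mono_iff_injective _).mp inferInstance)
  have hh : Module.Finite R (K.homology i) :=
    Module.Finite.of_surjective (K.homologyπ i).hom
      ((ModuleCat.epi_iff_surjective _).mp inferInstance)
  exact Module.Finite.equiv e.symm

theorem aux_ext_zero (N H : Type u) [AddCommGroup N] [Module R N]
    [AddCommGroup H] [Module R H] [h : Module.Finite R (extMod R 0 N H)] :
    Module.Finite R (N →ₗ[R] H) := by
  let F := (linearYoneda R (ModuleCat.{u} R)).obj (ModuleCat.of R H)
  have : PreservesFiniteLimits (F ⋙ forget (ModuleCat.{u} R)) :=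
    inferInstanceAs (PreservesFiniteLimits (yoneda.obj (ModuleCat.of R H)))
  have : PreservesFiniteLimits F := preservesFiniteLimits_of_reflects_of_preserves F
    (forget (ModuleCat.{u} R))
  have : PreservesFiniteColimits F.rightOp := preservesFiniteColimits_rightOp F
  let e := (F.rightOp.leftDerivedZeroIsoSelf.app (ModuleCat.of R N)).unop.toLinearEquiv
  have h' : Module.Finite R
    ((F.rightOp.leftDerived 0).obj (ModuleCat.of R N)).unop := h
  have h2 : Module.Finite R (ModuleCat.of R N ⟶ ModuleCat.of R H) :=
    Module.Finite.equiv e.symm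
  exact Module.Finite.equiv
    (ModuleCat.homLinearEquiv (S := R) (M := ModuleCat.of R N) (N := ModuleCat.of R H))

theorem aux_ext_smul (N H : ModuleCat.{u} R) (i : ℕ) (r : R) (hr : ∀ x : N, r • x = 0)
    (y : ((Ext R (ModuleCat.{u} R) i).obj (Opposite.op N)).obj H) : r • y = 0 := by
  let P := ProjectiveResolution.of N
  let e := (P.isoExt (R := R) i H).toLinearEquiv
  let K := P.complex.linearYonedaObj R H
  have hP : (r • 𝟙 P.complex) ≫ P.π = 0 := by
    apply HomologicalComplex.to_single_hom_ext
    ext x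
    exact (map_smul (P.π.f 0).hom r x).trans (hr (P.π.f 0 x))
  let h := ProjectiveResolution.liftHomotopyZero _ hP
  have main : ∀ z : K.homology i, r • z = 0 := by
    intro z
    obtain ⟨c, rfl⟩ := (ModuleCat.epi_iff_surjective (K.homologyπ i)).mp inferInstance z
    let f : P.complex.X i ⟶ H := K.iCycles i c
    have hf : P.complex.d (i + 1) i ≫ f = 0 := by
      have := ConcreteCategory.congr_hom (K.iCycles_d i (i + 1)) c
      exact this
    let j := (ComplexShape.down ℕ).next i
    let g : P.complex.X j ⟶ H := h.hom j i ≫ f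
    have hrf : r • f = P.complex.d i j ≫ g := by
      have := h.comm i
      have h2 := congrArg (fun k => k ≫ f) this
      simp only [HomologicalComplex.smul_f_apply, HomologicalComplex.id_f, Linear.smul_comp,
        Category.id_comp, Preadditive.add_comp] at h2
      rw [h2, prevD_eq _ (show (ComplexShape.down ℕ).Rel (i + 1) i by simp)]
      simp [hf, dNext, g, j]
    have hrc : r • c = (K.toCycles j i) g := by
      apply (ModuleCat.mono_iff_injective (K.iCycles i)).mp inferInstance
      rw [map_smul]
      have := ConcreteCategory.congr_hom (K.toCycles_i j i) g
      refine Eq.trans ?_ this.symm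
      exact hrf
    rw [← map_smul, hrc]
    exact ConcreteCategory.congr_hom (K.toCycles_comp_homologyπ j i) g
  apply e.injective
  rw [map_smul, map_zero]
  exact main _

theorem aux_torsion (a : Ideal R) (i : ℕ) (M : Type u) [AddCommGroup M] [Module R M]
    (x : locH R a i M) : ∃ t : ℕ, ∀ r ∈ a ^ t, r • x = 0 := by
  let D := localCohomology.diagram (localCohomology.idealPowersDiagram a) i
  let c := ((evaluation _ _).obj (ModuleCat.of R M)).mapCocone (colimit.cocone D)
  have hc : IsColimit c :=
    isColimitOfPreserves ((evaluation _ _).obj (ModuleCat.of R M)) (colimit.isColimit D)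
  have : IsFiltered ℕᵒᵖᵒᵖ := IsFiltered.of_equivalence (opOpEquivalence ℕ).symm
  have : PreservesFilteredColimitsOfSize.{0, 0} (forget (ModuleCat.{u} R)) :=
    preservesFilteredColimitsOfSize_shrink.{0, u, 0, u} _
  obtain ⟨t, y, hy⟩ := Concrete.isColimit_exists_rep _ hc x
  refine ⟨t.unop.unop, fun r hr => ?_⟩
  have hz : r • y = 0 := by
    refine aux_ext_smul _ _ i r ?_ y
    intro x
    obtain ⟨x, rfl⟩ := Ideal.Quotient.mk_surjective x
    change Ideal.Quotient.mk _ (r * x) = 0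
    exact Ideal.Quotient.eq_zero_iff_mem.mpr (Ideal.mul_mem_right _ _ hr)
  rw [← hy]
  have := map_smul (c.ι.app t).hom r y
  rw [hz, map_zero] at this
  exact this.symm

theorem aux_key [IsNoetherianRing R] (a b : Ideal R) (hba : b ≤ a) (i : ℕ)
    (M : Type u) [AddCommGroup M] [Module R M] :
    Module.Finite R (locH R a i M) ↔
      (∃ n : ℕ, b ^ n • (⊤ : Submodule R (locH R a i M)) = ⊥) ∧
        IsCofinite R b (locH R a i M) := by
  constructor
  · intro hfin
    refine ⟨?_, ?_, fun j => aux_ext_finite _ _ j⟩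
    · obtain ⟨s, hs⟩ := hfin.fg_top
      choose t ht using aux_torsion a i M
      refine ⟨s.sup t, ?_⟩
      rw [← hs, eq_bot_iff, Submodule.smul_le]
      intro r hr x hx
      have : Submodule.span R (s : Set (locH R a i M)) ≤
          LinearMap.ker (LinearMap.lsmul R (locH R a i M) r) := by
        rw [Submodule.span_le]
        intro y hy
        exact ht y r (Ideal.pow_le_pow_right (Finset.le_sup hy) (Ideal.pow_right_mono hba _ hr))
      exact this hx
    · intro p hp r hr
      rw [Module.mem_support_iff_exists_annihilator] at hp
      obtain ⟨m, hm⟩ := hp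
      obtain ⟨t, ht⟩ := aux_torsion a i M m
      refine p.2.mem_of_pow_mem t (hm ?_)
      rw [Submodule.mem_annihilator_span_singleton]
      exact ht _ (Ideal.pow_mem_pow (hba hr) t)
  · rintro ⟨⟨n, hn⟩, -, hext⟩
    refine aux_finite_of_pow b _ ?_ n hn
    have := hext 0
    have hfin : Module.Finite R (R ⧸ b →ₗ[R] locH R a i M) := aux_ext_zero _ _
    let ev : (R ⧸ b →ₗ[R] locH R a i M) →ₗ[R] locH R a i M :=
      LinearMap.applyₗ (Ideal.Quotient.mk b 1)
    have : Submodule.torsionBySet R (locH R a i M) (b : Set R) = LinearMap.range ev := by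
      ext x
      rw [Submodule.mem_torsionBySet_iff]
      constructor
      · intro h
        refine ⟨Submodule.liftQ b (LinearMap.toSpanSingleton R _ x) ?_, ?_⟩
        · intro r hr
          exact h ⟨r, hr⟩
        · change (1 : R) • x = x
          simp
      · rintro ⟨f, rfl⟩ ⟨r, hr⟩
        change r • f (Ideal.Quotient.mk b 1) = 0
        rw [← map_smul]
        have : r • (Ideal.Quotient.mk b 1) = 0 := by
          change Ideal.Quotient.mk b (r * 1) = 0
          rw [mul_one]
          exact Ideal.Quotient.eq_zero_iff_mem.mpr hr
        rw [this, map_zero]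
    rw [this, LinearMap.range_eq_map]
    exact hfin.fg_top.map ev

end Helpers

/-- `f_a(M) = min{f_a^b(M), c_a^b(M)}`. -/
theorem finDim_eq_min_fab_cofDim (R : Type u) [CommRing R] [IsNoetherianRing R]
    (a b : Ideal R) (hba : b ≤ a)
    (M : Type u) [AddCommGroup M] [Module R M] [Module.Finite R M] :
    finDim R a M = min (fab R a b M) (cofDim R a b M) := by
  unfold finDim fab cofDim
  rw [← sInf_union, ← Set.image_union]
  congr 2
  ext i
  change ¬ _ ↔ (∀ n : ℕ, _ ≠ _) ∨ ¬ _
  rw [aux_key a b hba i M, not_and_or, not_exists]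
end

section
/- Let R be a commutative Noetherian ring, a and b ideals with b ⊆ a, and M a finitely generated R-module. Then f_a(M) ≤ c_a^b(M); that is, if i < f_a(M) then H^i_a(M) is b-cofinite. In particular, every finitely generated R-module N with Supp N ⊆ V(a) is b-cofinite. -/
open CategoryTheory

universe u

open Limits

universe v

lemma extMk_zero_deg {C : Type*} [Category* C] [Abelian C] [HasExt.{v} C] {X Y : C}
    (P : ProjectiveResolution X) (f : P.complex.X 0 ⟶ Y) (m : ℕ) (hm : 0 + 1 = m)
    (hf : P.complex.d m 0 ≫ f = 0) (h : P.extMk f m hm hf = 0) : f = 0 := by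
  simp only [← P.extEquivCohomologyClass.apply_eq_iff_eq,
    ProjectiveResolution.extEquivCohomologyClass_extMk,
    ProjectiveResolution.extEquivCohomologyClass_zero,
    CochainComplex.HomComplex.CohomologyClass.mk_eq_zero_iff] at h
  rw [CochainComplex.HomComplex.Cocycle.toSingleMk_mem_coboundaries_iff _ _ _ _ _ 1 (by simp)] at h
  obtain ⟨g, hg⟩ := h
  have hz : IsZero (P.cochainComplex.X 1) :=
    P.cochainComplex.isZero_of_isStrictlyLE 0 1 (by simp)
  rw [hz.eq_of_src g 0, comp_zero] at hg
  rw [← cancel_epi (P.cochainComplexXIso (-(0:ℕ)) 0 rfl).hom, ← hg, comp_zero]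

lemma extMk_exists {C : Type*} [Category* C] [Abelian C] [HasExt.{v} C] {X Y : C}
    {n : ℕ} (P : ProjectiveResolution X) (f : P.complex.X n ⟶ Y) (m : ℕ) (hm : n + 1 = m)
    (hf : P.complex.d m n ≫ f = 0) :
    P.extMk f m hm hf = 0 ↔ ∃ g : P.complex.X ((ComplexShape.up ℕ).prev n) ⟶ Y,
      P.complex.d n _ ≫ g = f := by
  cases n with
  | zero =>
    constructor
    · intro h
      exact ⟨0, by rw [extMk_zero_deg P f m hm hf h, comp_zero]⟩
    · rintro ⟨g, hg⟩
      obtain rfl : f = 0 := by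
        rw [← hg, P.complex.shape _ _ (by simp), zero_comp]
      simp
  | succ p =>
    exact P.extMk_eq_zero_iff f m hm hf _ (by simp)

lemma extMk_smul {R : Type u} [CommRing R] {X Y : ModuleCat.{u} R} {n : ℕ}
    (P : ProjectiveResolution X) (r : R) (f : P.complex.X n ⟶ Y) (m : ℕ) (hm : n + 1 = m)
    (hf : P.complex.d m n ≫ f = 0) (hf' : P.complex.d m n ≫ (r • f) = 0) :
    P.extMk (r • f) m hm hf' = r • P.extMk f m hm hf := by
  rw [Abelian.Ext.smul_eq_comp_mk₀, P.extMk_comp_mk₀]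
  congr 1

lemma exists_injective_ext {R : Type u} [CommRing R] {X Y : ModuleCat.{u} R} (n : ℕ) :
    ∃ ψ : ((Ext R (ModuleCat.{u} R) n).obj (Opposite.op X)).obj Y →ₗ[R] Abelian.Ext X Y n,
      Function.Injective ψ := by
  let P := projectiveResolution X
  let K := P.complex.linearYonedaObj R Y
  let S := K.sc n
  let e₁ := (P.isoExt (R := R) n Y).toLinearEquiv
  let e₂ := (S.moduleCatHomologyIso).toLinearEquiv
  have hm : n + 1 = (ComplexShape.up ℕ).next n := by simp
  let φ : LinearMap.ker S.g.hom →ₗ[R] Abelian.Ext X Y n :=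
    { toFun := fun z => P.extMk (n := n) (Y := Y) z.1 _ hm z.2
      map_add' := fun x y => (P.add_extMk _ _ _ _ _ _).symm
      map_smul' := fun r x => by
        exact extMk_smul P r _ _ hm x.2 _ }
  have hker : LinearMap.ker φ = LinearMap.range S.moduleCatToCycles := by
    ext z
    rw [LinearMap.mem_ker]
    refine (extMk_exists P _ _ hm z.2).trans ?_
    constructor
    · rintro ⟨g, hg⟩
      exact ⟨g, Subtype.ext hg⟩
    · rintro ⟨g, hg⟩
      exact ⟨g, congrArg Subtype.val hg⟩
  let φ' : (LinearMap.ker S.g.hom ⧸ LinearMap.range S.moduleCatToCycles) →ₗ[R]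
    Abelian.Ext X Y n := (LinearMap.range S.moduleCatToCycles).liftQ φ hker.ge
  have hφ' : Function.Injective φ' := by
    rw [← LinearMap.ker_eq_bot]
    exact Submodule.ker_liftQ_eq_bot _ _ _ hker.le
  refine ⟨φ' ∘ₗ e₂.toLinearMap ∘ₗ e₁.toLinearMap, ?_⟩
  exact hφ'.comp (e₂.injective.comp e₁.injective)

lemma extMod_finite (R : Type u) [CommRing R] [IsNoetherianRing R] (i : ℕ)
    (N : Type u) [AddCommGroup N] [Module R N] [Module.Finite R N]
    (N' : Type u) [AddCommGroup N'] [Module R N'] [Module.Finite R N'] :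
    Module.Finite R (extMod R i N N') := by
  obtain ⟨ψ, hψ⟩ := exists_injective_ext (X := ModuleCat.of R N) (Y := ModuleCat.of R N') i
  exact Module.Finite.of_injective ψ hψ

lemma ext_smul_zero {R : Type u} [CommRing R] (J : Ideal R) (Y : ModuleCat.{u} R) (n : ℕ)
    (r : R) (hr : r ∈ J)
    (x : ((Ext R (ModuleCat.{u} R) n).obj (Opposite.op (ModuleCat.of R (R ⧸ J)))).obj Y) :
    r • x = 0 := by
  obtain ⟨ψ, hψ⟩ := exists_injective_ext (X := ModuleCat.of R (R ⧸ J)) (Y := Y) n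
  apply hψ
  rw [map_smul, map_zero]
  have h0 : r • 𝟙 (ModuleCat.of R (R ⧸ J)) = 0 := by
    ext
    change Ideal.Quotient.mk J (r • 1) = 0
    rw [Ideal.Quotient.eq_zero_iff_mem]
    simpa using hr
  rw [← Abelian.Ext.mk₀_id_comp (ψ x), ← Abelian.Ext.smul_comp, ← Abelian.Ext.mk₀_smul, h0,
    Abelian.Ext.mk₀_zero, Abelian.Ext.zero_comp]

lemma locH_torsion (R : Type u) [CommRing R] (a : Ideal R) (i : ℕ)
    (M : Type u) [AddCommGroup M] [Module R M] (x : locH R a i M) :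
    ∃ n : ℕ, ∀ r ∈ a ^ n, r • x = 0 := by
  let D := localCohomology.diagram (localCohomology.idealPowersDiagram a) i
  let Y := ModuleCat.of R M
  let c := ((evaluation (ModuleCat.{u} R) (ModuleCat.{u} R)).obj Y).mapCocone (colimit.cocone D)
  have hc : IsColimit c := isColimitOfPreserves _ (colimit.isColimit D)
  let T : Submodule R (locH R a i M) :=
    { carrier := {x | ∃ n : ℕ, ∀ r ∈ a ^ n, r • x = 0}
      zero_mem' := ⟨0, fun r _ => smul_zero r⟩
      add_mem' := by
        rintro x y ⟨n, hn⟩ ⟨m, hm⟩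
        refine ⟨n + m, fun r hr => ?_⟩
        rw [smul_add, hn r (Ideal.pow_le_pow_right (Nat.le_add_right n m) hr),
          hm r (Ideal.pow_le_pow_right (Nat.le_add_left m n) hr), add_zero]
      smul_mem' := by
        rintro s x ⟨n, hn⟩
        refine ⟨n, fun r hr => ?_⟩
        rw [smul_comm, hn r hr, smul_zero] }
  let q : c.pt ⟶ ModuleCat.of R (locH R a i M ⧸ T) := ModuleCat.ofHom T.mkQ
  have hq : q = 0 := by
    refine hc.hom_ext fun j => ?_
    rw [comp_zero]
    refine ModuleCat.hom_ext (LinearMap.ext fun y => ?_)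
    refine (Submodule.Quotient.mk_eq_zero T).mpr ⟨j.unop.unop, fun r hr => ?_⟩
    refine (map_smul (c.ι.app j).hom r y).symm.trans ?_
    have : r • y = 0 := ext_smul_zero _ Y i r hr y
    rw [this, map_zero]
    rfl
  have hx : T.mkQ x = 0 := congrArg (fun g : c.pt ⟶ ModuleCat.of R (locH R a i M ⧸ T) => g.hom x) hq
  exact (Submodule.Quotient.mk_eq_zero T).mp hx

lemma locH_support (R : Type u) [CommRing R] (a : Ideal R) (i : ℕ)
    (M : Type u) [AddCommGroup M] [Module R M] :
    Module.support R (locH R a i M) ⊆ PrimeSpectrum.zeroLocus (a : Set R) := by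
  intro p hp r hr
  obtain ⟨x, hx⟩ := Module.mem_support_iff'.mp hp
  obtain ⟨n, hn⟩ := locH_torsion R a i M x
  by_contra hrp
  exact hx (r ^ n) (fun h => hrp (p.2.mem_of_pow_mem _ h)) (hn _ (Ideal.pow_mem_pow hr n))

/-- `f_a(M) ≤ c_a^b(M)`; i.e. `H^i_a(M)` is `b`-cofinite for `i < f_a(M)`;
in particular every finitely generated module supported in `V(a)` is `b`-cofinite. -/
theorem finDim_le_cofDim (R : Type u) [CommRing R] [IsNoetherianRing R]
    (a b : Ideal R) (hba : b ≤ a)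
    (M : Type u) [AddCommGroup M] [Module R M] [Module.Finite R M] :
    finDim R a M ≤ cofDim R a b M ∧
    (∀ i : ℕ, (i : ℕ∞) < finDim R a M → IsCofinite R b (locH R a i M)) ∧
    (∀ (N : Type u) [AddCommGroup N] [Module R N], Module.Finite R N →
      Module.support R N ⊆ PrimeSpectrum.zeroLocus (a : Set R) →
      IsCofinite R b N) := by
  have key : ∀ (N : Type u) [AddCommGroup N] [Module R N], Module.Finite R N →
      Module.support R N ⊆ PrimeSpectrum.zeroLocus (a : Set R) → IsCofinite R b N :=
    fun N _ _ _ hN => ⟨hN.trans (PrimeSpectrum.zeroLocus_anti_mono_ideal hba),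
      fun i => extMod_finite R i _ _⟩
  have main : ∀ i : ℕ, (i : ℕ∞) < finDim R a M → IsCofinite R b (locH R a i M) := by
    intro i hi
    refine key _ ?_ (locH_support R a i M)
    by_contra h
    have h' : finDim R a M ≤ (i : ℕ∞) := sInf_le ⟨i, h, rfl⟩
    exact absurd h' (not_le.mpr hi)
  refine ⟨?_, main, key⟩
  refine le_sInf ?_
  rintro _ ⟨i, hi, rfl⟩
  by_contra h
  exact hi (main i (not_le.mp h))
end

section
/- Let R be a commutative Noetherian ring, a and b ideals with b ⊆ a, and M a finitely generated R-module. If f_a(M) ≠ c_a^b(M), then f_a(M) = f_a^b(M). -/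
open CategoryTheory

universe u

namespace FinRes
open CategoryTheory.Limits

variable {R : Type u} [CommRing R] [IsNoetherianRing R]

lemma exists_cover (Z : ModuleCat.{u} R) : ∃ (P : ModuleCat.{u} R) (p : P ⟶ Z),
    Projective P ∧ Epi p ∧ (Module.Finite R Z → Module.Finite R P) := by
  by_cases h : Module.Finite R Z
  · obtain ⟨n, f, hf⟩ := Module.Finite.exists_fin' R Z
    refine ⟨ModuleCat.of R (Fin n → R), ModuleCat.ofHom f, ?_, ?_, ?_⟩
    · exact ModuleCat.projective_of_free (Pi.basisFun R (Fin n))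
    · rw [ModuleCat.epi_iff_surjective]; exact hf
    · intro _; exact inferInstanceAs (Module.Finite R (Fin n → R))
  · exact ⟨Projective.over Z, Projective.π Z, inferInstance, inferInstance, fun h' => (h h').elim⟩

noncomputable def cov (Z : ModuleCat.{u} R) : ModuleCat.{u} R := (exists_cover Z).choose
noncomputable def covπ (Z : ModuleCat.{u} R) : cov Z ⟶ Z := (exists_cover Z).choose_spec.choose
instance (Z : ModuleCat.{u} R) : Projective (cov Z) := (exists_cover Z).choose_spec.choose_spec.1
instance (Z : ModuleCat.{u} R) : Epi (covπ Z) := (exists_cover Z).choose_spec.choose_spec.2.1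
lemma cov_finite (Z : ModuleCat.{u} R) [h : Module.Finite R Z] : Module.Finite R (cov Z) :=
  (exists_cover Z).choose_spec.choose_spec.2.2 h

noncomputable def syz {X Y : ModuleCat.{u} R} (f : X ⟶ Y) : cov (kernel f) ⟶ X :=
  covπ (kernel f) ≫ kernel.ι f

lemma syz_comp {X Y : ModuleCat.{u} R} (f : X ⟶ Y) : syz f ≫ f = 0 := by
  simp [syz]

lemma syz_exact {X Y : ModuleCat.{u} R} (f : X ⟶ Y) :
    (ShortComplex.mk (syz f) f (syz_comp f)).Exact := by
  let α : ShortComplex.mk (syz f) f (syz_comp f) ⟶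
      ShortComplex.mk (kernel.ι f) f (kernel.condition f) :=
    { τ₁ := covπ _
      τ₂ := 𝟙 _
      τ₃ := 𝟙 _
      comm₁₂ := by simp [syz]
      comm₂₃ := by simp }
  have : Epi α.τ₁ := inferInstanceAs (Epi (covπ _))
  have : IsIso α.τ₂ := inferInstanceAs (IsIso (𝟙 _))
  have : Mono α.τ₃ := inferInstanceAs (Mono (𝟙 _))
  rw [ShortComplex.exact_iff_of_epi_of_isIso_of_mono α]
  apply ShortComplex.exact_of_f_is_kernel
  apply kernelIsKernel

lemma syz_finite {X Y : ModuleCat.{u} R} (f : X ⟶ Y) [Module.Finite R X] :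
    Module.Finite R (cov (kernel f)) := by
  have : Module.Finite R (kernel f : ModuleCat.{u} R) :=
    Module.Finite.of_injective (kernel.ι f).hom
      ((ModuleCat.mono_iff_injective _).1 inferInstance)
  exact cov_finite _

structure St (R : Type u) [CommRing R] where
  X : ModuleCat.{u} R
  Y : ModuleCat.{u} R
  f : X ⟶ Y

variable (Z : ModuleCat.{u} R)

noncomputable def st : ℕ → St R
  | 0 => ⟨_, _, syz (covπ Z)⟩
  | n + 1 => ⟨_, _, syz (st n).f⟩

noncomputable def cpx : ChainComplex (ModuleCat.{u} R) ℕ :=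
  ChainComplex.of (fun n => (st Z n).Y) (fun n => (st Z n).f) (fun n => syz_comp (st Z n).f)

lemma proj_both (n : ℕ) : Projective (st Z n).X ∧ Projective (st Z n).Y := by
  induction n with
  | zero => exact ⟨inferInstanceAs (Projective (cov _)), inferInstanceAs (Projective (cov _))⟩
  | succ n ih => exact ⟨inferInstanceAs (Projective (cov _)), ih.1⟩

lemma fin_both [Module.Finite R Z] (n : ℕ) :
    Module.Finite R (st Z n).X ∧ Module.Finite R (st Z n).Y := by
  induction n with
  | zero =>
    have : Module.Finite R (cov Z) := cov_finite Z
    exact ⟨syz_finite (covπ Z), this⟩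
  | succ n ih =>
    have := ih.1
    exact ⟨syz_finite _, ih.1⟩

lemma cpx_d (n : ℕ) : (cpx Z).d (n + 1) n = (st Z n).f :=
  ChainComplex.of_d (fun n => (st Z n).Y) (fun n => (st Z n).f) n

lemma cpx_exactAt (n : ℕ) : (cpx Z).ExactAt (n + 1) := by
  rw [HomologicalComplex.exactAt_iff' _ (n + 1 + 1) (n + 1) n (by simp) (by simp)]
  have h := syz_exact (st Z n).f
  refine (ShortComplex.exact_iff_of_iso ?_).1 h
  refine ShortComplex.isoMk (Iso.refl _) (Iso.refl _) (Iso.refl _) ?_ ?_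
  · simp only [Iso.refl_hom]
    erw [Category.id_comp, Category.comp_id]
    exact (cpx_d Z (n + 1))
  · simp only [Iso.refl_hom]
    erw [Category.id_comp, Category.comp_id]
    exact cpx_d Z n

lemma cpx_d10 : (cpx Z).d 1 0 = syz (covπ Z) := cpx_d Z 0

noncomputable def res : ProjectiveResolution Z where
  complex := cpx Z
  projective n := (proj_both Z n).2
  π := (ChainComplex.toSingle₀Equiv _ _).symm ⟨covπ Z, by
    rw [cpx_d10]; exact syz_comp _⟩
  quasiIso := ⟨fun n => by
    cases n
    · rw [ChainComplex.quasiIsoAt₀_iff, ShortComplex.quasiIso_iff_of_zeros']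
      · refine (ShortComplex.exact_and_epi_g_iff_of_iso ?_).2
          ⟨syz_exact (covπ Z), inferInstanceAs (Epi (covπ Z))⟩
        refine ShortComplex.isoMk (Iso.refl _) (Iso.refl _) (Iso.refl _) ?_ ?_
        · simp only [Iso.refl_hom]
          exact (Category.id_comp _).trans ((cpx_d10 Z).trans (Category.comp_id _).symm)
        · simp only [Iso.refl_hom]
          refine (Category.id_comp _).trans (Eq.trans ?_ (Category.comp_id _).symm)
          exact ChainComplex.toSingle₀Equiv_symm_apply_f_zero (C := cpx Z) (X := Z) (covπ Z)
            (by rw [cpx_d10]; exact syz_comp _)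
      all_goals rfl
    · rw [quasiIsoAt_iff_exactAt']
      · apply cpx_exactAt
      · apply ChainComplex.exactAt_succ_single_obj⟩

lemma homology_finite (K : CochainComplex (ModuleCat.{u} R) ℕ) (n : ℕ)
    [Module.Finite R (K.X n)] : Module.Finite R (K.homology n) := by
  have : Module.Finite R (K.cycles n) :=
    Module.Finite.of_injective (K.iCycles n).hom
      ((ModuleCat.mono_iff_injective _).1 inferInstance)
  exact Module.Finite.of_surjective (K.homologyπ n).hom
      ((ModuleCat.epi_iff_surjective _).1 inferInstance)

theorem ext_finite (Z N : ModuleCat.{u} R) [Module.Finite R Z] [Module.Finite R N] (n : ℕ) :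
    Module.Finite R (((Ext R (ModuleCat.{u} R) n).obj (Opposite.op Z)).obj N) := by
  have e := (res Z).isoExt (R := R) n N
  have hX : Module.Finite R ((res Z).complex.X n) := (fin_both Z n).2
  have : Module.Finite R (((res Z).complex.linearYonedaObj R N).X n) := by
    have := Module.Finite.equiv
      (ModuleCat.homLinearEquiv (S := R) (M := (res Z).complex.X n) (N := N)).symm
    exact this
  have := homology_finite ((res Z).complex.linearYonedaObj R N) n
  exact Module.Finite.equiv e.symm.toLinearEquiv

theorem ext_smul (I : Ideal R) (N : ModuleCat.{u} R) (n : ℕ) (r : R) (hr : r ∈ I)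
    (x : ((Ext R (ModuleCat.{u} R) n).obj (Opposite.op (ModuleCat.of R (R ⧸ I)))).obj N) :
    r • x = 0 := by
  let P := res (ModuleCat.of R (R ⧸ I))
  let K := P.complex.linearYonedaObj R N
  let e := (P.isoExt (R := R) n N).toLinearEquiv
  suffices h : ∀ y : K.homology n, r • y = 0 by
    apply e.injective
    rw [map_smul, map_zero]; exact h _
  intro y
  obtain ⟨z, rfl⟩ := (ModuleCat.epi_iff_surjective (K.homologyπ n)).1 inferInstance y
  let φ : P.complex.X n ⟶ N := K.iCycles n z
  have hφ : P.complex.d ((ComplexShape.down ℕ).prev n) n ≫ φ = 0 := by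
    have h1 := K.iCycles_d n ((ComplexShape.down ℕ).prev n)
    exact ConcreteCategory.congr_hom h1 z
  have h0 : r • 𝟙 (ModuleCat.of R (R ⧸ I)) = 0 := by
    refine ModuleCat.hom_ext (LinearMap.ext fun w => ?_)
    obtain ⟨w, rfl⟩ := Ideal.Quotient.mk_surjective w
    change r • (Ideal.Quotient.mk I w) = 0
    rw [← Ideal.Quotient.mk_eq_mk, ← Submodule.Quotient.mk_smul, Submodule.Quotient.mk_eq_zero]
    exact I.mul_mem_right _ hr
  let H : Homotopy (r • 𝟙 P.complex) 0 := ProjectiveResolution.liftHomotopyZero _ (by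
    have : P.π ≫ (ChainComplex.single₀ _).map (r • 𝟙 (ModuleCat.of R (R ⧸ I))) = r • P.π := by
      apply HomologicalComplex.to_single_hom_ext
      rw [HomologicalComplex.comp_f, ChainComplex.single₀_map_f_zero]
      exact (Linear.comp_smul _ _ _ _ r _).trans (congrArg (r • ·) (Category.comp_id _))
    rw [Linear.smul_comp, Category.id_comp, ← this, h0, Functor.map_zero, comp_zero])
  have hc := H.comm n
  have key : r • φ = P.complex.d n ((ComplexShape.down ℕ).next n) ≫
      (H.hom ((ComplexShape.down ℕ).next n) n ≫ φ) := by
    have h2 : r • φ = (r • 𝟙 P.complex : P.complex ⟶ P.complex).f n ≫ φ := by simp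
    rw [h2, hc]
    simp [dNext, prevD, hφ]
  let ψ : K.X ((ComplexShape.down ℕ).next n) :=
    (H.hom ((ComplexShape.down ℕ).next n) n ≫ φ :
      P.complex.X ((ComplexShape.down ℕ).next n) ⟶ N)
  have hz : r • z = K.toCycles ((ComplexShape.down ℕ).next n) n ψ := by
    apply (ModuleCat.mono_iff_injective (K.iCycles n)).1 inferInstance
    have h3 := ConcreteCategory.congr_hom (K.toCycles_i ((ComplexShape.down ℕ).next n) n) ψ
    refine Eq.trans ?_ h3.symm
    rw [map_smul]
    exact key
  rw [← map_smul, hz]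
  exact ConcreteCategory.congr_hom (K.toCycles_comp_homologyπ _ _) _

noncomputable instance (N : ModuleCat.{u} R) :
    PreservesFiniteLimits ((linearYoneda R (ModuleCat.{u} R)).obj N) := by
  have : PreservesFiniteLimits ((linearYoneda R (ModuleCat.{u} R)).obj N ⋙ forget _) :=
    inferInstanceAs (PreservesFiniteLimits (yoneda.obj N))
  have : ReflectsFiniteLimits (forget (ModuleCat.{u} R)) := inferInstance
  exact preservesFiniteLimits_of_reflects_of_preserves _ (forget _)

noncomputable def extZero (Z N : ModuleCat.{u} R) :
    (((Ext R (ModuleCat.{u} R) 0).obj (Opposite.op Z)).obj N) ≃ₗ[R] (Z ⟶ N) := by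
  have : PreservesFiniteColimits ((linearYoneda R (ModuleCat.{u} R)).obj N).rightOp :=
    preservesFiniteColimits_rightOp _
  exact ((((linearYoneda R (ModuleCat.{u} R)).obj N).rightOp.leftDerivedZeroIsoSelf.app
    Z).unop.symm).toLinearEquiv


theorem locH_torsion (a : Ideal R) (N : ModuleCat.{u} R) (i : ℕ)
    (x : (localCohomology a i).obj N) : ∃ n : ℕ, ∀ r ∈ a ^ n, r • x = 0 := by
  let F := localCohomology.diagram (localCohomology.idealPowersDiagram a) i
  have := localCohomology.hasColimitDiagram (localCohomology.idealPowersDiagram a) i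
  have hc := isColimitOfPreserves
    ((evaluation (ModuleCat.{u} R) (ModuleCat.{u} R)).obj N) (colimit.isColimit F)
  have hs : PreservesFilteredColimitsOfSize.{0, 0} (forget (ModuleCat.{u} R)) :=
    preservesFilteredColimitsOfSize_shrink.{0, u, 0, u} _
  have := hs.preserves_filtered_colimits ℕᵒᵖᵒᵖ
  obtain ⟨j, y, hy⟩ := Concrete.isColimit_exists_rep _ hc x
  refine ⟨j.unop.unop, fun r hr => ?_⟩
  rw [← hy]
  have h := ext_smul (a ^ j.unop.unop) N i r hr y
  refine ((map_smul (ModuleCat.Hom.hom ((((evaluation (ModuleCat.{u} R)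
    (ModuleCat.{u} R)).obj N).mapCocone (colimit.cocone F)).ι.app j)) r y).symm).trans ?_
  refine (congrArg _ h).trans (map_zero _)

/-- A finitely generated local cohomology module is killed by a power of the ideal. -/
theorem killed_of_finite (a : Ideal R) (N : Type u) [AddCommGroup N] [Module R N]
    [Module.Finite R N] (h : ∀ x : N, ∃ n : ℕ, ∀ r ∈ a ^ n, r • x = 0) :
    ∃ n : ℕ, a ^ n • (⊤ : Submodule R N) = ⊥ := by
  choose n hn using h
  obtain ⟨s, hs⟩ := Module.Finite.fg_top (R := R) (M := N)
  refine ⟨s.sup n, ?_⟩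
  rw [eq_bot_iff, ← hs, Submodule.smul_le]
  intro r hr x hx
  rw [Submodule.mem_bot]
  induction hx using Submodule.span_induction with
  | mem x hx =>
    exact hn x r (Ideal.pow_le_pow_right (Finset.le_sup hx) hr)
  | zero => simp
  | add x y _ _ hx hy => rw [smul_add, hx, hy, add_zero]
  | smul c x _ hx => rw [smul_comm, hx, smul_zero]

theorem isCofinite_of_finite (a b : Ideal R) (hba : b ≤ a) (N : Type u) [AddCommGroup N]
    [Module R N] [Module.Finite R N] (n : ℕ) (h : a ^ n • (⊤ : Submodule R N) = ⊥) :
    IsCofinite R b N := by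
  refine ⟨?_, fun i => ext_finite _ _ i⟩
  rw [Module.support_eq_zeroLocus]
  intro p hp
  rw [PrimeSpectrum.mem_zeroLocus] at hp ⊢
  intro r hr
  refine p.2.mem_of_pow_mem n (hp ?_)
  rw [SetLike.mem_coe, Module.mem_annihilator]
  intro x
  have : r ^ n • x ∈ a ^ n • (⊤ : Submodule R N) :=
    Submodule.smul_mem_smul (Ideal.pow_mem_pow (hba hr) n) trivial
  rwa [h, Submodule.mem_bot] at this

theorem torsion_finite (b : Ideal R) (N : Type u) [AddCommGroup N] [Module R N]
    (h : IsCofinite R b N) : Module.Finite R (Submodule.torsionBySet R N (b : Set R)) := by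
  have h0 : Module.Finite R (extMod R 0 (R ⧸ b) N) := h.2 0
  have h1 : Module.Finite R (ModuleCat.of R (R ⧸ b) ⟶ ModuleCat.of R N) :=
    @Module.Finite.equiv R _ _ _ _ _ _ _ h0 (extZero (ModuleCat.of R (R ⧸ b)) (ModuleCat.of R N))
  have h2 : Module.Finite R ((R ⧸ b) →ₗ[R] N) :=
    Module.Finite.equiv (ModuleCat.homLinearEquiv (S := R)
      (M := ModuleCat.of R (R ⧸ b)) (N := ModuleCat.of R N))
  let ev : ((R ⧸ b) →ₗ[R] N) →ₗ[R] N := LinearMap.applyₗ (1 : R ⧸ b)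
  have h3 : Submodule.torsionBySet R N (b : Set R) ≤ LinearMap.range ev := by
    intro x hx
    rw [Submodule.mem_torsionBySet_iff] at hx
    have hle : b ≤ LinearMap.ker (LinearMap.toSpanSingleton R N x) := by
      intro r hr
      simpa using hx ⟨r, hr⟩
    refine ⟨Submodule.liftQ b (LinearMap.toSpanSingleton R N x) ?_, ?_⟩
    · exact hle
    · change Submodule.liftQ b (LinearMap.toSpanSingleton R N x) hle
        (Submodule.Quotient.mk 1) = x
      rw [Submodule.liftQ_apply]
      exact one_smul R x
  have : IsNoetherian R (LinearMap.range ev) := inferInstance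
  exact Module.Finite.of_injective (Submodule.inclusion h3) (Submodule.inclusion_injective h3)

theorem torsion_pow_finite (b : Ideal R) (N : Type u) [AddCommGroup N] [Module R N]
    (h : Module.Finite R (Submodule.torsionBySet R N (b : Set R))) (n : ℕ) :
    Module.Finite R (Submodule.torsionBySet R N ((b ^ n : Ideal R) : Set R)) := by
  induction n with
  | zero =>
    have : Submodule.torsionBySet R N ((b ^ 0 : Ideal R) : Set R) = ⊥ := by
      rw [eq_bot_iff]
      intro x hx
      rw [Submodule.mem_torsionBySet_iff] at hx
      simpa using hx ⟨1, by simp⟩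
    rw [this]; infer_instance
  | succ n ih =>
    obtain ⟨s, hs⟩ := IsNoetherian.noetherian b
    let T := Submodule.torsionBySet R N ((b ^ (n + 1) : Ideal R) : Set R)
    let T' := Submodule.torsionBySet R N ((b ^ n : Ideal R) : Set R)
    let g : T →ₗ[R] (s → T') := LinearMap.pi fun c =>
      LinearMap.codRestrict T' ((c : R) • T.subtype) (by
        rintro ⟨x, hx⟩
        rw [Submodule.mem_torsionBySet_iff] at hx ⊢
        rintro ⟨r, hr⟩
        have hc : (c : R) ∈ b := hs ▸ Submodule.subset_span c.2
        have := hx ⟨r * c, by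
          rw [pow_succ]; exact Ideal.mul_mem_mul hr hc⟩
        simpa [mul_smul] using this)
    have hN : IsNoetherian R (LinearMap.ker g) := by
      have hk : ∀ y : LinearMap.ker g, ((y : T) : N) ∈ Submodule.torsionBySet R N (b : Set R) := by
        rintro ⟨y, hy⟩
        rw [← hs]
        rw [Submodule.mem_torsionBySet_iff]
        rintro ⟨r, hr⟩
        change r • (y : N) = 0
        have hr' : r ∈ Submodule.span R (s : Set R) := hr
        induction hr' using Submodule.span_induction with
        | mem c hc => exact congrArg Subtype.val (congrFun (LinearMap.mem_ker.1 hy) ⟨c, hc⟩)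
        | zero => simp
        | add c d hc' hd' hc hd => rw [add_smul, hc hc', hd hd', add_zero]
        | smul c d hd' hd => rw [smul_eq_mul, mul_smul, hd hd', smul_zero]
      let k : LinearMap.ker g →ₗ[R] Submodule.torsionBySet R N (b : Set R) :=
        LinearMap.codRestrict _ (T.subtype ∘ₗ (LinearMap.ker g).subtype) hk
      refine isNoetherian_of_injective k ?_
      intro y z hyz
      exact Subtype.ext (Subtype.ext (congrArg (Submodule.torsionBySet R N (b : Set R)).subtype hyz))
    have hR : IsNoetherian R (LinearMap.range g) := inferInstance
    have : IsNoetherian R T :=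
      isNoetherian_of_range_eq_ker (LinearMap.ker g).subtype g.rangeRestrict
        (by rw [Submodule.range_subtype, LinearMap.ker_rangeRestrict])
    exact inferInstanceAs (Module.Finite R T)

theorem finite_of_cofinite (b : Ideal R) (N : Type u) [AddCommGroup N] [Module R N]
    (h : IsCofinite R b N) (n : ℕ) (hn : b ^ n • (⊤ : Submodule R N) = ⊥) :
    Module.Finite R N := by
  have h1 := torsion_pow_finite b N (torsion_finite b N h) n
  have h2 : Submodule.torsionBySet R N ((b ^ n : Ideal R) : Set R) = ⊤ := by
    rw [eq_top_iff]
    intro x _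
    rw [Submodule.mem_torsionBySet_iff]
    rintro ⟨r, hr⟩
    have : r • x ∈ b ^ n • (⊤ : Submodule R N) := Submodule.smul_mem_smul hr trivial
    rwa [hn, Submodule.mem_bot] at this
  rw [h2] at h1
  exact Module.Finite.equiv Submodule.topEquiv

end FinRes

/-- if `f_a(M) ≠ c_a^b(M)` then `f_a(M) = f_a^b(M)`. -/
theorem finDim_eq_fab_of_ne_cofDim (R : Type u) [CommRing R] [IsNoetherianRing R]
    (a b : Ideal R) (hba : b ≤ a)
    (M : Type u) [AddCommGroup M] [Module R M] [Module.Finite R M]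
    (h : finDim R a M ≠ cofDim R a b M) :
    finDim R a M = fab R a b M := by
  have hk : ∀ i : ℕ, Module.Finite R (locH R a i M) →
      ∃ n : ℕ, a ^ n • (⊤ : Submodule R (locH R a i M)) = ⊥ := fun i _ =>
    FinRes.killed_of_finite a _ (FinRes.locH_torsion a (ModuleCat.of R M) i)
  have h1 : finDim R a M ≤ cofDim R a b M := by
    apply sInf_le_sInf
    apply Set.image_mono
    intro i hi hf
    obtain ⟨n, hn⟩ := hk i hf
    exact hi (FinRes.isCofinite_of_finite a b hba _ n hn)
  have h2 : finDim R a M ≤ fab R a b M := by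
    apply sInf_le_sInf
    apply Set.image_mono
    intro i hi hf
    obtain ⟨n, hn⟩ := hk i hf
    refine hi n ?_
    rw [eq_bot_iff, ← hn]
    exact Submodule.smul_mono_left (Ideal.pow_right_mono hba n)
  have h3 : finDim R a M < cofDim R a b M := lt_of_le_of_ne h1 h
  refine le_antisymm h2 ?_
  have hne : ((↑) '' {i : ℕ | ¬ Module.Finite R (locH R a i M)} : Set ℕ∞).Nonempty := by
    by_contra hcon
    rw [Set.not_nonempty_iff_eq_empty] at hcon
    have : finDim R a M = ⊤ := by rw [finDim, hcon, sInf_empty]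
    rw [this] at h3
    exact not_top_lt h3
  obtain ⟨i, hi, hif⟩ := csInf_mem hne
  have hif' : (i : ℕ∞) = finDim R a M := hif
  rw [← hif'] at h3 ⊢
  have hcof : IsCofinite R b (locH R a i M) := by
    by_contra hcon
    exact absurd h3 (not_lt.2 (sInf_le ⟨i, hcon, rfl⟩))
  exact sInf_le ⟨i, fun n hn => hi (FinRes.finite_of_cofinite b _ hcof n hn), rfl⟩
end

section
/- Let (R, m) be a complete Noetherian local ring, M a finitely generated R-module, b ⊆ a ideals of R, and n a non-negative integer such that depth(b, M) ≤ f_a^b(M)_n and the set Ass_R(H_a^{f_a^b(M)}(M)) is finite. Then depth(b, M) ≤ min{f_a^b(M)_n, f_a^n(M)}. -/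
open CategoryTheory

universe u

open CategoryTheory.Limits

/-- Vanishing of the derived-category `Ext` implies vanishing of the derived-functor `Ext`. -/
lemma old_ext_isZero {R : Type u} [CommRing R] (N M : ModuleCat.{u} R) (i : ℕ)
    (h0 : Subsingleton (Abelian.Ext N M 0)) (h : Subsingleton (Abelian.Ext N M i)) :
    IsZero (((Ext R (ModuleCat.{u} R) i).obj (Opposite.op N)).obj M) := by
  let P := projectiveResolution N
  refine IsZero.of_iso ?_ (P.isoExt (R := R) i M)
  rw [← HomologicalComplex.exactAt_iff_isZero_homology]
  cases i with
  | zero =>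
    rw [HomologicalComplex.exactAt_iff' _ 0 0 1 (by simp) (by simp),
      ShortComplex.moduleCat_exact_iff]
    intro f hf
    refine ⟨0, ?_⟩
    change P.complex.X 0 ⟶ M at f
    have hf' : P.complex.d 1 0 ≫ f = 0 := hf
    have hs : Subsingleton (N ⟶ M) := Abelian.Ext.addEquiv₀.subsingleton_congr.mp h0
    obtain ⟨g, hg⟩ := P.exact₀.desc' f hf'
    have hg0 : g = 0 := hs.elim (α := N ⟶ M) g (0 : N ⟶ M)
    subst hg0
    rw [map_zero]
    exact (comp_zero.symm.trans hg)
  | succ i =>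
    rw [HomologicalComplex.exactAt_iff' _ i (i + 1) (i + 2) (by simp) (by simp),
      ShortComplex.moduleCat_exact_iff]
    intro f hf
    have hf' : P.complex.d (i + 2) (i + 1) ≫ f = 0 := hf
    obtain ⟨g, hg⟩ := (P.extMk_eq_zero_iff f (i + 2) rfl hf' i rfl).mp (Subsingleton.elim _ _)
    exact ⟨g, hg⟩

/-- Local cohomology vanishes below the length of a regular sequence. -/
lemma locH_subsingleton (R : Type u) [CommRing R] [IsNoetherianRing R] (a : Ideal R)
    (M : Type u) [AddCommGroup M] [Module R M] [Module.Finite R M]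
    (hlt : a • (⊤ : Submodule R M) < ⊤) (rs : List R) (hmem : ∀ r ∈ rs, r ∈ a)
    (hreg : RingTheory.Sequence.IsRegular M rs) (i : ℕ) (hi : i < rs.length) :
    Subsingleton (locH R a i M) := by
  have hz : ∀ t, IsZero (((localCohomology.diagram
      (localCohomology.idealPowersDiagram a) i).obj t).obj (ModuleCat.of R M)) := by
    intro t
    have key := ModuleCat.subsingleton_ext_of_exists_isRegular a
      (ModuleCat.of R (R ⧸ (a ^ (Opposite.unop (Opposite.unop t))))) (by
        change Module.support R (R ⧸ (a ^ (Opposite.unop (Opposite.unop t)))) ⊆ _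
        rw [Module.support_eq_zeroLocus, Ideal.annihilator_quotient,
          PrimeSpectrum.zeroLocus_subset_zeroLocus_iff]
        intro x hx
        exact ⟨_, Ideal.pow_mem_pow hx _⟩)
      (ModuleCat.of R M) hlt rs hmem hreg
    exact old_ext_isZero _ _ i (key 0 (by omega)) (key i hi)
  apply ModuleCat.subsingleton_of_isZero
  unfold locH localCohomology localCohomology.ofDiagram
  refine IsZero.of_iso ?_ (colimitObjIsoColimitCompEvaluation _ _)
  rw [IsZero.iff_id_eq_zero]
  refine colimit.hom_ext fun t => ?_
  exact (hz t).eq_of_src _ _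

/-- over a complete local ring, if `depth(b,M) ≤ f_a^b(M)_n` and
`Ass_R(H_a^{f_a^b(M)}(M))` is finite, then `depth(b,M) ≤ min{f_a^b(M)_n, f_a^n(M)}`. -/
theorem depth_le_min_fabn_fan (R : Type u) [CommRing R] [IsNoetherianRing R]
    [IsLocalRing R] [IsAdicComplete (IsLocalRing.maximalIdeal R) R]
    (a b : Ideal R) (hba : b ≤ a)
    (M : Type u) [AddCommGroup M] [Module R M] [Module.Finite R M] (n : ℕ)
    (hdepth : mdepth R b M ≤ fabn R a b M n)
    (hfin : ∀ i : ℕ, fab R a b M = (i : ℕ∞) →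
      (associatedPrimes R (locH R a i M)).Finite) :
    mdepth R b M ≤ min (fabn R a b M n) (fan R a M n) := by

  refine le_min hdepth (sSup_le ?_)
  rintro d ⟨rs, rfl, hmem, hreg⟩
  refine le_sInf ?_
  rintro d ⟨p, hp, -, rfl⟩
  refine le_sInf ?_
  rintro _ ⟨i, hi, rfl⟩
  by_contra hlt
  have hlt' : i < rs.length := by simpa using hlt
  apply hi
  have hap : a ≤ p.asIdeal := by
    have := Module.mem_support_iff_of_finite.mp hp
    refine le_trans ?_ this
    intro x hx
    rw [Module.mem_annihilator]
    intro m
    obtain ⟨m, rfl⟩ := Submodule.Quotient.mk_surjective _ m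
    rw [← Submodule.Quotient.mk_smul, Submodule.Quotient.mk_eq_zero]
    exact Submodule.smul_mem_smul hx trivial
  have hpM : p ∈ Module.support R M :=
    Module.support_subset_of_surjective _ (Submodule.mkQ_surjective _) hp
  have hnt : Nontrivial (LocalizedModule p.asIdeal.primeCompl M) :=
    Module.mem_support_iff.mp hpM
  have hreg' : RingTheory.Sequence.IsRegular (LocalizedModule p.asIdeal.primeCompl M)
      (rs.map (algebraMap R (Localization.AtPrime p.asIdeal))) :=
    hreg.toIsWeaklyRegular.isRegular_of_isLocalizedModule_of_mem
      (Localization.AtPrime p.asIdeal) p.asIdeal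
      (LocalizedModule.mkLinearMap p.asIdeal.primeCompl M)
      (fun r hr => hap (hba (hmem r hr)))
  have hJ : a.map (algebraMap R (Localization.AtPrime p.asIdeal)) ≤
      IsLocalRing.maximalIdeal (Localization.AtPrime p.asIdeal) := by
    rw [← Localization.AtPrime.map_eq_maximalIdeal]
    exact Ideal.map_mono hap
  have hnak : a.map (algebraMap R (Localization.AtPrime p.asIdeal)) •
      (⊤ : Submodule (Localization.AtPrime p.asIdeal)
        (LocalizedModule p.asIdeal.primeCompl M)) < ⊤ := by
    refine lt_of_le_of_ne le_top fun h => ?_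
    have := Submodule.eq_bot_of_le_smul_of_le_jacobson_bot
      (a.map (algebraMap R (Localization.AtPrime p.asIdeal)))
      (⊤ : Submodule (Localization.AtPrime p.asIdeal)
        (LocalizedModule p.asIdeal.primeCompl M)) Module.Finite.fg_top h.ge
      (hJ.trans (IsLocalRing.maximalIdeal_le_jacobson _))
    exact top_ne_bot this
  have := locH_subsingleton (Localization.AtPrime p.asIdeal) _
    (LocalizedModule p.asIdeal.primeCompl M) hnak _ (by
      intro r hr
      obtain ⟨s, hs, rfl⟩ := List.mem_map.mp hr
      exact Ideal.mem_map_of_mem _ (hba (hmem s hs))) hreg' i (by simpa using hlt')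
  infer_instance
end

section
/- Let (R, m) be a complete Noetherian local ring, M a finitely generated R-module, a an ideal of R, and s, t non-negative integers. Then the following are equivalent: (i) for all i < t, H^i_a(M) is in dimension < s; (ii) there exists an integer n such that dim Supp(a^n H^i_a(M)) < s for all i < t. -/
open CategoryTheory

universe u

noncomputable section

open Opposite

namespace LCproof

variable {R : Type u} [CommRing R]

/-- map of Hom complexes -/
def yonMap {X X' : ModuleCat.{u} R} (P : ProjectiveResolution X) (P' : ProjectiveResolution X')
    (φ : P'.complex ⟶ P.complex) (Y : ModuleCat.{u} R) :
    P.complex.linearYonedaObj R Y ⟶ P'.complex.linearYonedaObj R Y :=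
  (HomologicalComplex.unopFunctor _ _).map
    ((((linearYoneda R (ModuleCat.{u} R)).obj Y).rightOp.mapHomologicalComplex _).map φ).op

lemma sq_inv {C : Type*} [Category C] {A B A' B' : C} (a : A ≅ B) (a' : A' ≅ B') (m : A' ⟶ A)
    (q : B' ⟶ B) (h : m ≫ a.hom = a'.hom ≫ q) : a'.inv ≫ m = q ≫ a.inv := by
  rw [Iso.inv_comp_eq, ← Category.assoc, Iso.eq_comp_inv]; exact h

lemma isoExt_nat {X X' : ModuleCat.{u} R} (P : ProjectiveResolution X) (P' : ProjectiveResolution X')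
    (g : X' ⟶ X) (φ : P'.complex ⟶ P.complex) (comm : φ.f 0 ≫ P.π.f 0 = P'.π.f 0 ≫ g)
    (Y : ModuleCat.{u} R) (n : ℕ) :
    ((Ext R (ModuleCat.{u} R) n).map g.op).app Y ≫ (P'.isoExt (R := R) n Y).hom =
    (P.isoExt (R := R) n Y).hom ≫ HomologicalComplex.homologyMap (yonMap P P' φ Y) n := by
  have h := ProjectiveResolution.isoLeftDerivedObj_inv_naturality g P' P φ comm
    ((linearYoneda R (ModuleCat.{u} R)).obj Y).rightOp n
  have h2 := HomologicalComplex.homologyOp_hom_naturality (yonMap P P' φ Y) n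
  have h1 := congrArg Quiver.Hom.unop h
  simp only [unop_comp] at h1
  have h3 : (HomologicalComplex.homologyOp (P'.complex.linearYonedaObj R Y) n).inv ≫
     HomologicalComplex.homologyMap
        ((HomologicalComplex.opFunctor (ModuleCat R) (ComplexShape.up ℕ)).map (yonMap P P' φ Y).op) n =
      (HomologicalComplex.homologyMap (yonMap P P' φ Y) n).op ≫
      (HomologicalComplex.homologyOp (P.complex.linearYonedaObj R Y) n).inv :=
    sq_inv _ _ _ _ h2
  have h4 := congrArg Quiver.Hom.unop h3
  have e1 : (P'.isoExt (R := R) n Y).hom =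
    (P'.isoLeftDerivedObj ((linearYoneda R (ModuleCat R)).obj Y).rightOp n).inv.unop ≫
    (HomologicalComplex.homologyOp (P'.complex.linearYonedaObj R Y) n).inv.unop := rfl
  have e2 : (P.isoExt (R := R) n Y).hom =
    (P.isoLeftDerivedObj ((linearYoneda R (ModuleCat R)).obj Y).rightOp n).inv.unop ≫
    (HomologicalComplex.homologyOp (P.complex.linearYonedaObj R Y) n).inv.unop := rfl
  rw [e1, e2]
  have h5 := congrArg (fun z => z ≫ (HomologicalComplex.homologyOp (P'.complex.linearYonedaObj R Y) n).inv.unop) h1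
  refine h5.trans ?_
  exact congrArg (fun z => (P.isoLeftDerivedObj ((linearYoneda R (ModuleCat R)).obj Y).rightOp n).inv.unop ≫ z) h4

variable {X : ModuleCat.{u} R} (P : ProjectiveResolution X) (Y : ModuleCat.{u} R) (n : ℕ)

/-- cocycles -/
def Zc : Submodule R (P.complex.X n ⟶ Y) where
  carrier := {f | P.complex.d (n+1) n ≫ f = 0}
  add_mem' := by intro a b ha hb; simp only [Set.mem_ofPred_eq] at *; simp [ha, hb]
  zero_mem' := by simp
  smul_mem' := by intro c a ha; simp only [Set.mem_ofPred_eq] at *; simp [ha]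

lemma Zc_spec (f : Zc P Y n) : P.complex.d (n+1) n ≫ f.1 = 0 := f.2

def toX : ModuleCat.of R (Zc P Y n) ⟶ (P.complex.linearYonedaObj R Y).X n :=
  ModuleCat.ofHom (Zc P Y n).subtype

def toCyc : ModuleCat.of R (Zc P Y n) ⟶ (P.complex.linearYonedaObj R Y).cycles n :=
  (P.complex.linearYonedaObj R Y).liftCycles (toX P Y n) (n+1) (by simp) (by
    ext ⟨x, hx⟩
    exact hx)

lemma toCyc_i : toCyc P Y n ≫ (P.complex.linearYonedaObj R Y).iCycles n = toX P Y n := by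
  simp [toCyc]

lemma toCyc_surj : Function.Surjective (toCyc P Y n).hom := by
  intro z
  have h : (P.complex.linearYonedaObj R Y).iCycles n ≫ (P.complex.linearYonedaObj R Y).d n (n+1) = 0 :=
    HomologicalComplex.iCycles_d _ _ _
  let w : P.complex.X n ⟶ Y := ((P.complex.linearYonedaObj R Y).iCycles n).hom z
  have hw : w ∈ Zc P Y n := by
    have := congrArg (fun t => t.hom z) h
    exact this
  refine ⟨⟨w, hw⟩, ?_⟩
  have hm : Function.Injective ((P.complex.linearYonedaObj R Y).iCycles n).hom :=
    (ModuleCat.mono_iff_injective _).1 inferInstance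
  apply hm
  exact congrArg (fun t => t.hom ⟨w, hw⟩) (toCyc_i P Y n)

def alpha : Zc P Y n →ₗ[R] ((Ext R (ModuleCat.{u} R) n).obj (op X)).obj Y :=
  (toCyc P Y n ≫ (P.complex.linearYonedaObj R Y).homologyπ n ≫ (P.isoExt (R := R) n Y).inv).hom

lemma alpha_surj : Function.Surjective (alpha P Y n) := by
  have h1 : Function.Surjective ((P.complex.linearYonedaObj R Y).homologyπ n ≫ (P.isoExt (R := R) n Y).inv).hom :=
    (ModuleCat.epi_iff_surjective _).1 inferInstance
  exact h1.comp (toCyc_surj P Y n)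

lemma alpha_eq_zero_iff (f : Zc P Y n) : alpha P Y n f = 0 ↔
    ∃ g : (P.complex.linearYonedaObj R Y).X ((ComplexShape.up ℕ).prev n),
      ((P.complex.linearYonedaObj R Y).d _ n).hom g = f.1 := by
  have h0 : alpha P Y n f = 0 ↔ ((P.complex.linearYonedaObj R Y).homologyπ n).hom ((toCyc P Y n).hom f) = 0 := by
    have : Function.Injective ((P.isoExt (R := R) n Y).inv).hom :=
      (ModuleCat.mono_iff_injective _).1 inferInstance
    rw [← this.eq_iff, map_zero]; rfl
  rw [h0]
  have hex := ShortComplex.exact_of_g_is_cokernel (ShortComplex.mk ((P.complex.linearYonedaObj R Y).toCycles _ n)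
      ((P.complex.linearYonedaObj R Y).homologyπ n) (by simp))
     ((P.complex.linearYonedaObj R Y).homologyIsCokernel _ n rfl)
  rw [ShortComplex.moduleCat_exact_iff] at hex
  have hm : Function.Injective ((P.complex.linearYonedaObj R Y).iCycles n).hom :=
    (ModuleCat.mono_iff_injective _).1 inferInstance
  have hi : (((P.complex.linearYonedaObj R Y).iCycles n).hom ((toCyc P Y n).hom f)) = f.1 :=
     congrArg (fun t => t.hom f) (toCyc_i P Y n)
  have ht : ∀ g, ((P.complex.linearYonedaObj R Y).iCycles n).hom
     (((P.complex.linearYonedaObj R Y).toCycles ((ComplexShape.up ℕ).prev n) n).hom g) =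
     ((P.complex.linearYonedaObj R Y).d _ n).hom g := fun g =>
       congrArg (fun t => t.hom g) ((P.complex.linearYonedaObj R Y).toCycles_i _ n)
  constructor
  · intro h
    obtain ⟨g, hg⟩ := hex _ h
    refine ⟨g, ?_⟩
    rw [← ht, ← hi]
    exact congrArg _ hg
  · rintro ⟨g, hg⟩
    rw [← ht, ← hi] at hg
    rw [← hm hg]
    exact congrArg (fun t => t.hom g) (show (P.complex.linearYonedaObj R Y).toCycles _ n ≫ (P.complex.linearYonedaObj R Y).homologyπ n = 0 by simp)

def beta : Zc P Y n →ₗ[R] Abelian.Ext.{u} X Y n where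
  toFun f := P.extMk f.1 (n+1) rfl (Zc_spec P Y n f)
  map_add' f g := (P.add_extMk _ _ _ _ _ _).symm
  map_smul' r f := by
    rw [RingHom.id_apply, Abelian.Ext.smul_eq_comp_mk₀, ProjectiveResolution.extMk_comp_mk₀]
    congr 1

lemma beta_surj : Function.Surjective (beta P Y n) := fun x => by
  obtain ⟨f, hf, h⟩ := P.extMk_surjective x (n+1) rfl
  exact ⟨⟨f, hf⟩, h⟩

open CochainComplex HomComplex in
lemma beta_zero_iff (f : Zc P Y 0) : beta P Y 0 f = 0 ↔ f = 0 := by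
  refine ⟨fun h => ?_, fun h => by rw [h, map_zero]⟩
  obtain ⟨f, hf⟩ := f
  replace hf : P.complex.d 1 0 ≫ f = 0 := hf
  change P.extMk f 1 rfl hf = 0 at h
  simp only [← P.extEquivCohomologyClass.apply_eq_iff_eq,
    ProjectiveResolution.extEquivCohomologyClass_extMk, ProjectiveResolution.extEquivCohomologyClass_zero,
    CohomologyClass.mk_eq_zero_iff] at h
  rw [Cocycle.toSingleMk_mem_coboundaries_iff _ _ _ _ _ 1 (by lia)] at h
  obtain ⟨g, hg⟩ := h
  have : P.cochainComplex.d (-((0:ℕ):ℤ)) 1 = 0 := by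
    apply Limits.IsZero.eq_of_tgt
    exact CochainComplex.isZero_of_isStrictlyLE _ 0 _ (by lia)
  rw [this, Limits.zero_comp] at hg
  ext1
  change f = 0
  rw [← cancel_epi (P.cochainComplexXIso (-((0:ℕ):ℤ)) 0 rfl).hom, ← hg, Limits.comp_zero]

lemma ker_eq : LinearMap.ker (alpha P Y n) = LinearMap.ker (beta P Y n) := by
  ext f
  rw [LinearMap.mem_ker, LinearMap.mem_ker, alpha_eq_zero_iff]
  cases n with
  | zero =>
    rw [beta_zero_iff]
    have : (P.complex.linearYonedaObj R Y).d ((ComplexShape.up ℕ).prev 0) 0 = 0 :=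
      HomologicalComplex.shape _ _ _ (by simp)
    rw [this]
    constructor
    · rintro ⟨g, hg⟩; ext1; exact hg.symm
    · rintro rfl; exact ⟨0, rfl⟩
  | succ m =>
    have : (ComplexShape.up ℕ).prev (m+1) = m := by simp
    rw [this]
    exact (P.extMk_eq_zero_iff f.1 (m+1+1) rfl f.2 m rfl).symm

def cmp : ((Ext R (ModuleCat.{u} R) n).obj (op X)).obj Y ≃ₗ[R] Abelian.Ext.{u} X Y n :=
  ((alpha P Y n).quotKerEquivOfSurjective (alpha_surj P Y n)).symm ≪≫ₗ
   Submodule.quotEquivOfEq _ _ (ker_eq P Y n) ≪≫ₗ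
  ((beta P Y n).quotKerEquivOfSurjective (beta_surj P Y n))

lemma cmp_alpha (f) : cmp P Y n (alpha P Y n f) = beta P Y n f := by
  have : ((alpha P Y n).quotKerEquivOfSurjective (alpha_surj P Y n)).symm (alpha P Y n f) = Submodule.Quotient.mk f := by
    rw [LinearEquiv.symm_apply_eq]; rfl
  simp only [cmp, LinearEquiv.trans_apply]
  rw [this]; rfl

lemma cmp_nat {X' : ModuleCat.{u} R} (P' : ProjectiveResolution X') (g : X' ⟶ X) (x) :
    cmp P' Y n ((((Ext R (ModuleCat.{u} R) n).map g.op).app Y).hom x) =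
      (Abelian.Ext.mk₀ g).comp (cmp P Y n x) (zero_add n) := by
  obtain ⟨f, rfl⟩ := alpha_surj P Y n x
  let φ : P'.complex ⟶ P.complex := ProjectiveResolution.lift g P' P
  have comm : φ.f 0 ≫ P.π.f 0 = P'.π.f 0 ≫ g := by
    exact ProjectiveResolution.lift_commutes_zero g P' P
  have hz : P'.complex.d (n+1) n ≫ φ.f n ≫ f.1 = 0 := by
    rw [← φ.comm_assoc, f.2, Limits.comp_zero]
  have key : (((Ext R (ModuleCat.{u} R) n).map g.op).app Y).hom (alpha P Y n f) = alpha P' Y n ⟨φ.f n ≫ f.1, hz⟩ := by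
    have hinj : Function.Injective (P'.isoExt (R := R) n Y).hom.hom :=
      (ModuleCat.mono_iff_injective _).1 inferInstance
    apply hinj
    refine (congrArg (fun t => t.hom (alpha P Y n f)) (isoExt_nat P P' g φ comm Y n)).trans ?_
    have a1 : (P.isoExt (R := R) n Y).hom.hom (alpha P Y n f) =
       ((P.complex.linearYonedaObj R Y).homologyπ n).hom ((toCyc P Y n).hom f) :=
       congrArg (fun t => t.hom f) (show (toCyc P Y n ≫ (P.complex.linearYonedaObj R Y).homologyπ n ≫ (P.isoExt (R := R) n Y).inv) ≫ (P.isoExt (R := R) n Y).hom = toCyc P Y n ≫ (P.complex.linearYonedaObj R Y).homologyπ n by simp)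
    have a2 : (P'.isoExt (R := R) n Y).hom.hom (alpha P' Y n ⟨φ.f n ≫ f.1, hz⟩) =
       ((P'.complex.linearYonedaObj R Y).homologyπ n).hom ((toCyc P' Y n).hom ⟨φ.f n ≫ f.1, hz⟩) :=
       congrArg (fun t => t.hom ⟨φ.f n ≫ f.1, hz⟩) (show (toCyc P' Y n ≫ (P'.complex.linearYonedaObj R Y).homologyπ n ≫ (P'.isoExt (R := R) n Y).inv) ≫ (P'.isoExt (R := R) n Y).hom = toCyc P' Y n ≫ (P'.complex.linearYonedaObj R Y).homologyπ n by simp)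
    rw [a2]
    refine (congrArg ((HomologicalComplex.homologyMap (yonMap P P' φ Y) n).hom) a1).trans ?_
    refine (congrArg (fun t => t.hom ((toCyc P Y n).hom f)) (HomologicalComplex.homologyπ_naturality (yonMap P P' φ Y) n)).trans ?_
    change ((P'.complex.linearYonedaObj R Y).homologyπ n).hom _ = _
    congr 1
    have hm : Function.Injective ((P'.complex.linearYonedaObj R Y).iCycles n).hom :=
      (ModuleCat.mono_iff_injective _).1 inferInstance
    apply hm
    refine (congrArg (fun t => t.hom ((toCyc P Y n).hom f)) (HomologicalComplex.cyclesMap_i (yonMap P P' φ Y) n)).trans ?_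
    refine (congrArg ((yonMap P P' φ Y).f n).hom (congrArg (fun t => t.hom f) (toCyc_i P Y n))).trans ?_
    exact (congrArg (fun t => t.hom ⟨φ.f n ≫ f.1, hz⟩) (toCyc_i P' Y n)).symm
  rw [key, cmp_alpha, cmp_alpha]
  exact (ProjectiveResolution.mk₀_comp_extMk f.1 (n+1) rfl f.2 (⟨φ, comm⟩ : ProjectiveResolution.Hom P' P g)).symm

open localCohomology in
/-- The inverse system `R / a ^ n`. -/
def QD (a : Ideal R) : ℕᵒᵖ ⥤ ModuleCat.{u} R := ringModIdeals (idealPowersDiagram a)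

abbrev Q (a : Ideal R) (n : ℕ) : ModuleCat.{u} R := (QD a).obj (op n)

abbrev tr (a : Ideal R) {m n : ℕ} (h : m ≤ n) : Q a n ⟶ Q a m := (QD a).map (homOfLE h).op

def preC {X X' : ModuleCat.{u} R} (g : X' ⟶ X) (Y : ModuleCat.{u} R) (i : ℕ) :
    Abelian.Ext.{u} X Y i →ₗ[R] Abelian.Ext.{u} X' Y i where
  toFun x := (Abelian.Ext.mk₀ g).comp x (zero_add i)
  map_add' x y := by simp
  map_smul' r x := by simp

abbrev LC (a : Ideal R) (i : ℕ) (M : ModuleCat.{u} R) : Type u :=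
  Module.DirectLimit (fun n : ℕ => Abelian.Ext.{u} (Q a n) M i)
    (fun _ _ h => preC (tr a h) M i)

abbrev LCof (a : Ideal R) (i : ℕ) (M : ModuleCat.{u} R) (n : ℕ) :
    Abelian.Ext.{u} (Q a n) M i →ₗ[R] LC a i M :=
  Module.DirectLimit.of R ℕ (fun n : ℕ => Abelian.Ext.{u} (Q a n) M i)
    (fun _ _ h => preC (tr a h) M i) n

instance (a : Ideal R) (i : ℕ) (M : ModuleCat.{u} R) : DirectedSystem
    (fun n : ℕ => Abelian.Ext.{u} (Q a n) M i) (fun m n h => ⇑(preC (tr a h) M i)) where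
  map_self n x := by
    change (Abelian.Ext.mk₀ (tr a (le_refl n))).comp x (zero_add i) = x
    have : tr a (le_refl n) = 𝟙 _ := (QD a).map_id _
    rw [this, Abelian.Ext.mk₀_id_comp]
  map_map k m n h h' x := by
    change (Abelian.Ext.mk₀ (tr a h')).comp ((Abelian.Ext.mk₀ (tr a h)).comp x (zero_add i)) (zero_add i) =
      (Abelian.Ext.mk₀ (tr a (h.trans h'))).comp x (zero_add i)
    rw [Abelian.Ext.mk₀_comp_mk₀_assoc, ← Functor.map_comp]
    rfl

lemma LC_rep {a : Ideal R} {i : ℕ} {M : ModuleCat.{u} R} (z : LC a i M) :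
    ∃ n x, LCof a i M n x = z := Module.DirectLimit.exists_of z

lemma LC_zero {a : Ideal R} {i : ℕ} {M : ModuleCat.{u} R} {n} {x} (h : LCof a i M n x = 0) :
    ∃ m, ∃ hm : n ≤ m, preC (tr a hm) M i x = 0 := by
  obtain ⟨j, hj, h⟩ := Module.DirectLimit.of.zero_exact h
  exact ⟨j, hj, h⟩

lemma LCof_pre {a : Ideal R} {i : ℕ} {M : ModuleCat.{u} R} {m n} (h : m ≤ n) (x) :
    LCof a i M n (preC (tr a h) M i x) = LCof a i M m x := by
  exact Module.DirectLimit.of_f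

abbrev cmpn (a : Ideal R) (i : ℕ) (M : ModuleCat.{u} R) (n : ℕ) :
    ((Ext R (ModuleCat.{u} R) i).obj (op (Q a n))).obj M ≃ₗ[R] Abelian.Ext.{u} (Q a n) M i :=
  cmp (projectiveResolution (Q a n)) M i

lemma cmpn_nat (a : Ideal R) (i : ℕ) (M : ModuleCat.{u} R) {m n : ℕ} (h : m ≤ n) (x) :
    cmpn a i M n ((((Ext R (ModuleCat.{u} R) i).map (tr a h).op).app M).hom x) =
      preC (tr a h) M i (cmpn a i M m x) :=
  cmp_nat _ _ _ _ _ _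

open localCohomology Limits in
lemma exists_equiv (a : Ideal R) (i : ℕ) (M : Type u) [AddCommGroup M] [Module R M] :
    Nonempty (locH R a i M ≃ₗ[R] LC a i (ModuleCat.of R M)) := by
  let D := diagram (idealPowersDiagram a) i
  have hcol : HasColimit D := hasColimitDiagram.{u, 0} _ _
  let c : Cocone D := colimit.cocone D
  let Mo := ModuleCat.of R M
  let ev := (evaluation (ModuleCat.{u} R) (ModuleCat.{u} R)).obj Mo
  let hc : IsColimit (ev.mapCocone c) := isColimitOfPreserves ev (colimit.isColimit D)
  let c' : Cocone (D ⋙ ev) :=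
    { pt := ModuleCat.of R (LC a i Mo)
      ι :=
        { app := fun n => ModuleCat.ofHom (LCof a i Mo n.unop.unop ∘ₗ (cmpn a i Mo n.unop.unop).toLinearMap)
          naturality := by
            rintro ⟨⟨m⟩⟩ ⟨⟨n⟩⟩ f
            have h : m ≤ n := leOfHom f.unop.unop
            ext x
            exact (congrArg (LCof a i Mo n) (cmpn_nat a i Mo h x)).trans (LCof_pre h _) } }
  let F : locH R a i M →ₗ[R] LC a i Mo := (hc.desc c').hom
  let inj (n : ℕ) : ((Ext R (ModuleCat.{u} R) i).obj (op (Q a n))).obj Mo →ₗ[R] locH R a i M :=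
    ((ev.mapCocone c).ι.app (op (op n))).hom
  have hF : ∀ n x, F (inj n x) = LCof a i Mo n (cmpn a i Mo n x) := by
    intro n x
    have := hc.fac c' (op (op n))
    exact congrArg (fun t => t.hom x) this
  have hw : ∀ m n (h : m ≤ n) x, inj n ((((Ext R (ModuleCat.{u} R) i).map (tr a h).op).app Mo).hom x)
       = inj m x := by
    intro m n h x
    have := (ev.mapCocone c).w (homOfLE h).op.op
    exact congrArg (fun t => t.hom x) this
  let G : LC a i Mo →ₗ[R] locH R a i M := Module.DirectLimit.lift R ℕ _ _
    (fun n => inj n ∘ₗ (cmpn a i Mo n).symm.toLinearMap) (by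
      intro m n h x
      obtain ⟨y, rfl⟩ := (cmpn a i Mo m).surjective x
      rw [← cmpn_nat]
      simp only [LinearMap.comp_apply, LinearEquiv.coe_coe, LinearEquiv.symm_apply_apply]
      exact hw m n h y)
  have hG : ∀ n x, G (LCof a i Mo n x) = inj n ((cmpn a i Mo n).symm x) := by
    intro n x
    exact Module.DirectLimit.lift_of _ _ _
  have hGF : ∀ n x, G (F (inj n x)) = inj n x := by
    intro n x
    rw [hF, hG, LinearEquiv.symm_apply_apply]
  have hFG : ∀ z, F (G z) = z := by
    intro z
    obtain ⟨n, x, rfl⟩ := LC_rep z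
    rw [hG, hF, LinearEquiv.apply_symm_apply]
  refine ⟨LinearEquiv.ofLinearMap F G (LinearMap.ext hFG) ?_⟩
  have : ModuleCat.ofHom (G ∘ₗ F) = 𝟙 (locH R a i M) := by
    refine hc.hom_ext ?_
    rintro ⟨⟨n⟩⟩
    ext x
    exact hGF n x
  exact congrArg ModuleCat.Hom.hom this

section longExact

def postC (X : ModuleCat.{u} R) {Y Z : ModuleCat.{u} R} {i j k : ℕ} (e : Abelian.Ext.{u} Y Z j)
    (h : i + j = k) : Abelian.Ext.{u} X Y i →ₗ[R] Abelian.Ext.{u} X Z k where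
  toFun x := x.comp e h
  map_add' x y := by simp
  map_smul' r x := by simp

def LCpost (a : Ideal R) {Y Z : ModuleCat.{u} R} {i j k : ℕ} (e : Abelian.Ext.{u} Y Z j)
    (h : i + j = k) : LC a i Y →ₗ[R] LC a k Z :=
  Module.DirectLimit.map (fun n => postC (Q a n) e h) (by
    intro m n hmn
    ext x
    change ((Abelian.Ext.mk₀ (tr a hmn)).comp x (zero_add i)).comp e h =
      (Abelian.Ext.mk₀ (tr a hmn)).comp (x.comp e h) (zero_add k)
    rw [Abelian.Ext.comp_assoc _ _ _ _ _ (by lia)])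

lemma LCpost_of (a : Ideal R) {Y Z : ModuleCat.{u} R} {i j k : ℕ} (e : Abelian.Ext.{u} Y Z j)
    (h : i + j = k) (n : ℕ) (x) : LCpost a e h (LCof a i Y n x) = LCof a k Z n (x.comp e h) :=
  Module.DirectLimit.map_apply_of _ _ _

def LCmap (a : Ideal R) (i : ℕ) {Y Z : ModuleCat.{u} R} (f : Y ⟶ Z) : LC a i Y →ₗ[R] LC a i Z :=
  LCpost a (Abelian.Ext.mk₀ f) (add_zero i)

variable (a : Ideal R) {S : ShortComplex (ModuleCat.{u} R)} (hS : S.ShortExact)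

def LCdel (i : ℕ) : LC a i S.X₃ →ₗ[R] LC a (i+1) S.X₁ := LCpost a hS.extClass rfl

lemma LC_exact₂ (hS : S.ShortExact) (i : ℕ) : LinearMap.ker (LCmap a i S.g) ≤ LinearMap.range (LCmap a i S.f) := by
  intro z hz
  obtain ⟨n, x, rfl⟩ := LC_rep z
  rw [LinearMap.mem_ker, LCmap, LCpost_of] at hz
  obtain ⟨m, hm, h⟩ := LC_zero hz
  have h' : (preC (tr a hm) S.X₂ i x).comp (Abelian.Ext.mk₀ S.g) (add_zero i) = 0 := by
    rw [← h]
    exact Abelian.Ext.comp_assoc _ _ _ (zero_add _) _ (by lia)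
  obtain ⟨y, hy⟩ := Abelian.Ext.covariant_sequence_exact₂ _ hS _ h'
  refine ⟨LCof a i _ m y, ?_⟩
  rw [LCmap, LCpost_of, hy, LCof_pre]

lemma LC_exact₃ (i : ℕ) : LinearMap.ker (LCdel a hS i) ≤ LinearMap.range (LCmap a i S.g) := by
  intro z hz
  obtain ⟨n, x, rfl⟩ := LC_rep z
  rw [LinearMap.mem_ker, LCdel, LCpost_of] at hz
  obtain ⟨m, hm, h⟩ := LC_zero hz
  have h' : (preC (tr a hm) S.X₃ i x).comp hS.extClass rfl = 0 := by
    rw [← h]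
    exact Abelian.Ext.comp_assoc _ _ _ (zero_add _) _ (by lia)
  obtain ⟨y, hy⟩ := Abelian.Ext.covariant_sequence_exact₃ _ hS _ rfl h'
  refine ⟨LCof a i _ m y, ?_⟩
  rw [LCmap, LCpost_of, hy, LCof_pre]

lemma LC_exact₁ (i : ℕ) : LinearMap.ker (LCmap a (i+1) S.f) ≤ LinearMap.range (LCdel a hS i) := by
  intro z hz
  obtain ⟨n, x, rfl⟩ := LC_rep z
  rw [LinearMap.mem_ker, LCmap, LCpost_of] at hz
  obtain ⟨m, hm, h⟩ := LC_zero hz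
  have h' : (preC (tr a hm) S.X₁ (i+1) x).comp (Abelian.Ext.mk₀ S.f) (add_zero _) = 0 := by
    rw [← h]
    exact Abelian.Ext.comp_assoc _ _ _ (zero_add _) _ (by lia)
  obtain ⟨y, hy⟩ := Abelian.Ext.covariant_sequence_exact₁ _ hS _ h' rfl
  refine ⟨LCof a i _ m y, ?_⟩
  rw [LCdel, LCpost_of, hy, LCof_pre]

lemma LCdel_map (i : ℕ) (z : LC a i S.X₂) : LCdel a hS i (LCmap a i S.g z) = 0 := by
  obtain ⟨n, x, rfl⟩ := LC_rep z
  rw [LCmap, LCpost_of, LCdel, LCpost_of, Abelian.Ext.comp_assoc _ _ _ _ (zero_add 1) (by lia), hS.comp_extClass]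
  simp

lemma LCmap_smul (i : ℕ) (Y : ModuleCat.{u} R) (r : R) (z : LC a i Y) :
    LCmap a i (r • 𝟙 Y) z = r • z := by
  obtain ⟨n, x, rfl⟩ := LC_rep z
  rw [LCmap, LCpost_of, ← Abelian.Ext.smul_eq_comp_mk₀, map_smul]

lemma LC_torsion (i : ℕ) {Y : ModuleCat.{u} R} (z : LC a i Y) : ∃ n, ∀ y ∈ a ^ n, y • z = 0 := by
  obtain ⟨n, x, rfl⟩ := LC_rep z
  refine ⟨n, fun y hy => ?_⟩
  rw [← map_smul]
  have h1 : (y • 𝟙 (Q a n)) = 0 := by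
    ext t
    change y • t = 0
    induction t using Submodule.Quotient.induction_on with
    | H t =>
    exact (Submodule.Quotient.mk_eq_zero (a ^ n)).2 (Ideal.mul_mem_right _ _ hy)
  have : y • x = 0 := by
    conv_lhs => rw [← Abelian.Ext.mk₀_id_comp x]
    rw [← Abelian.Ext.smul_comp, ← Abelian.Ext.mk₀_smul, h1]
    simp
  rw [this, map_zero]

lemma LC_injective (i : ℕ) (E : ModuleCat.{u} R) [Injective E] (z : LC a (i+1) E) : z = 0 := by
  obtain ⟨n, x, rfl⟩ := LC_rep z
  rw [x.eq_zero_of_injective, map_zero]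

def mkHom {n : ℕ} {Y : ModuleCat.{u} R} (e : Y) (h : ∀ y ∈ a ^ n, y • e = 0) : Q a n ⟶ Y :=
  ModuleCat.ofHom (Submodule.liftQ (a^n) (LinearMap.toSpanSingleton R Y e) (by
    intro y hy; exact h y hy))

abbrev one (n : ℕ) : Q a n := Submodule.Quotient.mk (p := a^n) (1:R)

lemma mkHom_one {n : ℕ} {Y : ModuleCat.{u} R} (e : Y) (h : ∀ y ∈ a ^ n, y • e = 0) :
    (mkHom a e h).hom (one a n) = e := by
  exact one_smul R e

lemma Q_ext {n : ℕ} {Y : ModuleCat.{u} R} {f g : Q a n ⟶ Y} (h : f.hom (one a n) = g.hom (one a n)) :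
    f = g := by
  ext t
  obtain ⟨r, rfl⟩ : ∃ r : R, r • one a n = t := by
    induction t using Submodule.Quotient.induction_on with
    | H t => exact ⟨t, by change Submodule.Quotient.mk (t * 1) = _; rw [mul_one]⟩
  exact ((f.hom.map_smul r _).trans (congrArg (r • ·) h)).trans (g.hom.map_smul r _).symm

lemma one_tor {n : ℕ} (y : R) (hy : y ∈ a ^ n) : y • one a n = 0 :=
  (Submodule.Quotient.mk_eq_zero _).2 (Ideal.mul_mem_right _ _ hy)

def IsTor (N : Type u) [AddCommGroup N] [Module R N] : Prop := ∀ x : N, ∃ n, ∀ y ∈ a ^ n, y • x = 0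

lemma LCmap_zero_surj (hS : S.ShortExact) (h2 : IsTor a S.X₂) (z : LC a 0 S.X₃) : ∃ w, LCmap a 0 S.g w = z := by
  obtain ⟨n, x, rfl⟩ := LC_rep z
  obtain ⟨f, rfl⟩ := (Abelian.Ext.homEquiv₀ (X := Q a n) (Y := S.X₃)).symm.surjective x
  change ∃ w, _ = LCof a 0 S.X₃ n (Abelian.Ext.mk₀ f)
  have hg : Function.Surjective S.g.hom := (ModuleCat.epi_iff_surjective _).1 hS.epi_g
  obtain ⟨e, he⟩ := hg (f.hom (one a n))
  obtain ⟨m, hm⟩ := h2 e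
  have hm' : ∀ y ∈ a ^ (max n m), y • e = 0 := fun y hy => hm y (Ideal.pow_le_pow_right (le_max_right _ _) hy)
  refine ⟨LCof a 0 _ (max n m) (Abelian.Ext.mk₀ (mkHom a e hm')), ?_⟩
  rw [LCmap, LCpost_of, ← LCof_pre (le_max_left n m), Abelian.Ext.mk₀_comp_mk₀]
  congr 1
  change _ = (Abelian.Ext.mk₀ (tr a (le_max_left n m))).comp (Abelian.Ext.mk₀ f) (zero_add 0)
  rw [Abelian.Ext.mk₀_comp_mk₀]
  congr 1
  apply Q_ext
  refine (congrArg S.g.hom (mkHom_one a e hm')).trans ?_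
  exact he

def evn (Y : ModuleCat.{u} R) (n : ℕ) : Abelian.Ext.{u} (Q a n) Y 0 →ₗ[R] Y where
  toFun x := (Abelian.Ext.linearEquiv₀ (R := R) x).hom (one a n)
  map_add' x y := by rw [map_add]; rfl
  map_smul' r x := by rw [map_smul]; rfl

lemma evn_mk (Y : ModuleCat.{u} R) (n : ℕ) (f : Q a n ⟶ Y) :
    evn a Y n (Abelian.Ext.mk₀ f) = f.hom (one a n) := by
  have : Abelian.Ext.linearEquiv₀ (R := R) (Abelian.Ext.mk₀ f) = f :=
    Abelian.Ext.homEquiv₀.right_inv f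
  exact congrArg (fun t => t.hom (one a n)) this

lemma evn_pre (Y : ModuleCat.{u} R) (m n : ℕ) (h : m ≤ n) (x) :
    evn a Y n (preC (tr a h) Y 0 x) = evn a Y m x := by
  obtain ⟨f, rfl⟩ := (Abelian.Ext.homEquiv₀ (X := Q a m) (Y := Y)).symm.surjective x
  have : preC (tr a h) Y 0 (Abelian.Ext.mk₀ f) = Abelian.Ext.mk₀ (tr a h ≫ f) :=
    Abelian.Ext.mk₀_comp_mk₀ _ _
  refine (congrArg (evn a Y n) this).trans ?_
  refine (evn_mk a Y n _).trans (Eq.trans ?_ (evn_mk a Y m f).symm)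
  rfl

def LCev (Y : ModuleCat.{u} R) : LC a 0 Y →ₗ[R] Y :=
  Module.DirectLimit.lift R ℕ _ _ (evn a Y) (fun m n h x => evn_pre a Y m n h x)

lemma LCev_inj (Y : ModuleCat.{u} R) : Function.Injective (LCev a Y) := by
  rw [injective_iff_map_eq_zero]
  intro z hz
  obtain ⟨n, x, rfl⟩ := LC_rep z
  have h1 : evn a Y n x = 0 := by
    rw [← hz]
    exact (Module.DirectLimit.lift_of _ _ _).symm
  have h2 : Abelian.Ext.linearEquiv₀ (R := R) x = 0 := Q_ext a h1
  rw [(LinearEquiv.map_eq_zero_iff _).1 h2, map_zero]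

lemma LC_zero_FG [IsNoetherianRing R] (Y : ModuleCat.{u} R) [Module.Finite R Y] :
    Module.Finite R (LC a 0 Y) :=
  Module.Finite.of_injective (LCev a Y) (LCev_inj a Y)

end longExact

section vanishing
variable (a : Ideal R)

/-- The `a`-torsion submodule. -/
def Gam (N : Type u) [AddCommGroup N] [Module R N] : Submodule R N where
  carrier := {x | ∃ n, ∀ y ∈ a ^ n, y • x = 0}
  zero_mem' := ⟨0, fun y _ => smul_zero y⟩
  add_mem' := by
    rintro x x' ⟨n, hn⟩ ⟨m, hm⟩
    refine ⟨max n m, fun y hy => ?_⟩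
    rw [smul_add, hn y (Ideal.pow_le_pow_right (le_max_left _ _) hy),
      hm y (Ideal.pow_le_pow_right (le_max_right _ _) hy), add_zero]
  smul_mem' := by
    rintro r x ⟨n, hn⟩
    exact ⟨n, fun y hy => by rw [smul_comm, hn y hy, smul_zero]⟩

lemma Gam_tor (N : Type u) [AddCommGroup N] [Module R N] : IsTor a (Gam a N) := by
  rintro ⟨x, n, hn⟩
  exact ⟨n, fun y hy => Subtype.ext (hn y hy)⟩

lemma fg_tor {N : Type*} [AddCommGroup N] [Module R N] (P : Submodule R N) (hP : P.FG)
    (h : ∀ x ∈ P, ∃ n, ∀ y ∈ a ^ n, y • x = 0) : ∃ n, ∀ y ∈ a ^ n, ∀ x ∈ P, y • x = 0 := by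
  classical
  obtain ⟨s, rfl⟩ := hP
  choose! f hf using h
  refine ⟨s.sup f, fun y hy x hx => ?_⟩
  induction hx using Submodule.span_induction with
  | mem x hx => exact hf x (Submodule.subset_span hx) y
                  (Ideal.pow_le_pow_right (Finset.le_sup hx) hy)
  | zero => exact smul_zero y
  | add x x' _ _ h h' => rw [smul_add, h, h', add_zero]
  | smul r x _ h => rw [smul_comm, h, smul_zero]

lemma Gam_inj [IsNoetherianRing R] (E : Type u) [AddCommGroup E] [Module R E]
    [hE : Module.Injective R E] : Module.Injective R (Gam a E) := by
  apply Module.Baer.injective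
  intro I g
  obtain ⟨n, hn⟩ := fg_tor a (LinearMap.range g) (IsNoetherian.noetherian (⊤ : Submodule R I) |>.map g |> (by
    rw [LinearMap.range_eq_map]; exact ·)) (fun x _ => Gam_tor a E x)
  obtain ⟨k, hk⟩ := Ideal.exists_pow_inf_eq_pow_smul a (M := R) I
  let m := n + k
  have hm : a ^ m ⊓ I ≤ a ^ n • I := by
    have := hk m (Nat.le_add_left k n)
    have h2 : a ^ m • (⊤ : Ideal R) = a ^ m := by simp
    rw [h2] at this
    rw [this]
    simp only [m, Nat.add_sub_cancel]
    exact Submodule.smul_mono le_rfl inf_le_right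
  have hg0 : ∀ x (hx : x ∈ I), x ∈ a ^ m → g ⟨x, hx⟩ = 0 := by
    intro x hx hxm
    have h1 : x ∈ a ^ n • I := hm ⟨hxm, hx⟩
    have h2 : a ^ n • I ≤ (LinearMap.ker g).map I.subtype := by
      rw [Submodule.smul_le]
      intro y hy z hz
      refine ⟨⟨y • z, I.smul_mem y hz⟩, ?_, rfl⟩
      have : (⟨y • z, I.smul_mem y hz⟩ : I) = y • ⟨z, hz⟩ := rfl
      rw [this, SetLike.mem_coe, LinearMap.mem_ker, map_smul]
      exact hn y hy _ ⟨_, rfl⟩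
    obtain ⟨⟨w, hw⟩, hw0, hwx⟩ := h2 h1
    change w = x at hwx
    subst hwx
    exact hw0
  let J : Submodule R I := Submodule.comap I.subtype (a ^ m)
  let ψ : (I ⧸ J) →ₗ[R] (R ⧸ a ^ m) := Submodule.mapQ J (a ^ m) I.subtype le_rfl
  have hψ : Function.Injective ψ := by
    rw [← LinearMap.ker_eq_bot, Submodule.ker_mapQ]
    rw [eq_bot_iff, Submodule.map_le_iff_le_comap, Submodule.comap_bot, Submodule.ker_mkQ]
  let φ : (I ⧸ J) →ₗ[R] E := J.liftQ ((Gam a E).subtype ∘ₗ g) (by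
    rintro ⟨x, hx⟩ hxm
    exact congrArg Subtype.val (hg0 x hx hxm))
  obtain ⟨h, hh⟩ := hE.out ψ hψ φ
  have hkill : ∀ y ∈ a ^ m, ∀ x : R ⧸ a ^ m, y • h x = 0 := by
    intro y hy x
    obtain ⟨x, rfl⟩ := Submodule.Quotient.mk_surjective _ x
    rw [← map_smul]
    have : y • (Submodule.Quotient.mk x : R ⧸ a ^ m) = 0 :=
      (Submodule.Quotient.mk_eq_zero (a ^ m)).2 (Ideal.mul_mem_right _ _ hy)
    rw [this, map_zero]
  refine ⟨(h.codRestrict (Gam a E) (fun x => ⟨m, fun y hy => hkill y hy x⟩)) ∘ₗ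
    (a ^ m : Submodule R R).mkQ, fun x hx => Subtype.ext ?_⟩
  exact hh (Submodule.Quotient.mk ⟨x, hx⟩)

lemma ses {A B C : Type u} [AddCommGroup A] [AddCommGroup B] [AddCommGroup C] [Module R A]
    [Module R B] [Module R C] (f : A →ₗ[R] B) (g : B →ₗ[R] C) (hf : Function.Injective f)
    (hg : Function.Surjective g) (h : Function.Exact f g) :
    ∃ w, (ShortComplex.mk (ModuleCat.ofHom f) (ModuleCat.ofHom g) w).ShortExact := by
  refine ⟨?_, ?_⟩
  · ext x
    exact h.apply_apply_eq_zero x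
  · refine { exact := ?_, mono_f := ?_, epi_g := ?_ }
    · rw [CategoryTheory.ShortComplex.ShortExact.moduleCat_exact_iff_function_exact]
      exact h
    · exact (ModuleCat.mono_iff_injective _).2 hf
    · exact (ModuleCat.epi_iff_surjective _).2 hg

lemma tor_embed [IsNoetherianRing R] (N : ModuleCat.{u} R) (hN : IsTor a N) :
    ∃ (E C : ModuleCat.{u} R) (f : N ⟶ E) (g : E ⟶ C) (w : f ≫ g = 0),
      (ShortComplex.mk f g w).ShortExact ∧ Injective E ∧ IsTor a E ∧ IsTor a C := by
  obtain ⟨E, hE, f, hf⟩ : ∃ (E : ModuleCat.{u} R) (_ : Injective E) (f : N ⟶ E), Mono f :=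
    ⟨Injective.under N, inferInstance, Injective.ι N, inferInstance⟩
  have hE' : Module.Injective R E := (Module.injective_iff_injective_object R E).2 hE
  have hG := Gam_inj a E
  have hf' : Function.Injective f.hom := (ModuleCat.mono_iff_injective _).1 hf
  let f' : N →ₗ[R] Gam a E := f.hom.codRestrict (Gam a E) (fun x => by
    obtain ⟨n, hn⟩ := hN x
    exact ⟨n, fun y hy => by rw [← map_smul, hn y hy, map_zero]⟩)
  have hfinj : Function.Injective f' := fun x y h => hf' (congrArg Subtype.val h)
  obtain ⟨w, hw⟩ := ses f' (LinearMap.range f').mkQ hfinj (Submodule.mkQ_surjective _)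
    (by rw [LinearMap.exact_iff, Submodule.ker_mkQ])
  refine ⟨_, _, _, _, w, hw, (Module.injective_iff_injective_object R (Gam a E)).1 hG,
    Gam_tor a E, ?_⟩
  intro x
  obtain ⟨x, rfl⟩ := Submodule.mkQ_surjective _ x
  obtain ⟨n, hn⟩ := Gam_tor a E x
  exact ⟨n, fun y hy => by rw [← map_smul, hn y hy, map_zero]⟩

lemma LC_vanish [IsNoetherianRing R] (i : ℕ) : ∀ (N : ModuleCat.{u} R), IsTor a N →
    ∀ z : LC a (i+1) N, z = 0 := by
  induction i with
  | zero =>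
    intro N hN z
    obtain ⟨E, C, f, g, w, hS, hE, hEt, hC⟩ := tor_embed a N hN
    obtain ⟨y, rfl⟩ := LC_exact₁ a hS 0 (x := z) (LC_injective a 0 E _)
    obtain ⟨x, rfl⟩ := LCmap_zero_surj a hS hEt y
    exact LCdel_map a hS 0 x
  | succ i ih =>
    intro N hN z
    obtain ⟨E, C, f, g, w, hS, hE, hEt, hC⟩ := tor_embed a N hN
    obtain ⟨y, rfl⟩ := LC_exact₁ a hS (i+1) (x := z) (LC_injective a (i+1) E _)
    rw [ih C hC y, map_zero]
end vanishing

section smallness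
variable (T : Set (PrimeSpectrum R)) (a : Ideal R)

/-- finitely generated at the primes of `T`, uniformly -/
def AFG (N : Type*) [AddCommGroup N] [Module R N] : Prop :=
  ∃ P : Submodule R N, P.FG ∧ ∀ p ∈ T, ∀ n : N, ∃ r, r ∉ p.asIdeal ∧ r • n ∈ P

/-- `a ^ n` kills `N` at the primes of `T` -/
def APowN (n : ℕ) (N : Type*) [AddCommGroup N] [Module R N] : Prop :=
  ∀ p ∈ T, ∀ y ∈ a ^ n, ∀ h : N, ∃ r, r ∉ p.asIdeal ∧ r • y • h = 0

variable {T a} {A B C : Type*} [AddCommGroup A] [AddCommGroup B] [AddCommGroup C] [Module R A]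
    [Module R B] [Module R C]

lemma APowN.mono {m n : ℕ} (h : m ≤ n) (hA : APowN T a m A) : APowN T a n A :=
  fun p hp y hy x => hA p hp y (Ideal.pow_le_pow_right h hy) x

lemma AFG.of_finite [Module.Finite R A] : AFG T A :=
  ⟨⊤, Module.Finite.fg_top, fun p _ _ => ⟨1, p.asIdeal.one_notMem, trivial⟩⟩

lemma AFG.equiv (e : A ≃ₗ[R] B) (h : AFG T A) : AFG T B := by
  obtain ⟨P, hP, h⟩ := h
  refine ⟨P.map e.toLinearMap, hP.map _, fun p hp n => ?_⟩
  obtain ⟨r, hr, h⟩ := h p hp (e.symm n)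
  exact ⟨r, hr, ⟨_, h, by simp⟩⟩

lemma APowN.surj {n : ℕ} (f : A →ₗ[R] B) (hf : Function.Surjective f) (h : APowN T a n A) :
    APowN T a n B := by
  intro p hp y hy b
  obtain ⟨x, rfl⟩ := hf b
  obtain ⟨r, hr, h⟩ := h p hp y hy x
  exact ⟨r, hr, by rw [← map_smul, ← map_smul, h, map_zero]⟩

lemma AFG.exact [IsNoetherianRing R] (f : A →ₗ[R] B) (g : B →ₗ[R] C)
    (h : LinearMap.ker g ≤ LinearMap.range f) (hA : AFG T A) (hC : AFG T C) : AFG T B := by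
  obtain ⟨A', hA', hA⟩ := hA
  obtain ⟨C', hC', hC⟩ := hC
  have h1 : (C' ⊓ LinearMap.range g).FG := hC'.of_le inf_le_left
  obtain ⟨B1, hB1, hB1'⟩ : ∃ B1 : Submodule R B, B1.FG ∧ B1.map g = C' ⊓ LinearMap.range g := by
    obtain ⟨s, hs, hs'⟩ := Submodule.fg_def.1 h1
    have hsub : s ⊆ Set.range g := fun x hx => (hs' ▸ Submodule.subset_span hx :
      x ∈ C' ⊓ LinearMap.range g).2
    obtain ⟨t, _, ht, rfl⟩ := Set.exists_subset_image_finite_and (f := g) (s := Set.univ)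
      (p := fun u => u = s) |>.1 ⟨s, by simpa using hsub, hs, rfl⟩
    exact ⟨Submodule.span R t, Submodule.fg_span ht, by rw [Submodule.map_span, hs']⟩
  refine ⟨A'.map f ⊔ B1, (hA'.map f).sup hB1, fun p hp b => ?_⟩
  obtain ⟨r, hr, hrb⟩ := hC p hp (g b)
  have h2 : r • g b ∈ B1.map g := by
    rw [hB1']
    exact ⟨hrb, ⟨r • b, map_smul _ _ _⟩⟩
  obtain ⟨b1, hb1, hb1'⟩ := h2
  obtain ⟨x, hx⟩ := h (show r • b - b1 ∈ LinearMap.ker g by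
    rw [LinearMap.mem_ker, map_sub, map_smul, hb1', sub_self])
  obtain ⟨r', hr', hx'⟩ := hA p hp x
  refine ⟨r' * r, p.2.mul_notMem hr' hr, ?_⟩
  have : (r' * r) • b = f (r' • x) + r' • b1 := by
    rw [map_smul, hx, smul_sub, mul_smul, sub_add_cancel]
  rw [this]
  exact Submodule.add_mem_sup ⟨_, hx', rfl⟩ (B1.smul_mem _ hb1)

lemma AFG.of_small (f : A →ₗ[R] B) (g : B →ₗ[R] C)
    (h : LinearMap.ker g ≤ LinearMap.range f) (hA : AFG T A)
    (hC : ∀ p ∈ T, ∀ b, ∃ r, r ∉ p.asIdeal ∧ r • g b = 0) : AFG T B := by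
  obtain ⟨A', hA', hA⟩ := hA
  refine ⟨A'.map f, hA'.map f, fun p hp b => ?_⟩
  obtain ⟨r, hr, hrb⟩ := hC p hp b
  obtain ⟨x, hx⟩ := h (show r • b ∈ LinearMap.ker g by
    rw [LinearMap.mem_ker, map_smul, hrb])
  obtain ⟨r', hr', hx'⟩ := hA p hp x
  refine ⟨r' * r, p.2.mul_notMem hr' hr, r' • x, hx', ?_⟩
  rw [map_smul, hx, mul_smul]

lemma APowN.exact {m n : ℕ} (f : A →ₗ[R] B) (g : B →ₗ[R] C)
    (h : LinearMap.ker g ≤ LinearMap.range f) (hA : APowN T a m A) (hC : APowN T a n C) :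
    APowN T a (m + n) B := by
  intro p hp y hy b
  rw [pow_add] at hy
  induction hy using Submodule.mul_induction_on' with
  | mem_mul_mem y1 hy1 y2 hy2 =>
    obtain ⟨r, hr, h1⟩ := hC p hp y2 hy2 (g b)
    obtain ⟨x, hx⟩ := h (show r • y2 • b ∈ LinearMap.ker g by
      rw [LinearMap.mem_ker, map_smul, map_smul, h1])
    obtain ⟨r', hr', h2⟩ := hA p hp y1 hy1 x
    refine ⟨r' * r, p.2.mul_notMem hr' hr, ?_⟩
    have : (r' * r) • (y1 * y2) • b = f (r' • y1 • x) := by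
      rw [map_smul, map_smul, hx, mul_smul, mul_smul, smul_comm r y1]
    rw [this, h2, map_zero]
  | add y _ z _ h1 h2 =>
    obtain ⟨r, hr, h1⟩ := h1
    obtain ⟨r', hr', h2⟩ := h2
    refine ⟨r' * r, p.2.mul_notMem hr' hr, ?_⟩
    rw [add_smul, smul_add, mul_smul, h1, mul_comm, mul_smul, h2]
    simp
end smallness

section main
variable (T : Set (PrimeSpectrum R)) (a : Ideal R)

lemma exists_reg [IsNoetherianRing R] (N : Type u) [AddCommGroup N] [Module R N] [Module.Finite R N]
    (h : ∀ x : N, (∀ y ∈ a, y • x = 0) → x = 0) : ∃ x ∈ a, IsSMulRegular N x := by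
  by_contra! hc
  have h1 : (a : Set R) ⊆ ⋃ p ∈ associatedPrimes R N, p := by
    rw [biUnion_associatedPrimes_eq_compl_regular R]
    exact fun x hx => hc x hx
  obtain ⟨P, hP, haP⟩ := (a.subset_union_prime_finite (associatedPrimes.finite R N)
    (f := id) 0 0 fun _ h _ _ ↦ h.1).1 h1
  rw [AssociatedPrimes.mem_iff, isAssociatedPrime_iff] at hP
  obtain ⟨hp, x, hx⟩ := hP
  have hx0 : x = 0 := h x fun y hy => by
    have h2 : y ∈ P := haP hy
    rw [hx, Submodule.mem_colon_singleton] at h2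
    exact h2
  apply hp.ne_top
  rw [hx, hx0, Ideal.eq_top_iff_one, Submodule.mem_colon_singleton, smul_zero]
  exact Submodule.zero_mem _

lemma Gam_quot [IsNoetherianRing R] (N : Type u) [AddCommGroup N] [Module R N]
    (x : N ⧸ Gam a N) (h : ∀ y ∈ a, y • x = 0) : x = 0 := by
  obtain ⟨x, rfl⟩ := Submodule.mkQ_surjective _ x
  have h1 : ∀ y ∈ a, y • x ∈ Gam a N := fun y hy => by
    rw [← Submodule.ker_mkQ (Gam a N), LinearMap.mem_ker, map_smul, h y hy]
  obtain ⟨n, hn⟩ := fg_tor a (Submodule.map (LinearMap.toSpanSingleton R N x) a)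
    ((IsNoetherian.noetherian a).map _) (by
      rintro _ ⟨y, hy, rfl⟩
      exact h1 y hy)
  rw [← LinearMap.mem_ker, Submodule.ker_mkQ]
  refine ⟨n + 1, fun y hy => ?_⟩
  rw [pow_succ] at hy
  induction hy using Submodule.mul_induction_on' with
  | mem_mul_mem y1 hy1 y2 hy2 =>
    rw [mul_smul]
    exact hn y1 hy1 _ ⟨y2, hy2, rfl⟩
  | add y _ z _ h1 h2 => rw [add_smul, h1, h2, add_zero]

lemma common_pow (t : ℕ) (F : ℕ → ℕ → Prop) (hF : ∀ i m n, m ≤ n → F i m → F i n)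
    (h : ∀ i < t, ∃ n, F i n) : ∃ n, ∀ i < t, F i n := by
  choose! f hf using h
  exact ⟨(Finset.range t).sup f, fun i hi => hF i _ _
    (Finset.le_sup (Finset.mem_range.2 hi)) (hf i hi)⟩

set_option maxHeartbeats 1000000 in
lemma main_ind [IsNoetherianRing R] (t : ℕ) : ∀ (M : ModuleCat.{u} R) (_ : Module.Finite R M),
    (∀ i < t, ∃ n, APowN T a n (LC a i M)) → ∀ i < t, AFG T (LC a i M) := by
  induction t with
  | zero => intro M _ _ i hi; omega
  | succ t ih =>
    intro M hM hP
    let Γ := Gam a M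
    obtain ⟨w1, hS1⟩ := ses Γ.subtype Γ.mkQ Γ.injective_subtype Γ.mkQ_surjective
      (by rw [LinearMap.exact_iff, Submodule.ker_mkQ, Submodule.range_subtype])
    let N := ModuleCat.of R (M ⧸ Γ)
    have hN : ∀ i < t + 1, ∃ n, APowN T a n (LC a i N) := by
      intro i hi
      obtain ⟨n, hn⟩ := hP i hi
      refine ⟨n, hn.surj (LCmap a i (ModuleCat.ofHom Γ.mkQ)) ?_⟩
      intro z
      exact LC_exact₃ a hS1 i (x := z) (LC_vanish a i _ (Gam_tor a M) _)
    obtain ⟨n, hn⟩ := common_pow (t + 1) (fun i n => APowN T a n (LC a i N))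
      (fun i m n h h' => h'.mono h) hN
    obtain ⟨x, hx, hreg⟩ := exists_reg a (M ⧸ Γ) (Gam_quot a M)
    let y := x ^ n
    have hy : y ∈ a ^ n := Ideal.pow_mem_pow hx n
    have hyr : IsSMulRegular (M ⧸ Γ) y := hreg.pow n
    let φ : (M ⧸ Γ) →ₗ[R] (M ⧸ Γ) := y • LinearMap.id
    obtain ⟨w2, hS2⟩ := ses φ (LinearMap.range φ).mkQ hyr (Submodule.mkQ_surjective _)
      (by rw [LinearMap.exact_iff, Submodule.ker_mkQ])
    have hφ : (ModuleCat.ofHom φ : N ⟶ N) = y • 𝟙 N := by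
      ext z
      rfl
    have h3 : ∀ i < t, ∃ n, APowN T a n (LC a i (ModuleCat.of R ((M ⧸ Γ) ⧸ LinearMap.range φ))) :=
      fun i hi => ⟨_, APowN.exact _ _ (LC_exact₃ a hS2 i) (hn i (by omega)) (hn (i+1) (by omega))⟩
    have h4 := ih (ModuleCat.of R ((M ⧸ Γ) ⧸ LinearMap.range φ))
      (inferInstanceAs (Module.Finite R ((M ⧸ Γ) ⧸ LinearMap.range φ))) h3
    intro i hi
    rcases i with _ | i
    · have := LC_zero_FG a M
      exact AFG.of_finite
    have h5 : AFG T (LC a (i+1) N) := by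
      refine AFG.of_small _ _ (LC_exact₁ a hS2 i) (h4 i (by omega)) ?_
      intro p hp b
      obtain ⟨r, hr, h⟩ := hn (i+1) hi p hp y hy b
      refine ⟨r, hr, ?_⟩
      have hb : LCmap a (i+1) (ModuleCat.ofHom φ) b = y • b := by
        rw [hφ, LCmap_smul]
      rw [← h, ← hb]
    refine AFG.exact _ _ (LC_exact₂ a hS1 (i+1)) ?_ h5
    refine ⟨⊥, Submodule.fg_bot, fun p hp z => ⟨1, p.asIdeal.one_notMem, ?_⟩⟩
    rw [one_smul]
    exact LC_vanish a i _ (Gam_tor a M) z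
end main

/-- Primes of dimension at least `s`. -/
def TT (R : Type u) [CommRing R] (s : ℕ) : Set (PrimeSpectrum R) :=
  {p | (s : WithBot ℕ∞) ≤ Order.krullDim (Set.Ici p)}

lemma dimSupp_lt (s : ℕ) (N : Type u) [AddCommGroup N] [Module R N] :
    dimSupp R N < (s : WithBot ℕ∞) ↔
      ∀ p ∈ TT R s, ∀ n : N, ∃ r, r ∉ p.asIdeal ∧ r • n = 0 := by
  constructor
  · intro h p hp
    rw [← Module.notMem_support_iff']
    intro hps
    have h1 : Order.krullDim (Set.Ici p) ≤ Order.krullDim (Module.support R N) :=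
      Order.krullDim_le_of_strictMono
        (fun q : Set.Ici p => (⟨q.1, Module.mem_support_mono q.2 hps⟩ : Module.support R N))
        (fun x y hxy => hxy)
    exact absurd (lt_of_le_of_lt (le_trans hp h1) h) (lt_irrefl _)
  · intro h
    by_contra hc
    rw [not_lt] at hc
    obtain ⟨q, hq⟩ := Order.le_krullDim_iff.1 hc
    have hp : q.head.1 ∈ TT R s := by
      refine Order.le_krullDim_iff.2 ⟨⟨q.length, fun i => ⟨(q i).1, ?_⟩, ?_⟩, hq⟩
      · exact LTSeries.head_le q i
      · intro i
        exact q.step i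
    exact Module.notMem_support_iff'.2 (h _ hp) q.head.2

lemma inDimLT_iff (s : ℕ) (N : Type u) [AddCommGroup N] [Module R N] :
    InDimLT R s N ↔ AFG (TT R s) N := by
  unfold InDimLT AFG
  refine exists_congr fun P => and_congr_right fun _ => ?_
  rw [dimSupp_lt]
  refine forall_congr' fun p => forall_congr' fun hp => ?_
  rw [(Submodule.mkQ_surjective P).forall]
  refine forall_congr' fun n => exists_congr fun r => and_congr_right fun _ => ?_
  rw [← map_smul, ← LinearMap.mem_ker, Submodule.ker_mkQ]

lemma pow_iff (a : Ideal R) (n s : ℕ) (N : Type u) [AddCommGroup N] [Module R N] :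
    dimSupp R ↥(a ^ n • (⊤ : Submodule R N)) < (s : WithBot ℕ∞) ↔ APowN (TT R s) a n N := by
  rw [dimSupp_lt]
  refine forall_congr' fun p => forall_congr' fun hp => ?_
  constructor
  · intro h y hy z
    obtain ⟨r, hr, h⟩ := h ⟨y • z, Submodule.smul_mem_smul hy trivial⟩
    exact ⟨r, hr, congrArg Subtype.val h⟩
  · rintro h ⟨z, hz⟩
    suffices ∃ r, r ∉ p.asIdeal ∧ r • z = 0 by
      obtain ⟨r, hr, h⟩ := this
      exact ⟨r, hr, Subtype.ext h⟩
    induction hz using Submodule.smul_induction_on' with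
    | smul y hy z _ => exact h y hy z
    | add x _ y _ h1 h2 =>
      obtain ⟨r, hr, h1⟩ := h1
      obtain ⟨r', hr', h2⟩ := h2
      refine ⟨r' * r, p.2.mul_notMem hr' hr, ?_⟩
      rw [smul_add, mul_smul, h1, mul_comm, mul_smul, h2]
      simp

lemma APowN_of_AFG {T : Set (PrimeSpectrum R)} (a : Ideal R) {N : Type u} [AddCommGroup N]
    [Module R N] (htor : ∀ x : N, ∃ n, ∀ y ∈ a ^ n, y • x = 0) (h : AFG T N) :
    ∃ n, APowN T a n N := by
  obtain ⟨P, hP, h⟩ := h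
  obtain ⟨n, hn⟩ := fg_tor a P hP (fun x _ => htor x)
  refine ⟨n, fun p hp y hy x => ?_⟩
  obtain ⟨r, hr, hx⟩ := h p hp x
  exact ⟨r, hr, by rw [smul_comm, hn y hy _ hx]⟩

lemma final [IsNoetherianRing R] (a : Ideal R) (M : Type u) [AddCommGroup M] [Module R M]
    [hM : Module.Finite R M] (s t : ℕ) :
    (∀ i < t, InDimLT R s (locH R a i M)) ↔
    (∃ n : ℕ, ∀ i < t, dimSupp R ↥(a ^ n • (⊤ : Submodule R (locH R a i M))) <
      (s : WithBot ℕ∞)) := by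
  simp only [inDimLT_iff, pow_iff]
  have e : ∀ i, locH R a i M ≃ₗ[R] LC a i (ModuleCat.of R M) := fun i =>
    (exists_equiv a i M).some
  constructor
  · intro h
    refine common_pow t _ (fun i m n h h' => APowN.mono h h') fun i hi => ?_
    obtain ⟨n, hn⟩ := APowN_of_AFG a (fun x => LC_torsion a i x) ((h i hi).equiv (e i))
    exact ⟨n, hn.surj (e i).symm.toLinearMap (e i).symm.surjective⟩
  · rintro ⟨n, hn⟩ i hi
    exact (main_ind _ a t (ModuleCat.of R M) hM
      (fun i hi => ⟨n, (hn i hi).surj (e i).toLinearMap (e i).surjective⟩) i hi).equiv (e i).symm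

end LCproof

end

/-- over a complete local ring, `H^i_a(M)` is in dimension `< s`
for all `i < t` iff there is `n` with `dim Supp (a^n H^i_a(M)) < s` for all `i < t`. -/
theorem inDimLT_iff_exists_pow_smul_dim_lt (R : Type u) [CommRing R] [IsNoetherianRing R]
    [IsLocalRing R] [IsAdicComplete (IsLocalRing.maximalIdeal R) R]
    (a : Ideal R)
    (M : Type u) [AddCommGroup M] [Module R M] [Module.Finite R M] (s t : ℕ) :
    (∀ i < t, InDimLT R s (locH R a i M)) ↔
    (∃ n : ℕ, ∀ i < t,
      dimSupp R ↥(a ^ n • (⊤ : Submodule R (locH R a i M))) < (s : WithBot ℕ∞)) := by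
  exact LCproof.final a M s t
end
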